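/- arXiv:1207.0572 — 4 statements merged into one kernel-verified Lean document; each statement's English description precedes it below -/
import Mathlib

section
/- Let L be a 2-component link in R^3 consisting of two linearly embedded disjoint cycles with seven vertices in general position: a triangle ABC and a quadrilateral DEFG. If the linking number of L is zero, then L is a trivial (split) link. -/
open scoped Classical

noncomputable section

/-- Points of `ℝ³`. -/
abbrev E3 := EuclideanSpace ℝ (Fin 3)

/-- The determinant of the three vectors `a, b, c` of `ℝ³`. -/
def det3 (a b c : E3) : ℝ :=
  a 0 * (b 1 * c 2 - b 2 * c 1) - a 1 * (b 0 * c 2 - b 2 * c 0) +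
    a 2 * (b 0 * c 1 - b 1 * c 0)

/-- The open flat triangular disk with vertices `A`, `B`, `C`. -/
def OpenTri (A B C : E3) : Set E3 :=
  {x | ∃ a b c : ℝ, 0 < a ∧ 0 < b ∧ 0 < c ∧ a + b + c = 1 ∧
    x = a • A + b • B + c • C}

/-- The segment `XY` pierces the open triangular disk `ABC`. -/
def Pierces (A B C X Y : E3) : Prop :=
  (openSegment ℝ X Y ∩ OpenTri A B C).Nonempty

/-- The signed intersection of the segment `XY` with the triangle `ABC`:
`±1` if `XY` pierces the open disk of `ABC` (the sign recording on which side of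
the plane of `ABC` the point `X` lies), and `0` otherwise. -/
def edgeSign (A B C X Y : E3) : ℤ :=
  if Pierces A B C X Y then
    (if 0 < det3 (B - A) (C - A) (X - A) then 1 else -1) else 0

/-- The linking number of the straight-edge triangle `ABC` with the straight-edge
quadrilateral `DEFG`: the signed count of intersections of the edges of the
quadrilateral with the flat disk bounded by the triangle. -/
def lkTriQuad (A B C D E F G : E3) : ℤ :=
  edgeSign A B C D E + edgeSign A B C E F + edgeSign A B C F G + edgeSign A B C G D

/-- Seven points in general position: no four of them are coplanar. -/
def GenPos7 (v : Fin 7 → E3) : Prop :=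
  ∀ i j k l : Fin 7, i ≠ j → i ≠ k → i ≠ l → j ≠ k → j ≠ l → k ≠ l →
    AffineIndependent ℝ ![v i, v j, v k, v l]

/-- The closed polygonal triangle (1-complex) with vertices `A`, `B`, `C`. -/
def cycle3 (A B C : E3) : Set E3 :=
  segment ℝ A B ∪ segment ℝ B C ∪ segment ℝ C A

/-- The closed polygonal quadrilateral with vertices `D`, `E`, `F`, `G`. -/
def cycle4 (D E F G : E3) : Set E3 :=
  segment ℝ D E ∪ segment ℝ E F ∪ segment ℝ F G ∪ segment ℝ G D

/-- A two-component link `(K, L)` in `ℝ³` is split (trivial): there is an ambient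
isotopy of `ℝ³` (a continuous family of homeomorphisms starting at the identity,
with continuously varying inverses) moving `K` and `L` to opposite sides of a
plane. -/
def SplitLink (K L : Set E3) : Prop :=
  ∃ H : ℝ → (E3 ≃ₜ E3),
    Continuous (fun q : ℝ × E3 => H q.1 q.2) ∧
    Continuous (fun q : ℝ × E3 => (H q.1).symm q.2) ∧
    (∀ x, H 0 x = x) ∧
    (∀ x ∈ K, H 1 x 0 < 0) ∧ (∀ x ∈ L, 0 < H 1 x 0)

open Set Filter Topology in
/-- Transport of splitness along an explicit ambient isotopy. -/
lemma split_of_isotopy {K L : Set E3} (F Fi : ℝ → E3 → E3)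
    (hF : Continuous (fun q : ℝ × E3 => F q.1 q.2))
    (hFi : Continuous (fun q : ℝ × E3 => Fi q.1 q.2))
    (h1 : ∀ t x, Fi t (F t x) = x) (h2 : ∀ t x, F t (Fi t x) = x)
    (h0 : ∀ x, F 0 x = x) (h : SplitLink (F 1 '' K) (F 1 '' L)) : SplitLink K L := by
  obtain ⟨H, c1, c2, hz, hK, hL⟩ := h
  let Φ : ℝ → (E3 ≃ₜ E3) := fun t =>
    { toFun := F t
      invFun := Fi t
      left_inv := h1 t
      right_inv := h2 t
      continuous_toFun := hF.comp (by fun_prop : Continuous fun x : E3 => (t, x))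
      continuous_invFun := hFi.comp (by fun_prop : Continuous fun x : E3 => (t, x)) }
  refine ⟨fun t => (Φ t).trans (H t), ?_, ?_, ?_, ?_, ?_⟩
  · exact c1.comp (continuous_fst.prodMk hF)
  · exact hFi.comp (continuous_fst.prodMk c2)
  · intro x
    change H 0 (F 0 x) = x
    rw [h0, hz]
  · intro x hx
    exact hK _ ⟨x, hx, rfl⟩
  · intro x hx
    exact hL _ ⟨x, hx, rfl⟩

/-- Strict separation of two compact sets of reals. -/
lemma exists_between_compact {S T : Set ℝ} (hS : IsCompact S) (hT : IsCompact T)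
    (h : ∀ s ∈ S, ∀ t ∈ T, s < t) : ∃ c, (∀ s ∈ S, s < c) ∧ ∀ t ∈ T, c < t := by
  rcases S.eq_empty_or_nonempty with rfl | hSn
  · rcases T.eq_empty_or_nonempty with rfl | hTn
    · exact ⟨0, by simp, by simp⟩
    · obtain ⟨m, hm, hm2⟩ := hT.exists_isLeast hTn
      exact ⟨m - 1, by simp, fun t ht => by linarith [hm2 ht]⟩
  · obtain ⟨M, hM, hM2⟩ := hS.exists_isGreatest hSn
    rcases T.eq_empty_or_nonempty with rfl | hTn
    · exact ⟨M + 1, fun t ht => by linarith [hM2 ht], by simp⟩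
    · obtain ⟨m, hm, hm2⟩ := hT.exists_isLeast hTn
      have := h M hM m hm
      exact ⟨(M + m) / 2, fun t ht => by linarith [hM2 ht], fun t ht => by linarith [hm2 ht]⟩

open Set Filter Topology in
lemma isClosed_compact_add_ray {K : Set E3} (hK : IsCompact K) {w : E3} (hw : w ≠ 0)
    {R : Set ℝ} (hR : IsClosed R) : IsClosed {y : E3 | ∃ s ∈ R, y + s • w ∈ K} := by
  have e := isClosedEmbedding_smul_left (𝕜 := ℝ) (neg_ne_zero.2 hw)
  have h1 : IsClosed ((fun s : ℝ => s • (-w)) '' R) := e.isClosedMap _ hR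
  have h2 := h1.add_left_of_isCompact hK
  convert h2 using 1
  ext y
  constructor
  · rintro ⟨s, hs, hy⟩
    refine ⟨_, hy, _, ⟨s, hs, rfl⟩, ?_⟩
    simp
  · rintro ⟨k, hk, _, ⟨s, hs, rfl⟩, rfl⟩
    exact ⟨s, hs, by simpa using hk⟩

open Set Filter Topology in
/-- A continuous graph separating two compact sets fibrewise over `Y`, vanishing on `Z`. -/
lemma exists_graph {Km Kp Y Z : Set E3} (hm : IsCompact Km) (hp : IsCompact Kp)
    (hY : IsClosed Y) (hZ : IsClosed Z) {w : E3} (hw : w ≠ 0)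
    (h : ∀ y ∈ Y, ∀ s t : ℝ, y + s • w ∈ Km → y + t • w ∈ Kp → s < t)
    (hm0 : ∀ y ∈ Y, y ∈ Z → ∀ s : ℝ, y + s • w ∈ Km → s < 0)
    (hp0 : ∀ y ∈ Y, y ∈ Z → ∀ s : ℝ, y + s • w ∈ Kp → 0 < s) :
    ∃ g : E3 → ℝ, Continuous g ∧ ∀ y ∈ Y, (y ∈ Z → g y = 0) ∧
      (∀ s : ℝ, y + s • w ∈ Km → s < g y) ∧ (∀ s : ℝ, y + s • w ∈ Kp → g y < s) := by
  let t : E3 → Set ℝ := fun y => {c | y ∈ Y → (y ∈ Z → c = 0) ∧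
      (∀ s : ℝ, y + s • w ∈ Km → s < c) ∧ (∀ s : ℝ, y + s • w ∈ Kp → c < s)}
  have ht : ∀ y, Convex ℝ (t y) := by
    intro y c hc d hd a b ha hb hab hy
    obtain ⟨c1, c2, c3⟩ := hc hy
    obtain ⟨d1, d2, d3⟩ := hd hy
    refine ⟨fun hz => by simp [c1 hz, d1 hz], fun s hs => ?_, fun s hs => ?_⟩
    · exact (convex_Ioi s) (c2 s hs) (d2 s hs) ha hb hab
    · exact (convex_Iio s) (c3 s hs) (d3 s hs) ha hb hab
  have emb : ∀ y : E3, IsClosedEmbedding (fun s : ℝ => y + s • w) := fun y =>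
    (Homeomorph.addLeft y).isClosedEmbedding.comp (isClosedEmbedding_smul_left (𝕜 := ℝ) hw)
  obtain ⟨g, hg⟩ := exists_continuous_forall_mem_convex_of_local_const ht (by
    intro y0
    by_cases hy0 : y0 ∈ Y
    swap
    · refine ⟨0, ?_⟩
      filter_upwards [hY.isOpen_compl.mem_nhds hy0] with y hy hy'
      exact absurd hy' hy
    have key : ∃ c : ℝ, (∀ᶠ y in 𝓝 y0, y ∈ Y → y ∈ Z → c = 0) ∧
        (∀ s : ℝ, y0 + s • w ∈ Km → s < c) ∧ (∀ s : ℝ, y0 + s • w ∈ Kp → c < s) := by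
      by_cases hz : y0 ∈ Z
      · exact ⟨0, by simp, hm0 y0 hy0 hz, hp0 y0 hy0 hz⟩
      · obtain ⟨c, hc1, hc2⟩ := exists_between_compact ((emb y0).isCompact_preimage hm)
          ((emb y0).isCompact_preimage hp) (fun s hs t ht => h y0 hy0 s t hs ht)
        refine ⟨c, ?_, hc1, hc2⟩
        filter_upwards [hZ.isOpen_compl.mem_nhds hz] with y hy _ hy'
        exact absurd hy' hy
    obtain ⟨c, k1, k2, k3⟩ := key
    refine ⟨c, ?_⟩
    have o1 := (isClosed_compact_add_ray hm hw (isClosed_Ici (a := c))).isOpen_compl.mem_nhds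
      (x := y0) (by rintro ⟨s, hs, hh⟩; exact absurd (k2 s hh) (not_lt.2 hs))
    have o2 := (isClosed_compact_add_ray hp hw (isClosed_Iic (a := c))).isOpen_compl.mem_nhds
      (x := y0) (by rintro ⟨s, hs, hh⟩; exact absurd (k3 s hh) (not_lt.2 hs))
    filter_upwards [k1, o1, o2] with y a1 a2 a3 hy
    refine ⟨a1 hy, fun s hs => ?_, fun s hs => ?_⟩
    · by_contra hc
      exact a2 ⟨s, not_lt.1 hc, hs⟩
    · by_contra hc
      exact a3 ⟨s, not_lt.1 hc, hs⟩)
  exact ⟨g, g.continuous, fun y hy => hg y hy⟩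

/-- Shear along `w` with arbitrary continuous profile preserves splitness. -/
lemma split_of_shear {K L : Set E3} (w : E3) (f : E3 → ℝ) (hf : Continuous f)
    (hinv : ∀ (x : E3) (s : ℝ), f (x + s • w) = f x)
    (h : SplitLink ((fun x => x + f x • w) '' K) ((fun x => x + f x • w) '' L)) :
    SplitLink K L := by
  refine split_of_isotopy (fun t x => x + (t * f x) • w) (fun t x => x + (-(t * f x)) • w)
    (by fun_prop) (by fun_prop) ?_ ?_ (by simp) (by simpa using h)
  · intro t x
    simp [hinv]
  · intro t x
    rw [hinv]
    module

lemma exists_functional {w : E3} (hw : w ≠ 0) :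
    ∃ (l : E3 → ℝ) (e : E3), Continuous l ∧ (∀ x y s, l (x + s • y) = l x + s * l y) ∧
      l w = 1 ∧ l e = 0 ∧ e 0 = 1 := by
  by_cases h1 : w 1 = 0
  · by_cases h2 : w 2 = 0
    · have h0 : w 0 ≠ 0 := by
        intro h0
        apply hw
        ext i
        fin_cases i <;> simp [h0, h1, h2]
      refine ⟨fun x => (x 0 - x 1) / w 0, !₂[1, 1, 0], by fun_prop, ?_, ?_, ?_, ?_⟩
      · intro x y s
        simp
        ring
      · simp [h1, h0]
      · simp
      · simp
    · refine ⟨fun x => x 2 / w 2, !₂[1, 0, 0], by fun_prop, ?_, ?_, ?_, ?_⟩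
      · intro x y s
        simp
        ring
      · simp [h2]
      · simp
      · simp
  · refine ⟨fun x => x 1 / w 1, !₂[1, 0, 0], by fun_prop, ?_, ?_, ?_, ?_⟩
    · intro x y s
      simp
      ring
    · simp [h1]
    · simp
    · simp

/-- Two compact sets on opposite sides of a plane (in linear-functional form) are split. -/
lemma split_of_functional {K L : Set E3} (hK : IsCompact K) (hL : IsCompact L)
    (l : E3 → ℝ) (e : E3) (hl : Continuous l) (hlin : ∀ x y s, l (x + s • y) = l x + s * l y)
    (he : l e = 0) (he0 : e 0 = 1) (h1 : ∀ x ∈ K, l x < 0) (h2 : ∀ x ∈ L, 0 < l x) :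
    SplitLink K L := by
  have a1 : ∃ M1 : ℝ, ∀ M ≥ M1, ∀ x ∈ K, x 0 + M * l x < 0 := by
    rcases K.eq_empty_or_nonempty with rfl | hn
    · exact ⟨0, by simp⟩
    obtain ⟨k, hk, hk2⟩ := hK.exists_isMaxOn hn (f := fun x => x 0 / (-l x))
      ((by fun_prop : Continuous fun x : E3 => x 0).continuousOn.div hl.neg.continuousOn
        (fun x hx => by have := h1 x hx; simp; linarith))
    refine ⟨k 0 / (-l k) + 1, fun M hM x hx => ?_⟩
    have h3 : x 0 / (-l x) ≤ k 0 / (-l k) := hk2 hx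
    have h4 : 0 < - l x := by linarith [h1 x hx]
    have h5 : x 0 / (-l x) < M := by linarith
    rw [div_lt_iff₀ h4] at h5
    linarith
  have a2 : ∃ M1 : ℝ, ∀ M ≥ M1, ∀ x ∈ L, 0 < x 0 + M * l x := by
    rcases L.eq_empty_or_nonempty with rfl | hn
    · exact ⟨0, by simp⟩
    obtain ⟨k, hk, hk2⟩ := hL.exists_isMaxOn hn (f := fun x => (- x 0) / (l x))
      ((by fun_prop : Continuous fun x : E3 => - x 0).continuousOn.div hl.continuousOn
        (fun x hx => by have := h2 x hx; linarith))
    refine ⟨(-k 0) / (l k) + 1, fun M hM x hx => ?_⟩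
    have h3 : (-x 0) / (l x) ≤ (-k 0) / (l k) := hk2 hx
    have h4 : 0 < l x := h2 x hx
    have h5 : (-x 0) / (l x) < M := by linarith
    rw [div_lt_iff₀ h4] at h5
    linarith
  obtain ⟨M1, b1⟩ := a1
  obtain ⟨M2, b2⟩ := a2
  refine split_of_shear e (fun x => max M1 M2 * l x) (by fun_prop) ?_ ?_
  · intro x s
    simp [hlin, he]
  · refine ⟨fun _ => Homeomorph.refl _, continuous_snd, continuous_snd, fun x => rfl, ?_, ?_⟩
    · rintro _ ⟨x, hx, rfl⟩
      simpa [he0] using b1 _ (le_max_left _ _) x hx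
    · rintro _ ⟨x, hx, rfl⟩
      simpa [he0] using b2 _ (le_max_right _ _) x hx

/-- If `K` lies below `L` in the direction `w`, the link is split. -/
lemma split_of_below {K L : Set E3} (hK : IsCompact K) (hL : IsCompact L) {w : E3} (hw : w ≠ 0)
    (h : ∀ x ∈ K, ∀ s : ℝ, x + s • w ∈ L → 0 < s) : SplitLink K L := by
  obtain ⟨l, e, hl, hlin, lw, le, e0⟩ := exists_functional hw
  obtain ⟨g, hg, hg2⟩ := exists_graph (Y := Set.univ) (Z := ∅) hK hL isClosed_univ isClosed_empty
    hw (by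
      intro y _ s t hs ht
      have := h _ hs (t - s) (by convert ht using 1; module)
      linarith) (by simp) (by simp)
  have hP : ∀ x, x = (x + (-l x) • w) + l x • w := fun x => by module
  refine split_of_shear w (fun x => - g (x + (-l x) • w)) (by fun_prop) ?_ ?_
  · intro x s
    simp only [hlin, lw]
    congr 2
    module
  · have cS : Continuous fun x : E3 => x + (- g (x + (-l x) • w)) • w := by fun_prop
    refine split_of_functional (hK.image cS) (hL.image cS) l e hl hlin le e0 ?_ ?_
    · rintro _ ⟨x, hx, rfl⟩
      have := (hg2 (x + (-l x) • w) trivial).2.1 (l x) (by rwa [← hP x])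
      simp only [hlin, lw]
      linarith
    · rintro _ ⟨x, hx, rfl⟩
      have := (hg2 (x + (-l x) • w) trivial).2.2 (l x) (by rwa [← hP x])
      simp only [hlin, lw]
      linarith

open Set Filter Topology in
/-- If `K` lies in a compact convex set disjoint from `L`, and some ray issued from that
convex set misses `L`, then the link is split. -/
lemma split_of_convex {K L C : Set E3} (hK : IsCompact K) (hL : IsCompact L) (hC : IsCompact C)
    (hCc : Convex ℝ C) (hKC : K ⊆ C) (hd : Disjoint C L) {p u : E3} (hp : p ∈ C) (hu : u ≠ 0)
    (hray : ∀ s : ℝ, 0 ≤ s → p + s • u ∉ L) : SplitLink K L := by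
  obtain ⟨δ, hδ, hδd⟩ := hd.exists_thickenings hC hL.isClosed
  set V : Set E3 := (fun x => p + x) ⁻¹' (Metric.thickening δ C) with hV
  have Vc : Convex ℝ V := (hCc.thickening δ).translate_preimage_right p
  have Vo : IsOpen V := Metric.isOpen_thickening.preimage (by fun_prop)
  have V0 : (0 : E3) ∈ V := by
    simpa [hV] using Metric.self_subset_thickening hδ C hp
  have gc : Continuous (gauge V) := continuous_gauge Vc (Vo.mem_nhds V0)
  have gV : {x | gauge V x < 1} = V := setOfPred_gauge_lt_one_eq_self_of_isOpen Vc V0 Vo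
  set g : E3 → ℝ := gauge V with hg
  have g0 : ∀ x, 0 ≤ g x := fun x => gauge_nonneg x
  have gs : ∀ (k : ℝ) x, 0 ≤ k → g (k • x) = k * g x := fun k x hk => by
    rw [hg, gauge_smul_of_nonneg hk]; rfl
  have gL : ∀ x ∈ L, 1 ≤ g (x - p) := by
    intro x hx
    by_contra hc
    have h1 : x - p ∈ V := by rw [← gV]; exact not_le.1 hc
    have h2 : x ∈ Metric.thickening δ C := by simpa [hV] using h1
    exact Set.disjoint_left.1 hδd h2 (Metric.self_subset_thickening hδ L hx)
  have gC : ∃ θ : ℝ, 0 < θ ∧ θ < 1 ∧ ∀ x ∈ C, g (x - p) ≤ θ := by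
    obtain ⟨k, hk, hk2⟩ := hC.exists_isMaxOn ⟨p, hp⟩ (f := fun x => g (x - p))
      (by fun_prop : Continuous fun x : E3 => g (x - p)).continuousOn
    have h1 : k - p ∈ V := by
      simpa [hV] using Metric.self_subset_thickening hδ C hk
    have h2 : g (k - p) < 1 := by rw [← gV] at h1; exact h1
    refine ⟨max (g (k - p)) (1 / 2), by positivity, max_lt h2 (by norm_num), fun x hx => ?_⟩
    exact le_trans (hk2 hx) (le_max_left _ _)
  obtain ⟨θ, θ0, θ1, hθ⟩ := gC
  have hr : ∃ r : ℝ, 0 < r ∧ ∀ x ∈ L, ∀ s : ℝ, 0 ≤ s → r ≤ ‖x - p - s • u‖ := by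
    have hcl : IsClosed ((fun s : ℝ => p + s • u) '' Set.Ici 0) :=
      ((Homeomorph.addLeft p).isClosedEmbedding.comp
        (isClosedEmbedding_smul_left (𝕜 := ℝ) hu)).isClosedMap _ isClosed_Ici
    have hdj : Disjoint L ((fun s : ℝ => p + s • u) '' Set.Ici 0) := by
      rw [Set.disjoint_left]
      rintro x hx ⟨s, hs, rfl⟩
      exact hray s hs hx
    obtain ⟨r, hr, hrd⟩ := hdj.exists_thickenings hL hcl
    refine ⟨r, hr, fun x hx s hs => ?_⟩
    by_contra hc
    refine Set.disjoint_left.1 hrd (Metric.self_subset_thickening hr _ hx) ?_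
    rw [Metric.mem_thickening_iff]
    refine ⟨p + s • u, ⟨s, hs, rfl⟩, ?_⟩
    rw [dist_eq_norm]
    rw [← sub_sub] at *
    exact not_le.1 hc
  obtain ⟨r, r0, hr⟩ := hr
  obtain ⟨R, hR⟩ := (hK.isBounded).exists_norm_le
  have hR' : ∀ x ∈ K, ‖x - p‖ ≤ |R| + ‖p‖ := fun x hx =>
    (norm_sub_le _ _).trans (by linarith [hR x hx, le_abs_self R])
  obtain ⟨N, hN⟩ := exists_pow_lt_of_lt_one (show 0 < r / (|R| + ‖p‖ + 1) by positivity) θ1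
  have hN' : θ ^ N * (|R| + ‖p‖) < r := by
    rw [lt_div_iff₀ (by positivity)] at hN
    have : 0 < θ ^ N := by positivity
    linarith
  have mpos : ∀ x, 0 < max (g x) θ := fun x => lt_of_lt_of_le θ0 (le_max_right _ _)
  have mpos' : ∀ y : ℝ, 0 < max y θ := fun x => lt_of_lt_of_le θ0 (le_max_right _ _)
  refine split_of_isotopy
    (fun t x => p + ((max (g (x - p)) θ) ^ ((N : ℝ) * |t|)) • (x - p))
    (fun t x => p + ((max ((g (x - p)) ^ (1 / (1 + (N : ℝ) * |t|))) θ) ^ (-((N : ℝ) * |t|)))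
      • (x - p)) ?_ ?_ ?_ ?_ ?_ ?_
  · have cm : Continuous fun q : ℝ × E3 => (max (g (q.2 - p)) θ) ^ ((N : ℝ) * |q.1|) :=
      Continuous.rpow (by fun_prop) (by fun_prop) (fun q => Or.inl (mpos _).ne')
    exact continuous_const.add (cm.smul (continuous_snd.sub continuous_const))
  · have ci : Continuous fun q : ℝ × E3 => 1 / (1 + (N : ℝ) * |q.1|) :=
      continuous_const.div (by fun_prop) (fun q => by positivity)
    have cj : Continuous fun q : ℝ × E3 => (g (q.2 - p)) ^ (1 / (1 + (N : ℝ) * |q.1|)) :=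
      Continuous.rpow (by fun_prop) ci (fun q => Or.inr (by positivity))
    have cm : Continuous fun q : ℝ × E3 =>
        (max ((g (q.2 - p)) ^ (1 / (1 + (N : ℝ) * |q.1|))) θ) ^ (-((N : ℝ) * |q.1|)) :=
      Continuous.rpow (cj.max continuous_const) (by fun_prop) (fun q => Or.inl (mpos' _).ne')
    exact continuous_const.add (cm.smul (continuous_snd.sub continuous_const))
  · intro t x
    set s := (N : ℝ) * |t| with hs
    have s0 : 0 ≤ s := by positivity
    set y := x - p with hy
    have hx : x = p + y := by simp [hy]
    set M := (max (g y) θ) ^ s with hM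
    have M0 : 0 < M := Real.rpow_pos_of_pos (mpos y) _
    simp only [add_sub_cancel_left]
    rw [gs M y M0.le]
    have key : max ((M * g y) ^ (1 / (1 + s))) θ = max (g y) θ := by
      rcases le_total θ (g y) with h | h
      · have gp : 0 < g y := lt_of_lt_of_le θ0 h
        have : M * g y = (g y) ^ (1 + s) := by
          rw [hM, max_eq_left h, Real.rpow_add gp, Real.rpow_one, mul_comm]
        rw [this, ← Real.rpow_mul (g0 y), mul_one_div_cancel (by positivity), Real.rpow_one]
      · have h3 : M * g y ≤ θ ^ (1 + s) := by
          rw [hM, max_eq_right h, Real.rpow_add θ0, Real.rpow_one, mul_comm]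
          gcongr
        have h4 : (M * g y) ^ (1 / (1 + s)) ≤ (θ ^ (1 + s)) ^ (1 / (1 + s)) :=
          Real.rpow_le_rpow (mul_nonneg M0.le (g0 y)) h3 (by positivity)
        rw [← Real.rpow_mul θ0.le, mul_one_div_cancel (by positivity), Real.rpow_one] at h4
        rw [max_eq_right h4, max_eq_right h]
    rw [key, smul_smul, hM, ← Real.rpow_add (mpos y)]
    simp [hx]
  · intro t x
    set s := (N : ℝ) * |t| with hs
    have s0 : 0 ≤ s := by positivity
    set y := x - p with hy
    have hx : x = p + y := by simp [hy]
    set a := (g y) ^ (1 / (1 + s)) with ha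
    have a0 : 0 ≤ a := Real.rpow_nonneg (g0 y) _
    have ga : g y = a ^ (1 + s) := by
      rw [ha, ← Real.rpow_mul (g0 y), one_div_mul_cancel (by positivity), Real.rpow_one]
    set M := (max a θ) ^ (-s) with hM
    have M0 : 0 < M := Real.rpow_pos_of_pos (mpos' a) _
    simp only [add_sub_cancel_left]
    rw [gs M y M0.le]
    have key : max (M * g y) θ = max a θ := by
      rcases le_total θ a with h | h
      · have gp : 0 < a := lt_of_lt_of_le θ0 h
        have : M * g y = a := by
          rw [ga, hM, max_eq_left h, ← Real.rpow_add gp]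
          simp
        rw [this]
      · have h3 : M * g y ≤ θ := by
          have : a ^ (1 + s) ≤ θ ^ (1 + s) := Real.rpow_le_rpow a0 h (by positivity)
          calc M * g y ≤ M * θ ^ (1 + s) := by rw [ga]; gcongr
            _ = θ := by
              rw [hM, max_eq_right h, ← Real.rpow_add θ0]
              simp
        rw [max_eq_right h3, max_eq_right h]
    rw [key, smul_smul, hM, ← Real.rpow_add (mpos' a)]
    simp [hx]
  · intro x
    simp
  · have cF : Continuous fun x : E3 =>
        p + ((max (g (x - p)) θ) ^ ((N : ℝ) * |(1 : ℝ)|)) • (x - p) := by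
      have cm : Continuous fun x : E3 => (max (g (x - p)) θ) ^ ((N : ℝ) * |(1 : ℝ)|) :=
        Continuous.rpow (by fun_prop) (by fun_prop) (fun q => Or.inl (mpos _).ne')
      exact continuous_const.add (cm.smul (continuous_id.sub continuous_const))
    refine split_of_below (hK.image cF) (hL.image cF) (neg_ne_zero.2 hu) ?_
    rintro _ ⟨k, hk, rfl⟩ s ⟨x, hx, hxe⟩
    by_contra hs
    have hs' : 0 ≤ -s := by linarith
    simp only [abs_one, mul_one, Real.rpow_natCast] at hxe
    have e1 : max (g (k - p)) θ = θ := max_eq_right (hθ k (hKC hk))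
    have e2 : max (g (x - p)) θ = g (x - p) := max_eq_left (by linarith [gL x hx])
    rw [e1, e2] at hxe
    set lam := g (x - p) ^ N with hlam
    have lam1 : 1 ≤ lam := one_le_pow₀ (gL x hx)
    have lam0 : 0 < lam := by linarith
    have e3 : x - p - ((-s) / lam) • u = (lam⁻¹ * θ ^ N) • (k - p) := by
      have e4 : lam • (x - p) = θ ^ N • (k - p) + (-s) • u := by
        have := congrArg (fun y => y - p) hxe
        simp only [add_sub_cancel_left] at this
        rw [this]
        module
      have e5 : x - p = lam⁻¹ • (lam • (x - p)) := by
        rw [smul_smul, inv_mul_cancel₀ lam0.ne', one_smul]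
      rw [e5, e4, smul_add, smul_smul, smul_smul, div_eq_inv_mul]
      abel
    have e6 := hr x hx ((-s) / lam) (by positivity)
    rw [e3, norm_smul, Real.norm_of_nonneg (by positivity)] at e6
    have e7 : lam⁻¹ ≤ 1 := inv_le_one_of_one_le₀ lam1
    have e8 : lam⁻¹ * θ ^ N * ‖k - p‖ ≤ 1 * θ ^ N * (|R| + ‖p‖) := by
      gcongr
      exact hR' k hk
    linarith

/-- Dual coordinates of a frame `u, v, w` of `ℝ³`. -/
structure Frame3 (u v w : E3) (b c z : E3 →L[ℝ] ℝ) : Prop where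
  rep : ∀ x, x = b x • u + c x • v + z x • w
  bu : b u = 1
  bv : b v = 0
  bw : b w = 0
  cu : c u = 0
  cv : c v = 1
  cw : c w = 0
  zu : z u = 0
  zv : z v = 0
  zw : z w = 1

lemma exists_frame (u v w : E3) (h : det3 u v w ≠ 0) :
    ∃ b c z : E3 →L[ℝ] ℝ, Frame3 u v w b c z ∧ ∀ x, z x = det3 u v x / det3 u v w := by
  let b0 : E3 →ₗ[ℝ] ℝ :=
    { toFun := fun x => det3 x v w / det3 u v w
      map_add' := fun x y => by simp [det3]; ring
      map_smul' := fun x y => by simp [det3]; ring }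
  let c0 : E3 →ₗ[ℝ] ℝ :=
    { toFun := fun x => det3 u x w / det3 u v w
      map_add' := fun x y => by simp [det3]; ring
      map_smul' := fun x y => by simp [det3]; ring }
  let z0 : E3 →ₗ[ℝ] ℝ :=
    { toFun := fun x => det3 u v x / det3 u v w
      map_add' := fun x y => by simp [det3]; ring
      map_smul' := fun x y => by simp [det3]; ring }
  refine ⟨b0.toContinuousLinearMap, c0.toContinuousLinearMap, z0.toContinuousLinearMap, ?_,
    fun x => rfl⟩
  constructor
  · intro x
    change x = (det3 x v w / det3 u v w) • u + (det3 u x w / det3 u v w) • v +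
      (det3 u v x / det3 u v w) • w
    have key : det3 u v w • x = det3 x v w • u + det3 u x w • v + det3 u v x • w := by
      ext i
      fin_cases i <;> simp [det3] <;> ring
    have e : x = (det3 u v w)⁻¹ • (det3 u v w • x) := by
      rw [smul_smul, inv_mul_cancel₀ h, one_smul]
    calc x = (det3 u v w)⁻¹ • (det3 u v w • x) := e
      _ = _ := by
        rw [key]
        simp only [smul_add, smul_smul, div_eq_inv_mul]
  · exact div_self h
  · change det3 v v w / _ = 0
    rw [div_eq_zero_iff]; left; simp [det3]; ring
  · change det3 w v w / _ = 0
    rw [div_eq_zero_iff]; left; simp [det3]; ring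
  · change det3 u u w / _ = 0
    rw [div_eq_zero_iff]; left; simp [det3]; ring
  · exact div_self h
  · change det3 u w w / _ = 0
    rw [div_eq_zero_iff]; left; simp [det3]; ring
  · change det3 u v u / _ = 0
    rw [div_eq_zero_iff]; left; simp [det3]; ring
  · change det3 u v v / _ = 0
    rw [div_eq_zero_iff]; left; simp [det3]; ring
  · exact div_self h

/-- The closed flat triangle in coordinates. -/
def CTri (A : E3) (b c z : E3 →L[ℝ] ℝ) : Set E3 :=
  {x | z (x - A) = 0 ∧ 0 ≤ b (x - A) ∧ 0 ≤ c (x - A) ∧ b (x - A) + c (x - A) ≤ 1}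

lemma CTri_convex (A : E3) (b c z : E3 →L[ℝ] ℝ) : Convex ℝ (CTri A b c z) := by
  rintro x ⟨x1, x2, x3, x4⟩ y ⟨y1, y2, y3, y4⟩ s t hs ht hst
  have e : s • x + t • y - A = s • (x - A) + t • (y - A) := by
    have : A = (s + t) • A := by rw [hst, one_smul]
    nth_rewrite 1 [this]
    module
  refine ⟨?_, ?_, ?_, ?_⟩ <;> simp only [e, map_add, map_smul, smul_eq_mul]
  · simp [x1, y1]
  · positivity
  · positivity
  · nlinarith

lemma CTri_compact {A u v w : E3} {b c z : E3 →L[ℝ] ℝ} (hf : Frame3 u v w b c z) :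
    IsCompact (CTri A b c z) := by
  have h1 : IsCompact ((fun q : ℝ × ℝ => A + q.1 • u + q.2 • v) ''
      (Set.Icc 0 1 ×ˢ Set.Icc 0 1)) :=
    (isCompact_Icc.prod isCompact_Icc).image (by fun_prop)
  refine h1.of_isClosed_subset ?_ ?_
  · have i1 : IsClosed {x : E3 | z (x - A) = 0} := isClosed_eq (by fun_prop) (by fun_prop)
    have i2 : IsClosed {x : E3 | 0 ≤ b (x - A)} := isClosed_le (by fun_prop) (by fun_prop)
    have i3 : IsClosed {x : E3 | 0 ≤ c (x - A)} := isClosed_le (by fun_prop) (by fun_prop)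
    have i4 : IsClosed {x : E3 | b (x - A) + c (x - A) ≤ 1} :=
      isClosed_le (by fun_prop) (by fun_prop)
    exact i1.inter (i2.inter (i3.inter i4))
  · rintro x ⟨x1, x2, x3, x4⟩
    refine ⟨(b (x - A), c (x - A)), ⟨⟨x2, by dsimp only; linarith⟩, x3, by dsimp only; linarith⟩, ?_⟩
    have := hf.rep (x - A)
    rw [x1, zero_smul, add_zero] at this
    dsimp only
    rw [add_assoc, ← this]
    abel

lemma Frame3.w_ne {u v w : E3} {b c z : E3 →L[ℝ] ℝ} (hf : Frame3 u v w b c z) : w ≠ 0 := by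
  rintro rfl
  have := hf.zw
  simp at this

/-- Separation of a polygon by a graph over the triangle implies splitness. -/
lemma split_of_graph {A u v w : E3} {b c z : E3 →L[ℝ] ℝ} (hf : Frame3 u v w b c z)
    {K Qp Qm : Set E3} (hK : IsCompact K) (hp : IsCompact Qp) (hm : IsCompact Qm)
    (hKT : K ⊆ CTri A b c z)
    (h3 : ∀ y ∈ CTri A b c z, ∀ s t : ℝ, y + s • w ∈ Qm → y + t • w ∈ Qp → s < t)
    (h1 : ∀ y ∈ K, ∀ s : ℝ, y + s • w ∈ Qm → s < 0)
    (h2 : ∀ y ∈ K, ∀ s : ℝ, y + s • w ∈ Qp → 0 < s)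
    (hpt : ∃ p ∈ CTri A b c z, ∀ s : ℝ, p + s • w ∉ Qp ∪ Qm) :
    SplitLink K (Qp ∪ Qm) := by
  have hT := CTri_compact (A := A) hf
  obtain ⟨g, hg, hg2⟩ := exists_graph hm hp hT.isClosed hK.isClosed hf.w_ne h3
    (fun y _ hy => h1 y hy) (fun y _ hy => h2 y hy)
  have hP : ∀ x, x = (x + (-z (x - A)) • w) + z (x - A) • w := fun x => by module
  have zlin : ∀ (x : E3) (s : ℝ), z (x + s • w - A) = z (x - A) + s := by
    intro x s
    rw [add_sub_right_comm, map_add, map_smul, hf.zw, smul_eq_mul, mul_one]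
  have cS : Continuous fun x : E3 => x + (- g (x + (-z (x - A)) • w)) • w := by fun_prop
  have hinv : ∀ (x : E3) (s : ℝ), x + s • w + (-z (x + s • w - A)) • w
      = x + (-z (x - A)) • w := by
    intro x s
    rw [zlin]
    module
  refine split_of_shear w (fun x => - g (x + (-z (x - A)) • w)) (by fun_prop) ?_ ?_
  · intro x s
    simp only [hinv]
  have fixK : (fun x => x + (- g (x + (-z (x - A)) • w)) • w) '' K = K := by
    have : ∀ x ∈ K, x + (- g (x + (-z (x - A)) • w)) • w = x := by
      intro x hx
      rw [(hKT hx).1, neg_zero, zero_smul, add_zero, (hg2 x (hKT hx)).1 hx]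
      simp
    ext y
    constructor
    · rintro ⟨x, hx, rfl⟩
      dsimp only
      rwa [this x hx]
    · intro hy
      exact ⟨y, hy, this y hy⟩
  rw [fixK]
  obtain ⟨p, hpT, hpl⟩ := hpt
  have back : ∀ y ∈ CTri A b c z, ∀ (s : ℝ) (x : E3),
      x + (- g (x + (-z (x - A)) • w)) • w = y + s • w → x = y + (s + g y) • w := by
    intro y hy s x hx
    have e := hinv x (- g (x + (-z (x - A)) • w))
    rw [hx, hinv, hy.1, neg_zero, zero_smul, add_zero] at e
    rw [← e] at hx
    rw [add_smul, ← add_assoc, ← hx]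
    module
  refine split_of_convex hK ((hp.union hm).image cS) hT (CTri_convex A b c z) hKT ?_ hpT hf.w_ne ?_
  · rw [Set.disjoint_left]
    rintro y hy ⟨x, hx, hxy⟩
    have e := back y hy 0 x (by simpa using hxy)
    rw [zero_add] at e
    rw [e] at hx
    rcases hx with hx | hx
    · exact lt_irrefl _ ((hg2 y hy).2.2 _ hx)
    · exact lt_irrefl _ ((hg2 y hy).2.1 _ hx)
  · rintro s - ⟨x, hx, hxy⟩
    have e := back p hpT s x hxy
    rw [e] at hx
    exact hpl _ hx

lemma finite_quadratic (α β k : ℝ) (h : ¬ (α = 0 ∧ β = 0)) :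
    {τ : ℝ | α * τ + β * τ ^ 2 = k}.Finite := by
  have hne : (Polynomial.C β * Polynomial.X ^ 2 + Polynomial.C α * Polynomial.X
      - Polynomial.C k : Polynomial ℝ) ≠ 0 := by
    intro h0
    have c1 := congrArg (fun P => Polynomial.coeff P 1) h0
    have c2 := congrArg (fun P => Polynomial.coeff P 2) h0
    simp [Polynomial.coeff_X, Polynomial.coeff_C] at c1 c2
    exact h ⟨c1, c2⟩
  refine (Polynomial.finite_setOfPred_isRoot hne).subset ?_
  intro τ hτ
  have hτ' : α * τ + β * τ ^ 2 = k := hτ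
  simp [Polynomial.IsRoot]
  linarith

lemma finite_bad {A u v w : E3} {b c z : E3 →L[ℝ] ℝ} (hf : Frame3 u v w b c z) (X Y : E3) :
    {τ : ℝ | ∃ s : ℝ, A + τ • u + τ ^ 2 • v + s • w ∈ segment ℝ X Y}.Finite := by
  obtain ⟨β, γ, hne, h0⟩ : ∃ β γ : ℝ, ¬ (β = 0 ∧ γ = 0) ∧ β * b (Y - X) + γ * c (Y - X) = 0 := by
    by_cases h : b (Y - X) = 0 ∧ c (Y - X) = 0
    · exact ⟨1, 0, by simp, by simp [h.1]⟩
    · refine ⟨c (Y - X), - b (Y - X), ?_, by ring⟩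
      rintro ⟨h1, h2⟩
      exact h ⟨by linarith, h1⟩
  refine (finite_quadratic β γ (β * b (X - A) + γ * c (X - A)) hne).subset ?_
  rintro τ ⟨s, hs⟩
  rw [segment_eq_image'] at hs
  obtain ⟨θ, -, hθ⟩ := hs
  have e : τ • u + τ ^ 2 • v + s • w = (X - A) + θ • (Y - X) := by
    have : τ • u + τ ^ 2 • v + s • w = (A + τ • u + τ ^ 2 • v + s • w) - A := by abel
    rw [this, ← hθ]
    dsimp only
    module
  have eb := congrArg b e
  have ec := congrArg c e
  simp only [map_add, map_smul, hf.bu, hf.bv, hf.bw, hf.cu, hf.cv, hf.cw, smul_eq_mul] at eb ec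
  change β * τ + γ * τ ^ 2 = _
  linear_combination β * eb + γ * ec + θ * h0

lemma exists_good_point {A u v w : E3} {b c z : E3 →L[ℝ] ℝ} (hf : Frame3 u v w b c z)
    (D E F G : E3) : ∃ p ∈ CTri A b c z, ∀ s : ℝ, p + s • w ∉ cycle4 D E F G := by
  have hfin := (((finite_bad (A := A) hf D E).union (finite_bad (A := A) hf E F)).union
    (finite_bad (A := A) hf F G)).union (finite_bad (A := A) hf G D)
  have hinf : (Set.Ioo (0 : ℝ) (1 / 2)).Infinite := Set.Ioo_infinite (by norm_num)
  obtain ⟨τ, hτ, hτn⟩ := (hinf.sdiff hfin).nonempty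
  refine ⟨A + τ • u + τ ^ 2 • v, ?_, ?_⟩
  · have e : A + τ • u + τ ^ 2 • v - A = τ • u + τ ^ 2 • v := by abel
    have h1 := hτ.1
    have h2 := hτ.2
    refine ⟨?_, ?_, ?_, ?_⟩ <;>
      simp only [e, map_add, map_smul, hf.bu, hf.bv, hf.cu, hf.cv, hf.zu, hf.zv, smul_eq_mul]
    · ring
    · linarith
    · positivity
    · nlinarith
  · intro s hs
    apply hτn
    rcases hs with ((h | h) | h) | h
    · exact Or.inl (Or.inl (Or.inl ⟨s, h⟩))
    · exact Or.inl (Or.inl (Or.inr ⟨s, h⟩))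
    · exact Or.inl (Or.inr ⟨s, h⟩)
    · exact Or.inr ⟨s, h⟩

lemma exists_shrink_const {Q : Set E3} (hQ : IsCompact Q) {f ζ : E3 → ℝ} (hf : Continuous f)
    (hζ : Continuous ζ) (h : ∀ q ∈ Q, ζ q = 0 → 0 < f q) :
    ∃ N0 : ℝ, ∀ N ≥ N0, ∀ q ∈ Q, ζ q ≤ 0 → 0 < N * (-ζ q) / 3 + f q := by
  set Q' : Set E3 := Q ∩ ({q | ζ q ≤ 0} ∩ {q | f q ≤ 0}) with hQ'
  have cQ' : IsCompact Q' := hQ.inter_right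
    ((isClosed_le hζ continuous_const).inter (isClosed_le hf continuous_const))
  have neg : ∀ q ∈ Q', 0 < -ζ q := by
    rintro q ⟨h1, h2, h3⟩
    have h2' : ζ q ≤ 0 := h2
    have h3' : f q ≤ 0 := h3
    rcases h2'.lt_or_eq with h4 | h4
    · linarith
    · have := h q h1 h4
      linarith
  have : ∃ M : ℝ, ∀ q ∈ Q', (-f q) / (-ζ q) ≤ M := by
    rcases Q'.eq_empty_or_nonempty with h0 | h0
    · exact ⟨0, by simp [h0]⟩
    obtain ⟨k, hk, hk2⟩ := cQ'.exists_isMaxOn h0 (f := fun q => (-f q) / (-ζ q))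
      (hf.neg.continuousOn.div hζ.neg.continuousOn (fun q hq => (neg q hq).ne'))
    exact ⟨_, fun q hq => hk2 hq⟩
  obtain ⟨M, hM⟩ := this
  refine ⟨max 0 (3 * (M + 1)), fun N hN q hq hz => ?_⟩
  have N0 : 0 ≤ N := le_trans (le_max_left _ _) hN
  have N1 : 3 * (M + 1) ≤ N := le_trans (le_max_right _ _) hN
  by_cases h1 : f q ≤ 0
  · have n := neg q ⟨hq, hz, h1⟩
    have h2 := hM q ⟨hq, hz, h1⟩
    rw [div_le_iff₀ n] at h2
    nlinarith
  · have : 0 ≤ N * (-ζ q) := mul_nonneg N0 (by linarith)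
    linarith [not_le.1 h1]

/-- If the polygon meets the plane of the triangle only inside the open triangle, the link
is split. -/
lemma split_of_inside {A u v w : E3} {b c z : E3 →L[ℝ] ℝ} (hf : Frame3 u v w b c z)
    {K Q : Set E3} (hK : IsCompact K) (hQ : IsCompact Q)
    (hK1 : ∀ x ∈ K, z (x - A) = 0)
    (hK2 : ∀ x ∈ K, ¬ (0 < b (x - A) ∧ 0 < c (x - A) ∧ 0 < 1 - b (x - A) - c (x - A)))
    (hQ1 : ∀ x ∈ Q, z (x - A) = 0 →
      0 < b (x - A) ∧ 0 < c (x - A) ∧ 0 < 1 - b (x - A) - c (x - A)) :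
    SplitLink K Q := by
  obtain ⟨N1, hN1⟩ := exists_shrink_const hQ (f := fun x => b (x - A)) (ζ := fun x => z (x - A))
    (by fun_prop) (by fun_prop) (fun q hq h => (hQ1 q hq h).1)
  obtain ⟨N2, hN2⟩ := exists_shrink_const hQ (f := fun x => c (x - A)) (ζ := fun x => z (x - A))
    (by fun_prop) (by fun_prop) (fun q hq h => (hQ1 q hq h).2.1)
  obtain ⟨N3, hN3⟩ := exists_shrink_const hQ (f := fun x => 1 - b (x - A) - c (x - A))
    (ζ := fun x => z (x - A)) (by fun_prop) (by fun_prop) (fun q hq h => (hQ1 q hq h).2.2)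
  obtain ⟨N, n0, n1, n2, n3⟩ : ∃ N : ℝ, 0 ≤ N ∧ N1 ≤ N ∧ N2 ≤ N ∧ N3 ≤ N :=
    ⟨max (max 0 N1) (max N2 N3), by simp, by simp, by simp, by simp⟩
  -- horizontal scaling about the barycentre
  let S : ℝ → E3 → E3 := fun m x =>
    x + ((m - 1) * (b (x - A) - 1 / 3)) • u + ((m - 1) * (c (x - A) - 1 / 3)) • v
  have Sb : ∀ m x, b (S m x - A) = 1 / 3 + m * (b (x - A) - 1 / 3) := by
    intro m x
    simp only [S, add_sub_right_comm, map_add, map_smul, hf.bu, hf.bv, smul_eq_mul]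
    ring
  have Sc : ∀ m x, c (S m x - A) = 1 / 3 + m * (c (x - A) - 1 / 3) := by
    intro m x
    simp only [S, add_sub_right_comm, map_add, map_smul, hf.cu, hf.cv, smul_eq_mul]
    ring
  have Sz : ∀ m x, z (S m x - A) = z (x - A) := by
    intro m x
    simp only [S, add_sub_right_comm, map_add, map_smul, hf.zu, hf.zv, smul_eq_mul]
    ring
  have S1 : ∀ x, S 1 x = x := by
    intro x
    simp [S]
  have SS : ∀ m n x, m * n = 1 → S m (S n x) = x := by
    intro m n x hmn
    change S n x + ((m - 1) * (b (S n x - A) - 1 / 3)) • u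
      + ((m - 1) * (c (S n x - A) - 1 / 3)) • v = x
    rw [Sb, Sc]
    simp only [S]
    have e1 : (m - 1) * (1 / 3 + n * (b (x - A) - 1 / 3) - 1 / 3)
        = -((n - 1) * (b (x - A) - 1 / 3)) := by
      linear_combination (b (x - A) - 1 / 3) * hmn
    have e2 : (m - 1) * (1 / 3 + n * (c (x - A) - 1 / 3) - 1 / 3)
        = -((n - 1) * (c (x - A) - 1 / 3)) := by
      linear_combination (c (x - A) - 1 / 3) * hmn
    rw [e1, e2]
    module
  let μ : ℝ → E3 → ℝ := fun t x => 1 + |t| * N * max 0 (-z (x - A))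
  have μpos : ∀ t x, 0 < μ t x := by
    intro t x
    have : 0 ≤ |t| * N * max 0 (-z (x - A)) := by positivity
    change 0 < 1 + |t| * N * max 0 (-z (x - A))
    linarith
  have μS : ∀ t m x, μ t (S m x) = μ t x := by
    intro t m x
    simp only [μ, Sz]
  have μc : Continuous fun q : ℝ × E3 => μ q.1 q.2 := by
    simp only [μ]
    fun_prop
  have μc' : Continuous fun q : ℝ × E3 => (μ q.1 q.2)⁻¹ := μc.inv₀ (fun q => (μpos _ _).ne')
  have c1 : Continuous fun q : ℝ × E3 => S (μ q.1 q.2)⁻¹ q.2 := by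
    simp only [S]
    fun_prop
  have c2 : Continuous fun q : ℝ × E3 => S (μ q.1 q.2) q.2 := by
    simp only [S]
    fun_prop
  refine split_of_isotopy (fun t x => S (μ t x)⁻¹ x) (fun t x => S (μ t x) x) c1 c2 ?_ ?_ ?_ ?_
  · intro t x
    simp only [μS]
    exact SS _ _ _ (mul_inv_cancel₀ (μpos t x).ne')
  · intro t x
    simp only [μS]
    exact SS _ _ _ (inv_mul_cancel₀ (μpos t x).ne')
  · intro x
    simp [μ, S1]
  · have c3 : Continuous fun x : E3 => S (μ 1 x)⁻¹ x :=
      c1.comp (by fun_prop : Continuous fun x : E3 => ((1 : ℝ), x))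
    refine split_of_below (hK.image c3) (hQ.image c3) hf.w_ne ?_
    rintro _ ⟨k, hk, rfl⟩ s ⟨q, hq, hqe⟩
    have hk0 : S (μ 1 k)⁻¹ k = k := by
      have : μ 1 k = 1 := by
        simp only [μ, hK1 k hk, neg_zero, max_self, mul_zero, add_zero]
      rw [this, inv_one, S1]
    dsimp only at hqe
    rw [hk0] at hqe
    have ez := Sz (μ 1 q)⁻¹ q
    have eb := Sb (μ 1 q)⁻¹ q
    have ec := Sc (μ 1 q)⁻¹ q
    rw [hqe, add_sub_right_comm, map_add, map_smul] at ez eb ec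
    simp only [hK1 k hk, hf.zw, hf.bw, hf.cw, smul_eq_mul, mul_one, mul_zero, zero_add,
      add_zero] at ez eb ec
    by_contra hs
    have hs' : z (q - A) ≤ 0 := by linarith
    apply hK2 k hk
    have m0 := μpos 1 q
    have hμ : μ 1 q = 1 + N * (-z (q - A)) := by
      simp only [μ, abs_one, one_mul, max_eq_right (show 0 ≤ -z (q - A) by linarith)]
    set m := μ 1 q with hm
    have k1 := hN1 N n1 q hq hs'
    have k2 := hN2 N n2 q hq hs'
    have k3 := hN3 N n3 q hq hs'
    have mi : m⁻¹ * m = 1 := inv_mul_cancel₀ m0.ne'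
    have mp : 0 < m⁻¹ := inv_pos.2 m0
    have f1 : b (k - A) = m⁻¹ * (N * (-z (q - A)) / 3 + b (q - A)) := by
      rw [eb]
      linear_combination (-1 / 3 : ℝ) * mi + (m⁻¹ / 3) * hμ
    have f2 : c (k - A) = m⁻¹ * (N * (-z (q - A)) / 3 + c (q - A)) := by
      rw [ec]
      linear_combination (-1 / 3 : ℝ) * mi + (m⁻¹ / 3) * hμ
    have f3 : 1 - b (k - A) - c (k - A)
        = m⁻¹ * (N * (-z (q - A)) / 3 + (1 - b (q - A) - c (q - A))) := by
      rw [eb, ec]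
      linear_combination (-1 / 3 : ℝ) * mi + (m⁻¹ / 3) * hμ
    rw [f3, f1, f2]
    exact ⟨mul_pos mp k1, mul_pos mp k2, mul_pos mp k3⟩

lemma compact_seg (X Y : E3) : IsCompact (segment ℝ X Y) := by
  rw [segment_eq_image']
  exact isCompact_Icc.image (by fun_prop)

lemma compact_cycle3 (A B C : E3) : IsCompact (cycle3 A B C) :=
  ((compact_seg _ _).union (compact_seg _ _)).union (compact_seg _ _)

lemma compact_cycle4 (D E F G : E3) : IsCompact (cycle4 D E F G) :=
  (((compact_seg _ _).union (compact_seg _ _)).union (compact_seg _ _)).union (compact_seg _ _)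

lemma cycle4_rot (D E F G : E3) : cycle4 D E F G = cycle4 E F G D := by
  ext x
  simp only [cycle4, Set.mem_union]
  tauto

lemma det3_ne_zero_of_affineIndependent {P Q R S : E3} (h : AffineIndependent ℝ ![P, Q, R, S]) :
    det3 (Q - P) (R - P) (S - P) ≠ 0 := by
  intro h0
  let M : Matrix (Fin 3) (Fin 3) ℝ := ![fun i => (Q - P) i, fun i => (R - P) i, fun i => (S - P) i]
  have hM : M.det = 0 := by
    rw [Matrix.det_fin_three, ← h0]
    simp [M, det3]
    ring
  obtain ⟨a, ha, haM⟩ := Matrix.exists_vecMul_eq_zero_iff.2 hM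
  have rel : ∀ i, a 0 * (Q i - P i) + a 1 * (R i - P i) + a 2 * (S i - P i) = 0 := by
    intro i
    have := congrFun haM i
    simpa [Matrix.vecMul, dotProduct, Fin.sum_univ_three, M] using this
  rw [affineIndependent_iff] at h
  have := h Finset.univ ![-(a 0 + a 1 + a 2), a 0, a 1, a 2]
    (by simp [Fin.sum_univ_four]; ring) (by
      ext i
      simp [Fin.sum_univ_four]
      linarith [rel i])
  apply ha
  ext i
  fin_cases i
  · simpa using this 1 (Finset.mem_univ _)
  · simpa using this 2 (Finset.mem_univ _)
  · simpa using this 3 (Finset.mem_univ _)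

/-- The signed height of `X` over the plane `ABC`. -/
def hgt (A B C X : E3) : ℝ := det3 (B - A) (C - A) (X - A)

lemma hgt_line (A B C X Y : E3) (θ : ℝ) :
    hgt A B C (X + θ • (Y - X)) = hgt A B C X + θ * (hgt A B C Y - hgt A B C X) := by
  simp [hgt, det3]
  ring

lemma openTri_hgt {A B C x : E3} (h : x ∈ OpenTri A B C) : hgt A B C x = 0 := by
  obtain ⟨a, b, c, -, -, -, hs, rfl⟩ := h
  have : a = 1 - b - c := by linarith
  subst this
  simp [hgt, det3]
  ring

lemma pierces_line {A B C X Y : E3} (h : Pierces A B C X Y) :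
    ∃ θ : ℝ, 0 < θ ∧ θ < 1 ∧ X + θ • (Y - X) ∈ OpenTri A B C := by
  obtain ⟨x, hx, hT⟩ := h
  rw [openSegment_eq_image'] at hx
  obtain ⟨θ, hθ, rfl⟩ := hx
  exact ⟨θ, hθ.1, hθ.2, hT⟩

lemma pierces_opp {A B C X Y : E3} (h : Pierces A B C X Y) (hX : hgt A B C X ≠ 0) :
    hgt A B C X * hgt A B C Y < 0 := by
  obtain ⟨θ, h0, h1, hT⟩ := pierces_line h
  have e := openTri_hgt hT
  rw [hgt_line] at e
  have h2 : 0 < hgt A B C X ^ 2 := by positivity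
  have e2 : θ * (hgt A B C X * hgt A B C Y) = -((1 - θ) * hgt A B C X ^ 2) := by
    linear_combination hgt A B C X * e
  have h3 : 0 < (1 - θ) * hgt A B C X ^ 2 := mul_pos (by linarith) h2
  by_contra hc
  have := mul_nonneg h0.le (not_lt.1 hc)
  linarith

lemma edge_pierced {A B C X Y x : E3} (h : Pierces A B C X Y) (hX : hgt A B C X ≠ 0)
    (hx : x ∈ segment ℝ X Y) (h0 : hgt A B C x = 0) : x ∈ OpenTri A B C := by
  have hop := pierces_opp h hX
  obtain ⟨θ, -, -, hT⟩ := pierces_line h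
  have e := openTri_hgt hT
  rw [segment_eq_image'] at hx
  obtain ⟨τ, -, rfl⟩ := hx
  dsimp only at h0
  rw [hgt_line] at e h0
  have hne : hgt A B C Y - hgt A B C X ≠ 0 := by
    intro hh
    have : hgt A B C Y = hgt A B C X := by linarith
    rw [this] at hop
    nlinarith [sq_nonneg (hgt A B C X)]
  have : τ = θ := by
    apply mul_right_cancel₀ hne
    linarith
  rw [this]
  exact hT

lemma edge_same {A B C X Y x : E3} (h : 0 < hgt A B C X * hgt A B C Y)
    (hx : x ∈ segment ℝ X Y) : hgt A B C x ≠ 0 := by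
  rw [segment_eq_image'] at hx
  obtain ⟨τ, ⟨t0, t1⟩, rfl⟩ := hx
  dsimp only
  rw [hgt_line]
  intro h0
  have hX : hgt A B C X ≠ 0 := by
    intro hh
    rw [hh] at h
    simp at h
  have h2 : 0 < hgt A B C X ^ 2 := by positivity
  have e2 : (1 - τ) * hgt A B C X ^ 2 + τ * (hgt A B C X * hgt A B C Y) = 0 := by
    linear_combination hgt A B C X * h0
  rcases t0.eq_or_lt with h3 | h3
  · rw [← h3] at e2
    linarith
  · have := mul_pos h3 h
    have := mul_nonneg (sub_nonneg.2 t1) h2.le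
    linarith

section coords

variable {A B C w : E3} {b c z : E3 →L[ℝ] ℝ}

lemma cycle3_coords (hf : Frame3 (B - A) (C - A) w b c z) {x : E3} (hx : x ∈ cycle3 A B C) :
    x ∈ CTri A b c z ∧
      ¬ (0 < b (x - A) ∧ 0 < c (x - A) ∧ 0 < 1 - b (x - A) - c (x - A)) := by
  simp only [cycle3, segment_eq_image', Set.mem_union] at hx
  rcases hx with (hx | hx) | hx
  · obtain ⟨θ, ⟨h0, h1⟩, rfl⟩ := hx
    have e : A + θ • (B - A) - A = θ • (B - A) := by module
    simp only [CTri, Set.mem_setOf_eq, e, map_smul, hf.bu, hf.cu, hf.zu, smul_eq_mul]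
    refine ⟨⟨by ring, by linarith, by linarith, by linarith⟩, ?_⟩
    rintro ⟨-, k, -⟩
    linarith
  · obtain ⟨θ, ⟨h0, h1⟩, rfl⟩ := hx
    have e : B + θ • (C - B) - A = (1 - θ) • (B - A) + θ • (C - A) := by module
    simp only [CTri, Set.mem_setOf_eq, e, map_smul, map_add, hf.bu, hf.cu, hf.zu, hf.bv, hf.cv,
      hf.zv, smul_eq_mul]
    refine ⟨⟨by ring, by linarith, by linarith, by linarith⟩, ?_⟩
    rintro ⟨-, -, k⟩
    linarith
  · obtain ⟨θ, ⟨h0, h1⟩, rfl⟩ := hx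
    have e : C + θ • (A - C) - A = (1 - θ) • (C - A) := by module
    simp only [CTri, Set.mem_setOf_eq, e, map_smul, hf.bv, hf.cv, hf.zv, smul_eq_mul]
    refine ⟨⟨by ring, by linarith, by linarith, by linarith⟩, ?_⟩
    rintro ⟨k, -, -⟩
    linarith

lemma openTri_coords (hf : Frame3 (B - A) (C - A) w b c z) {x : E3} (hx : x ∈ OpenTri A B C) :
    z (x - A) = 0 ∧ 0 < b (x - A) ∧ 0 < c (x - A) ∧ 0 < 1 - b (x - A) - c (x - A) := by
  obtain ⟨p, q, r, hp, hq, hr, hs, rfl⟩ := hx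
  have hp' : p = 1 - q - r := by linarith
  subst hp'
  have e : (1 - q - r) • A + q • B + r • C - A = q • (B - A) + r • (C - A) := by module
  simp only [e, map_smul, map_add, hf.bu, hf.cu, hf.zu, hf.bv, hf.cv, hf.zv, smul_eq_mul]
  refine ⟨by ring, by linarith, by linarith, by linarith⟩

lemma CTri_cases (hf : Frame3 (B - A) (C - A) w b c z) {x : E3} (hx : x ∈ CTri A b c z) :
    x ∈ cycle3 A B C ∨ x ∈ OpenTri A B C := by
  obtain ⟨hz, hb, hc, hbc⟩ := hx
  have rep := hf.rep (x - A)
  rw [hz, zero_smul, add_zero] at rep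
  have rep' : x = A + (b (x - A) • (B - A) + c (x - A) • (C - A)) := by
    rw [← rep]
    abel
  set p := b (x - A)
  set q := c (x - A)
  simp only [cycle3, segment_eq_image', Set.mem_union]
  rcases hb.eq_or_lt with h1 | h1
  · left; right
    refine ⟨1 - q, ⟨by linarith, by linarith⟩, ?_⟩
    rw [rep', ← h1]
    module
  rcases hc.eq_or_lt with h2 | h2
  · left; left; left
    refine ⟨p, ⟨by linarith, by linarith⟩, ?_⟩
    rw [rep', ← h2]
    module
  rcases hbc.eq_or_lt with h3 | h3
  · left; left; right
    refine ⟨q, ⟨by linarith, by linarith⟩, ?_⟩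
    have : p = 1 - q := by linarith
    rw [rep', this]
    module
  · right
    refine ⟨1 - p - q, p, q, by linarith, h1, h2, by ring, ?_⟩
    rw [rep']
    module

lemma edge_unpierced (hf : Frame3 (B - A) (C - A) w b c z) {X Y x : E3}
    (hp : ¬ Pierces A B C X Y) (hX : z (X - A) ≠ 0) (hY : z (Y - A) ≠ 0)
    (hd : x ∉ cycle3 A B C) (hx : x ∈ segment ℝ X Y) : x ∉ CTri A b c z := by
  intro hT
  rcases CTri_cases hf hT with h | h
  · exact hd h
  · apply hp
    refine ⟨x, mem_openSegment_of_ne_left_right ?_ ?_ hx, h⟩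
    · rintro rfl
      exact hX hT.1
    · rintro rfl
      exact hY hT.1

end coords

lemma case_none {A B C D E F G : E3}
    (hD : hgt A B C D ≠ 0) (hE : hgt A B C E ≠ 0) (hF : hgt A B C F ≠ 0) (hG : hgt A B C G ≠ 0)
    (hdisj : Disjoint (cycle3 A B C) (cycle4 D E F G))
    (p1 : ¬ Pierces A B C D E) (p2 : ¬ Pierces A B C E F) (p3 : ¬ Pierces A B C F G)
    (p4 : ¬ Pierces A B C G D) : SplitLink (cycle3 A B C) (cycle4 D E F G) := by
  obtain ⟨b, c, z, hf, hz⟩ := exists_frame (B - A) (C - A) (D - A) hD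
  have zne : ∀ X, hgt A B C X ≠ 0 → z (X - A) ≠ 0 := by
    intro X hX
    rw [hz]
    exact div_ne_zero hX hD
  have hT : ∀ x ∈ cycle4 D E F G, x ∉ CTri A b c z := by
    intro x hx
    have hd := Set.disjoint_right.1 hdisj hx
    rcases hx with ((h | h) | h) | h
    · exact edge_unpierced hf p1 (zne _ hD) (zne _ hE) hd h
    · exact edge_unpierced hf p2 (zne _ hE) (zne _ hF) hd h
    · exact edge_unpierced hf p3 (zne _ hF) (zne _ hG) hd h
    · exact edge_unpierced hf p4 (zne _ hG) (zne _ hD) hd h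
  have cz : Continuous fun x : E3 => z (x - A) := by fun_prop
  have hQ := compact_cycle4 D E F G
  have hp : IsCompact (cycle4 D E F G ∩ {x | 0 ≤ z (x - A)}) :=
    hQ.inter_right (isClosed_le continuous_const cz)
  have hm : IsCompact (cycle4 D E F G ∩ {x | z (x - A) ≤ 0}) :=
    hQ.inter_right (isClosed_le cz continuous_const)
  have hU : cycle4 D E F G = (cycle4 D E F G ∩ {x | 0 ≤ z (x - A)}) ∪
      (cycle4 D E F G ∩ {x | z (x - A) ≤ 0}) := by
    ext x
    constructor
    · intro hx
      rcases le_total 0 (z (x - A)) with h | h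
      · exact Or.inl ⟨hx, h⟩
      · exact Or.inr ⟨hx, h⟩
    · rintro (h | h)
      · exact h.1
      · exact h.1
  have zl : ∀ y ∈ CTri A b c z, ∀ s : ℝ, z (y + s • (D - A) - A) = s := by
    intro y hy s
    rw [add_sub_right_comm, map_add, map_smul, hf.zw, hy.1]
    simp
  have hpos : ∀ y ∈ CTri A b c z, ∀ s : ℝ,
      y + s • (D - A) ∈ cycle4 D E F G ∩ {x | 0 ≤ z (x - A)} → 0 < s := by
    rintro y hy s ⟨h1, h2⟩
    have h2' : 0 ≤ z (y + s • (D - A) - A) := h2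
    rw [zl y hy] at h2'
    rcases h2'.eq_or_lt with h | h
    · rw [← h, zero_smul, add_zero] at h1
      exact absurd hy (hT y h1)
    · exact h
  have hneg : ∀ y ∈ CTri A b c z, ∀ s : ℝ,
      y + s • (D - A) ∈ cycle4 D E F G ∩ {x | z (x - A) ≤ 0} → s < 0 := by
    rintro y hy s ⟨h1, h2⟩
    have h2' : z (y + s • (D - A) - A) ≤ 0 := h2
    rw [zl y hy] at h2'
    rcases h2'.eq_or_lt with h | h
    · rw [h, zero_smul, add_zero] at h1
      exact absurd hy (hT y h1)
    · exact h
  have hKT : cycle3 A B C ⊆ CTri A b c z := fun x hx => (cycle3_coords hf hx).1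
  obtain ⟨p, hpT, hpl⟩ := exists_good_point (A := A) hf D E F G
  rw [hU]
  refine split_of_graph (A := A) hf (compact_cycle3 A B C) hp hm hKT ?_ ?_ ?_ ⟨p, hpT, ?_⟩
  · intro y hy s t hs ht
    exact (hneg y hy s hs).trans (hpos y hy t ht)
  · intro y hy s hs
    exact hneg y (hKT hy) s hs
  · intro y hy s hs
    exact hpos y (hKT hy) s hs
  · rw [← hU]
    exact hpl

lemma case_inside {A B C D E F G : E3} (hD : hgt A B C D ≠ 0)
    (hdisj : ∀ x ∈ cycle4 D E F G, hgt A B C x = 0 → x ∈ OpenTri A B C) :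
    SplitLink (cycle3 A B C) (cycle4 D E F G) := by
  obtain ⟨b, c, z, hf, hz⟩ := exists_frame (B - A) (C - A) (D - A) hD
  refine split_of_inside (A := A) hf (compact_cycle3 A B C) (compact_cycle4 D E F G)
    (fun x hx => (cycle3_coords hf hx).1.1) (fun x hx => (cycle3_coords hf hx).2) ?_
  intro x hx h0
  rw [hz, div_eq_zero_iff] at h0
  rcases h0 with h0 | h0
  · exact (openTri_coords hf (hdisj x hx h0)).2
  · exact absurd h0 hD

lemma interp_pos {τ σ β d : ℝ} (h0 : 0 < τ) (h1 : 0 ≤ σ) (h2 : σ ≤ τ) (h3 : 0 < β)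
    (h4 : 0 < β + τ * d) : 0 < β + σ * d := by
  have e : τ * (β + σ * d) = (τ - σ) * β + σ * (β + τ * d) := by ring
  have k1 := mul_nonneg (sub_nonneg.2 h2) h3.le
  have k2 := mul_nonneg h1 h4.le
  have k3 : 0 < τ * (β + σ * d) := by
    rw [e]
    rcases h1.eq_or_lt with h | h
    · rw [← h]
      have := mul_pos h0 h3
      linarith
    · have := mul_pos h h4
      linarith
  exact pos_of_mul_pos_right k3 h0.le

lemma case_spike {A B C D E F G : E3}
    (hD : hgt A B C D ≠ 0) (hE : hgt A B C E ≠ 0) (hF : hgt A B C F ≠ 0) (hG : hgt A B C G ≠ 0)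
    (hdisj : Disjoint (cycle3 A B C) (cycle4 D E F G))
    (hdet : det3 (D - E) (F - E) (G - E) ≠ 0)
    (p1 : Pierces A B C D E) (p2 : Pierces A B C E F) (p3 : ¬ Pierces A B C F G)
    (p4 : ¬ Pierces A B C G D) : SplitLink (cycle3 A B C) (cycle4 D E F G) := by
  have o1 := pierces_opp p1 hD
  have o2 := pierces_opp p2 hE
  have hΔ : det3 (B - A) (C - A) (D - E) = hgt A B C D - hgt A B C E := by
    simp [hgt, det3]
    ring
  have hΔ0 : det3 (B - A) (C - A) (D - E) ≠ 0 := by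
    rw [hΔ]
    intro h
    have : hgt A B C D = hgt A B C E := by linarith
    rw [this] at o1
    nlinarith [sq_nonneg (hgt A B C E)]
  obtain ⟨b, c, z, hf, hz⟩ := exists_frame (B - A) (C - A) (D - E) hΔ0
  have hz' : ∀ X, z (X - A) = hgt A B C X / det3 (B - A) (C - A) (D - E) := fun X => hz _
  have zne : ∀ X, hgt A B C X ≠ 0 → z (X - A) ≠ 0 := by
    intro X hX
    rw [hz']
    exact div_ne_zero hX hΔ0
  have opp : ∀ X Y, hgt A B C X * hgt A B C Y < 0 → z (X - A) * z (Y - A) < 0 := by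
    intro X Y h
    rw [hz', hz', div_mul_div_comm]
    exact div_neg_of_neg_of_pos h (mul_self_pos.2 hΔ0)
  have zDE : z (D - A) - z (E - A) = 1 := by
    rw [← map_sub, sub_sub_sub_cancel_right, hf.zw]
  have z1 := opp _ _ o1
  have z2 := opp _ _ o2
  have zE : z (E - A) < 0 := by nlinarith [sq_nonneg (z (E - A))]
  have zD : 0 < z (D - A) := by nlinarith
  have zF : 0 < z (F - A) := by nlinarith
  have hTu : ∀ x ∈ segment ℝ F G ∪ segment ℝ G D, x ∉ CTri A b c z := by
    intro x hx
    rcases hx with h | h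
    · exact edge_unpierced hf p3 (zne _ hF) (zne _ hG)
        (Set.disjoint_right.1 hdisj (Or.inl (Or.inr h))) h
    · exact edge_unpierced hf p4 (zne _ hG) (zne _ hD)
        (Set.disjoint_right.1 hdisj (Or.inr h)) h
  have lin : ∀ (l : E3 →L[ℝ] ℝ) (X Y : E3) (θ : ℝ), l (X + θ • (Y - X) - A)
      = l (X - A) + θ * (l (Y - A) - l (X - A)) := by
    intro l X Y θ
    rw [add_sub_right_comm, map_add, map_smul, ← map_sub, sub_sub_sub_cancel_right, smul_eq_mul]
  have bDE : b (D - A) - b (E - A) = 0 := by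
    rw [← map_sub, sub_sub_sub_cancel_right, hf.bw]
  have cDE : c (D - A) - c (E - A) = 0 := by
    rw [← map_sub, sub_sub_sub_cancel_right, hf.cw]
  -- coordinates of the tip of the spike
  obtain ⟨θ, -, -, hθ⟩ := pierces_line p1
  obtain ⟨-, tb, tc, ta⟩ := openTri_coords hf hθ
  rw [lin] at tb tc ta
  rw [lin] at ta
  have be1 : b (D - A) = b (E - A) := by linarith
  have ce1 : c (D - A) = c (E - A) := by linarith
  simp only [be1, ce1, sub_self, mul_zero, add_zero] at tb tc ta
  have Eb : 0 < b (E - A) := by linarith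
  have Ec : 0 < c (E - A) := by linarith
  have Ea : 0 < 1 - b (E - A) - c (E - A) := by linarith
  obtain ⟨τ, τ0, -, hτ⟩ := pierces_line p2
  obtain ⟨qz, qb, qc, qa⟩ := openTri_coords hf hτ
  rw [lin] at qz qb qc qa
  rw [lin] at qa
  have spike : ∀ x ∈ segment ℝ D E ∪ segment ℝ E F, z (x - A) ≤ 0 →
      0 < b (x - A) ∧ 0 < c (x - A) ∧ 0 < 1 - b (x - A) - c (x - A) := by
    intro x hx hx0
    rw [segment_eq_image', segment_eq_image'] at hx
    rcases hx with ⟨σ, ⟨s0, s1⟩, rfl⟩ | ⟨σ, ⟨s0, s1⟩, rfl⟩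
    · dsimp only at hx0 ⊢
      rw [lin b, lin c]
      have e1 : b (D - A) = b (E - A) := by linarith
      have e2 : c (D - A) = c (E - A) := by linarith
      rw [e1, e2, sub_self, sub_self, mul_zero, add_zero, add_zero]
      exact ⟨Eb, Ec, Ea⟩
    · dsimp only at hx0 ⊢
      rw [lin z] at hx0
      rw [lin b, lin c]
      have hστ : σ ≤ τ := by
        by_contra hc
        have hc' : 0 < σ - τ := by linarith [not_le.1 hc]
        have : 0 < (σ - τ) * (z (F - A) - z (E - A)) := mul_pos hc' (by linarith)
        nlinarith
      refine ⟨interp_pos τ0 s0 hστ Eb qb, interp_pos τ0 s0 hστ Ec qc, ?_⟩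
      have := interp_pos (d := -(b (F - A) - b (E - A)) - (c (F - A) - c (E - A)))
        τ0 s0 hστ Ea (by linarith)
      linarith
  have cz : Continuous fun x : E3 => z (x - A) := by fun_prop
  set Qp : Set E3 := (segment ℝ D E ∪ segment ℝ E F) ∪
    ((segment ℝ F G ∪ segment ℝ G D) ∩ {x | 0 ≤ z (x - A)}) with hQp
  set Qm : Set E3 := (segment ℝ F G ∪ segment ℝ G D) ∩ {x | z (x - A) ≤ 0} with hQm
  have hp : IsCompact Qp :=
    ((compact_seg _ _).union (compact_seg _ _)).union
      (((compact_seg _ _).union (compact_seg _ _)).inter_right (isClosed_le continuous_const cz))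
  have hm : IsCompact Qm :=
    ((compact_seg _ _).union (compact_seg _ _)).inter_right (isClosed_le cz continuous_const)
  have hU : cycle4 D E F G = Qp ∪ Qm := by
    ext x
    have := le_total 0 (z (x - A))
    simp only [hQp, hQm, cycle4, Set.mem_union, Set.mem_inter_iff, Set.mem_setOf_eq]
    tauto
  have zl : ∀ y ∈ CTri A b c z, ∀ s : ℝ, z (y + s • (D - E) - A) = s := by
    intro y hy s
    rw [add_sub_right_comm, map_add, map_smul, hf.zw, hy.1]
    simp
  have bl : ∀ (y : E3) (s : ℝ), b (y + s • (D - E) - A) = b (y - A) := by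
    intro y s
    rw [add_sub_right_comm, map_add, map_smul, hf.bw]
    simp
  have cl : ∀ (y : E3) (s : ℝ), c (y + s • (D - E) - A) = c (y - A) := by
    intro y s
    rw [add_sub_right_comm, map_add, map_smul, hf.cw]
    simp
  have hneg : ∀ y ∈ CTri A b c z, ∀ s : ℝ, y + s • (D - E) ∈ Qm → s < 0 := by
    rintro y hy s ⟨h1, h2⟩
    have h2' : z (y + s • (D - E) - A) ≤ 0 := h2
    rw [zl y hy] at h2'
    rcases h2'.eq_or_lt with h | h
    · rw [h, zero_smul, add_zero] at h1
      exact absurd hy (hTu y h1)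
    · exact h
  have hKT : cycle3 A B C ⊆ CTri A b c z := fun x hx => (cycle3_coords hf hx).1
  obtain ⟨p, hpT, hpl⟩ := exists_good_point (A := A) hf D E F G
  rw [hU]
  refine split_of_graph (A := A) hf (compact_cycle3 A B C) hp hm hKT ?_ ?_ ?_ ⟨p, hpT, ?_⟩
  · intro y hy s t hs ht
    have sneg := hneg y hy s hs
    have zs := zl y hy s
    rcases ht with ht | ht
    · exfalso
      have e1 : det3 (D - E) (F - E) (y + t • (D - E) - E) = 0 := by
        rw [segment_eq_image', segment_eq_image'] at ht
        rcases ht with ⟨σ, -, h⟩ | ⟨σ, -, h⟩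
        · rw [← h]
          simp [det3]
          ring
        · rw [← h]
          simp [det3]
          ring
      have e2 : det3 (D - E) (F - E) (y + s • (D - E) - E) = 0 := by
        rw [← e1]
        simp [det3]
        ring
      obtain ⟨hs, -⟩ := hs
      rw [segment_eq_image', segment_eq_image'] at hs
      rcases hs with ⟨σ, -, h⟩ | ⟨σ, -, h⟩
      · dsimp only at h
        rw [← h] at e2 zs
        have e3 : σ * det3 (D - E) (F - E) (G - E) = 0 := by
          rw [← e2]
          simp [det3]
          ring
        have e4 : σ = 0 := (mul_eq_zero.1 e3).resolve_right hdet
        rw [e4, zero_smul, add_zero] at zs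
        linarith
      · dsimp only at h
        rw [← h] at e2 zs
        have e3 : (1 - σ) * det3 (D - E) (F - E) (G - E) = 0 := by
          rw [← e2]
          simp [det3]
          ring
        have e4 : 1 - σ = 0 := (mul_eq_zero.1 e3).resolve_right hdet
        have e5 : σ = 1 := by linarith
        rw [e5, one_smul, add_sub_cancel] at zs
        linarith
    · have h2' : 0 ≤ z (y + t • (D - E) - A) := ht.2
      rw [zl y hy] at h2'
      linarith
  · intro y hy s hs
    exact hneg y (hKT hy) s hs
  · intro y hy t ht
    have zt := zl y (hKT hy) t
    rcases ht with ht | ht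
    · by_contra hc
      have := spike _ ht (by rw [zt]; exact not_lt.1 hc)
      rw [bl, cl] at this
      exact (cycle3_coords hf hy).2 this
    · obtain ⟨h1, h2⟩ := ht
      have h2' : 0 ≤ z (y + t • (D - E) - A) := h2
      rw [zt] at h2'
      rcases h2'.eq_or_lt with h | h
      · rw [← h, zero_smul, add_zero] at h1
        exact absurd (hKT hy) (hTu y h1)
      · exact h
  · rw [← hU]
    exact hpl

/-- The combinatorial case analysis. -/
lemma split_main {A B C D E F G : E3}
    (hD : hgt A B C D ≠ 0) (hE : hgt A B C E ≠ 0) (hF : hgt A B C F ≠ 0) (hG : hgt A B C G ≠ 0)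
    (hdisj : Disjoint (cycle3 A B C) (cycle4 D E F G))
    (d1 : det3 (D - E) (F - E) (G - E) ≠ 0) (d2 : det3 (E - F) (G - F) (D - F) ≠ 0)
    (d3 : det3 (F - G) (D - G) (E - G) ≠ 0) (d4 : det3 (G - D) (E - D) (F - D) ≠ 0)
    (hlk : lkTriQuad A B C D E F G = 0) :
    SplitLink (cycle3 A B C) (cycle4 D E F G) := by
  have r1 := cycle4_rot D E F G
  have r2 := cycle4_rot E F G D
  have r3 := cycle4_rot F G D E
  have hdisj1 := hdisj
  rw [r1] at hdisj1
  have hdisj2 := hdisj1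
  rw [r2] at hdisj2
  have hdisj3 := hdisj2
  rw [r3] at hdisj3
  have hin : (∀ x ∈ segment ℝ D E, hgt A B C x = 0 → x ∈ OpenTri A B C) →
      (∀ x ∈ segment ℝ E F, hgt A B C x = 0 → x ∈ OpenTri A B C) →
      (∀ x ∈ segment ℝ F G, hgt A B C x = 0 → x ∈ OpenTri A B C) →
      (∀ x ∈ segment ℝ G D, hgt A B C x = 0 → x ∈ OpenTri A B C) →
      SplitLink (cycle3 A B C) (cycle4 D E F G) := by
    intro i1 i2 i3 i4
    refine case_inside hD ?_
    rintro x (((h | h) | h) | h)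
    · exact i1 x h
    · exact i2 x h
    · exact i3 x h
    · exact i4 x h
  have same : ∀ X Y, 0 < hgt A B C X * hgt A B C Y →
      ∀ x ∈ segment ℝ X Y, hgt A B C x = 0 → x ∈ OpenTri A B C :=
    fun X Y h x hx h0 => absurd h0 (edge_same h hx)
  have prod : ∀ p q r s : ℝ, p ≠ 0 → r ≠ 0 → p * q < 0 → r * s < 0 →
      (if 0 < p then (1 : ℤ) else -1) + (if 0 < r then (1 : ℤ) else -1) = 0 →
      0 < q * r ∧ 0 < s * p := by
    intro p q r s hp hr h1 h2 h3
    rcases lt_or_gt_of_ne hp with k1 | k1 <;> rcases lt_or_gt_of_ne hr with k2 | k2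
    · simp [k1.not_gt, k2.not_gt] at h3
    · exact ⟨mul_pos (pos_of_mul_neg_right h1 k1.le) k2,
        mul_pos_of_neg_of_neg (neg_of_mul_neg_right h2 k2.le) k1⟩
    · exact ⟨mul_pos_of_neg_of_neg (neg_of_mul_neg_right h1 k1.le) k2,
        mul_pos (pos_of_mul_neg_right h2 k2.le) k1⟩
    · simp [k1, k2] at h3
  change edgeSign A B C D E + edgeSign A B C E F + edgeSign A B C F G + edgeSign A B C G D = 0
    at hlk
  have es : ∀ X Y, edgeSign A B C X Y = if Pierces A B C X Y then
      (if 0 < hgt A B C X then 1 else -1) else 0 := fun X Y => rfl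
  simp only [es] at hlk
  by_cases p1 : Pierces A B C D E <;> by_cases p2 : Pierces A B C E F <;>
    by_cases p3 : Pierces A B C F G <;> by_cases p4 : Pierces A B C G D <;>
    simp only [p1, p2, p3, p4, if_true, if_false, add_zero, zero_add] at hlk
  · exact hin (fun x => edge_pierced p1 hD) (fun x => edge_pierced p2 hE)
      (fun x => edge_pierced p3 hF) (fun x => edge_pierced p4 hG)
  · exfalso
    split_ifs at hlk <;> omega
  · exfalso
    split_ifs at hlk <;> omega
  · exact case_spike hD hE hF hG hdisj d1 p1 p2 p3 p4
  · exfalso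
    split_ifs at hlk <;> omega
  · obtain ⟨k1, k2⟩ := prod _ _ _ _ hD hF (pierces_opp p1 hD) (pierces_opp p3 hF) hlk
    exact hin (fun x => edge_pierced p1 hD) (same _ _ k1) (fun x => edge_pierced p3 hF)
      (same _ _ k2)
  · rw [r1, r2, r3]
    exact case_spike hG hD hE hF hdisj3 d4 p4 p1 p2 p3
  · exfalso
    split_ifs at hlk <;> omega
  · exfalso
    split_ifs at hlk <;> omega
  · rw [r1]
    exact case_spike hE hF hG hD hdisj1 d2 p2 p3 p4 p1
  · obtain ⟨k1, k2⟩ := prod _ _ _ _ hE hG (pierces_opp p2 hE) (pierces_opp p4 hG) hlk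
    exact hin (same _ _ k2) (fun x => edge_pierced p2 hE) (same _ _ k1)
      (fun x => edge_pierced p4 hG)
  · exfalso
    split_ifs at hlk <;> omega
  · rw [r1, r2]
    exact case_spike hF hG hD hE hdisj2 d3 p3 p4 p1 p2
  · exfalso
    split_ifs at hlk <;> omega
  · exfalso
    split_ifs at hlk <;> omega
  · exact case_none hD hE hF hG hdisj p1 p2 p3 p4

/-- Let a straight-edge triangle (on vertices `v 0, v 1, v 2`) and a straight-edge
quadrilateral (on vertices `v 3, v 4, v 5, v 6`) be disjoint cycles in `ℝ³`, with
the seven vertices in general position.  If their linking number is zero, then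
they form a trivial (split) link. -/
theorem linking_zero_implies_split (v : Fin 7 → E3) (hGP : GenPos7 v)
    (hdisj : Disjoint (cycle3 (v 0) (v 1) (v 2)) (cycle4 (v 3) (v 4) (v 5) (v 6)))
    (hlk : lkTriQuad (v 0) (v 1) (v 2) (v 3) (v 4) (v 5) (v 6) = 0) :
    SplitLink (cycle3 (v 0) (v 1) (v 2)) (cycle4 (v 3) (v 4) (v 5) (v 6)) := by
  have hd : ∀ i j k l : Fin 7, i ≠ j → i ≠ k → i ≠ l → j ≠ k → j ≠ l → k ≠ l →
      det3 (v j - v i) (v k - v i) (v l - v i) ≠ 0 :=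
    fun i j k l h1 h2 h3 h4 h5 h6 =>
      det3_ne_zero_of_affineIndependent (hGP i j k l h1 h2 h3 h4 h5 h6)
  refine split_main ?_ ?_ ?_ ?_ hdisj ?_ ?_ ?_ ?_ hlk
  · exact hd 0 1 2 3 (by decide) (by decide) (by decide) (by decide) (by decide) (by decide)
  · exact hd 0 1 2 4 (by decide) (by decide) (by decide) (by decide) (by decide) (by decide)
  · exact hd 0 1 2 5 (by decide) (by decide) (by decide) (by decide) (by decide) (by decide)
  · exact hd 0 1 2 6 (by decide) (by decide) (by decide) (by decide) (by decide) (by decide)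
  · exact hd 4 3 5 6 (by decide) (by decide) (by decide) (by decide) (by decide) (by decide)
  · exact hd 5 4 6 3 (by decide) (by decide) (by decide) (by decide) (by decide) (by decide)
  · exact hd 6 5 3 4 (by decide) (by decide) (by decide) (by decide) (by decide) (by decide)
  · exact hd 3 6 4 5 (by decide) (by decide) (by decide) (by decide) (by decide) (by decide)

end
end

section
/- For every embedding of the graph K_{3,3,1} in R^3, the sum over all 2-component links (pairs of disjoint cycles) of their linking numbers is odd. -/
open scoped Classical

noncomputable section

/-- The linking number of two disjoint loops `f, g : [0,1] → ℝ³`, computed by the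
Gauss double integral. -/
def gaussLk (f g : ℝ → E3) : ℝ :=
  (4 * Real.pi)⁻¹ * ∫ s in (0:ℝ)..1, ∫ t in (0:ℝ)..1,
    det3 (deriv f s) (deriv g t) (f s - g t) / ‖f s - g t‖ ^ 3

/-- Vertices of `K₃,₃,₁` are `0,…,6`: part `{0,2,4}` (labels `1,3,5`), part
`{1,3,5}` (labels `2,4,6`), and the extra vertex `6` (label `7`). -/
def odds : Fin 3 → Fin 7 := ![0, 2, 4]

/-- The second part of `K₃,₃`. -/
def evens : Fin 3 → Fin 7 := ![1, 3, 5]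

/-- The part of each vertex of `K₃,₃,₁`. -/
def part : Fin 7 → Fin 3 := ![0, 1, 0, 1, 0, 1, 2]

/-- Two vertices of `K₃,₃,₁` are adjacent iff they lie in different parts. -/
def Adj (i j : Fin 7) : Prop := part i ≠ part j

/-- The triangle loop of the link indexed by `(a, b)`: the concatenation of the
three edge paths `7 → a`-th odd vertex `→ b`-th even vertex `→ 7`. -/
def triLoop (γ : Fin 7 → Fin 7 → ℝ → E3) (a b : Fin 3) : ℝ → E3 := fun t =>
  if t < 1/3 then γ 6 (odds a) (3 * t)
  else if t < 2/3 then γ (odds a) (evens b) (3 * t - 1)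
  else γ (evens b) 6 (3 * t - 2)

/-- The complementary quadrilateral loop of the link indexed by `(a, b)`: the
concatenation of the four edge paths around the 4-cycle on the remaining
vertices of `K₃,₃`. -/
def quadLoop (γ : Fin 7 → Fin 7 → ℝ → E3) (a b : Fin 3) : ℝ → E3 := fun t =>
  if t < 1/4 then γ (odds (a+1)) (evens (b+1)) (4 * t)
  else if t < 1/2 then γ (evens (b+1)) (odds (a+2)) (4 * t - 1)
  else if t < 3/4 then γ (odds (a+2)) (evens (b+2)) (4 * t - 2)
  else γ (evens (b+2)) (odds (a+1)) (4 * t - 3)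

open Filter Topology


/-- A half space containing exactly one of `a`, `-a` for every `a ≠ 0`. -/
def HalfS (a : E3) : Prop := 0 < a 2 ∨ (a 2 = 0 ∧ (0 < a 1 ∨ (a 1 = 0 ∧ 0 < a 0)))

/-- First spinor coordinate. -/
def spA (a : E3) : ℂ := if HalfS a then ⟨‖a‖ + a 2, 0⟩ else ⟨a 0, -a 1⟩
/-- Second spinor coordinate. -/
def spB (a : E3) : ℂ := if HalfS a then ⟨a 0, a 1⟩ else ⟨‖a‖ - a 2, 0⟩

/-- Hermitian product of the spinors of `a` and `b`. -/
def spL (a b : E3) : ℂ :=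
  (starRingEnd ℂ) (spA a) * spA b + (starRingEnd ℂ) (spB a) * spB b

/-- Link angle. -/
def lnk (a b : E3) : Real.Angle := ((spL a b).arg : Real.Angle)

/-- Sign correction. -/
def kap (a : E3) : Real.Angle := if HalfS a then 0 else (Real.pi : Real.Angle)

def dot3 (a b : E3) : ℝ := a 0 * b 0 + a 1 * b 1 + a 2 * b 2

def triR (a b c : E3) : ℝ :=
  ‖a‖ * ‖b‖ * ‖c‖ + ‖a‖ * dot3 b c + ‖b‖ * dot3 a c + ‖c‖ * dot3 a b

def triT (a b c : E3) : ℂ := ⟨triR a b c, det3 a b c⟩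

lemma norm_sq3 (a : E3) : ‖a‖ * ‖a‖ = a 0 * a 0 + a 1 * a 1 + a 2 * a 2 := by
  have := EuclideanSpace.norm_sq_eq a
  rw [Fin.sum_univ_three] at this
  simp only [Real.norm_eq_abs, sq_abs] at this
  nlinarith

lemma halfS_neg {a : E3} (ha : a ≠ 0) : HalfS (-a) ↔ ¬ HalfS a := by
  have h : ¬ (a 0 = 0 ∧ a 1 = 0 ∧ a 2 = 0) := by
    rintro ⟨h0, h1, h2⟩
    apply ha
    ext i
    fin_cases i <;> simp [h0, h1, h2]
  unfold HalfS
  simp only [PiLp.neg_apply, Left.neg_pos_iff, neg_eq_zero]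
  rcases lt_trichotomy (a 2) 0 with h2 | h2 | h2
  · simp [h2, h2.ne, h2.le]
  · rcases lt_trichotomy (a 1) 0 with h1 | h1 | h1
    · simp [h2, h1, h1.ne, h1.le]
    · rcases lt_trichotomy (a 0) 0 with h0 | h0 | h0
      · simp [h2, h1, h0, h0.le]
      · exact absurd ⟨h0, h1, h2⟩ h
      · simp [h2, h1, h0, h0.le]
    · simp [h2, h1, h1.ne', h1.le]
  · simp [h2, h2.ne', h2.le]

lemma kap_neg {a : E3} (ha : a ≠ 0) : kap (-a) = kap a + (Real.pi : Real.Angle) := by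
  unfold kap
  by_cases h : HalfS a
  · rw [if_neg (by rw [halfS_neg ha]; simpa using h), if_pos h, zero_add]
  · rw [if_pos ((halfS_neg ha).2 h), if_neg h, Real.Angle.coe_pi_add_coe_pi]

lemma norm_add_pos {a : E3} (h : HalfS a) : 0 < ‖a‖ + a 2 := by
  rcases h with h | ⟨h, h'⟩
  · positivity
  · rw [h, add_zero, norm_pos_iff]
    rintro rfl
    simp at h'

lemma norm_sub_pos {a : E3} (ha : a ≠ 0) (h : ¬ HalfS a) : 0 < ‖a‖ - a 2 := by
  have := norm_add_pos ((halfS_neg ha).2 h)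
  simpa [sub_eq_add_neg] using this

/-- The projector identity. -/
lemma sp_proj {a : E3} (ha : a ≠ 0) : ∃ k : ℝ, 0 < k ∧
    spA a * (starRingEnd ℂ) (spA a) = k * ⟨‖a‖ + a 2, 0⟩ ∧
    spA a * (starRingEnd ℂ) (spB a) = k * ⟨a 0, - a 1⟩ ∧
    spB a * (starRingEnd ℂ) (spA a) = k * ⟨a 0, a 1⟩ ∧
    spB a * (starRingEnd ℂ) (spB a) = k * ⟨‖a‖ - a 2, 0⟩ := by
  have hn := norm_sq3 a
  by_cases h : HalfS a
  · refine ⟨‖a‖ + a 2, norm_add_pos h, ?_⟩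
    simp only [spA, spB, if_pos h]
    refine ⟨?_, ?_, ?_, ?_⟩ <;> apply Complex.ext <;> simp <;> nlinarith
  · refine ⟨‖a‖ - a 2, norm_sub_pos ha h, ?_⟩
    simp only [spA, spB, if_neg h]
    refine ⟨?_, ?_, ?_, ?_⟩ <;> apply Complex.ext <;> simp <;> nlinarith

lemma spL_tri {a b c : E3} (ha : a ≠ 0) (hb : b ≠ 0) (hc : c ≠ 0) :
    ∃ k : ℝ, 0 < k ∧ spL a b * spL b c * spL c a = k * triT a b c := by
  obtain ⟨ka, pa, a1, a2, a3, a4⟩ := sp_proj ha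
  obtain ⟨kb, pb, b1, b2, b3, b4⟩ := sp_proj hb
  obtain ⟨kc, pc, c1, c2, c3, c4⟩ := sp_proj hc
  refine ⟨2 * (ka * kb * kc), by positivity, ?_⟩
  have : spL a b * spL b c * spL c a =
      (spA a * (starRingEnd ℂ) (spA a)) * ((spA b * (starRingEnd ℂ) (spA b)) * (spA c * (starRingEnd ℂ) (spA c)) + (spA b * (starRingEnd ℂ) (spB b)) * (spB c * (starRingEnd ℂ) (spA c)))
      + (spA a * (starRingEnd ℂ) (spB a)) * ((spB b * (starRingEnd ℂ) (spA b)) * (spA c * (starRingEnd ℂ) (spA c)) + (spB b * (starRingEnd ℂ) (spB b)) * (spB c * (starRingEnd ℂ) (spA c)))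
      + (spB a * (starRingEnd ℂ) (spA a)) * ((spA b * (starRingEnd ℂ) (spA b)) * (spA c * (starRingEnd ℂ) (spB c)) + (spA b * (starRingEnd ℂ) (spB b)) * (spB c * (starRingEnd ℂ) (spB c)))
      + (spB a * (starRingEnd ℂ) (spB a)) * ((spB b * (starRingEnd ℂ) (spA b)) * (spA c * (starRingEnd ℂ) (spB c)) + (spB b * (starRingEnd ℂ) (spB b)) * (spB c * (starRingEnd ℂ) (spB c))) := by
    unfold spL; ring
  rw [this, a1, a2, a3, a4, b1, b2, b3, b4, c1, c2, c3, c4]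
  apply Complex.ext
  · simp [triT, triR, dot3]; ring
  · simp [triT, det3]; ring

lemma triR_ne {a b c : E3} (h : 0 < triR a b c) : a ≠ 0 ∧ b ≠ 0 ∧ c ≠ 0 := by
  refine ⟨?_, ?_, ?_⟩ <;> rintro rfl <;> simp [triR, dot3] at h

lemma spL_conj (a b : E3) : spL b a = (starRingEnd ℂ) (spL a b) := by
  simp [spL]; ring

lemma lnk_symm (a b : E3) : lnk b a = - lnk a b := by
  rw [lnk, spL_conj, Complex.arg_conj_coe_angle, lnk]

lemma spL_ne {a b c : E3} (h : 0 < triR a b c) :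
    spL a b ≠ 0 ∧ spL b c ≠ 0 ∧ spL c a ≠ 0 := by
  obtain ⟨ha, hb, hc⟩ := triR_ne h
  obtain ⟨k, hk, e⟩ := spL_tri ha hb hc
  have : (k : ℂ) * triT a b c ≠ 0 := by
    apply mul_ne_zero (by exact_mod_cast hk.ne')
    intro h0
    have := congrArg Complex.re h0
    simp [triT] at this
    linarith
  rw [← e] at this
  simp only [ne_eq, mul_eq_zero, not_or] at this
  tauto

lemma arg_arctan {z : ℂ} (h : 0 < z.re) : z.arg = Real.arctan (z.im / z.re) := by
  rw [← Complex.tan_arg, Real.arctan_tan]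
  · exact (Complex.neg_pi_div_two_lt_arg_iff.2 (Or.inl h))
  · exact (Complex.arg_lt_pi_div_two_iff.2 (Or.inl h))

lemma lnk_tri {a b c : E3} (h : 0 < triR a b c) :
    lnk a b + lnk b c + lnk c a = (Real.arctan (det3 a b c / triR a b c) : Real.Angle) := by
  obtain ⟨ha, hb, hc⟩ := triR_ne h
  obtain ⟨h1, h2, h3⟩ := spL_ne h
  obtain ⟨k, hk, e⟩ := spL_tri ha hb hc
  unfold lnk
  rw [← Complex.arg_mul_coe_angle h1 h2, ← Complex.arg_mul_coe_angle (mul_ne_zero h1 h2) h3, e,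
    Complex.arg_real_mul _ hk, arg_arctan (by simpa [triT] using h)]
  rfl

lemma lnk_quad {a b c d : E3} (h : 0 < triR a b c) (h' : 0 < triR a c d) :
    lnk a b + lnk b c + lnk c d + lnk d a =
      ((Real.arctan (det3 a b c / triR a b c) + Real.arctan (det3 a c d / triR a c d) : ℝ) :
        Real.Angle) := by
  rw [Real.Angle.coe_add, ← lnk_tri h, ← lnk_tri h', lnk_symm a c]
  abel

lemma two_kap (a : E3) : kap a = - kap a := by
  unfold kap
  split_ifs <;> simp [Real.Angle.neg_coe_pi]

lemma lnk_neg {a b : E3} (ha : a ≠ 0) (hb : b ≠ 0) (h : spL a b ≠ 0) :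
    lnk (-a) (-b) = kap b - kap a - lnk a b := by
  have key : ∀ x : E3, x ≠ 0 → ∃ s : ℝ, ((s = 1 ∧ HalfS x) ∨ (s = -1 ∧ ¬ HalfS x)) ∧
      spA (-x) = s * -(starRingEnd ℂ) (spB x) ∧ spB (-x) = s * (starRingEnd ℂ) (spA x) := by
    intro x hx
    by_cases hh : HalfS x
    · refine ⟨1, Or.inl ⟨rfl, hh⟩, ?_⟩
      have h2 : ¬ HalfS (-x) := by rw [halfS_neg hx]; simpa using hh
      simp only [spA, spB, if_pos hh, if_neg h2]
      constructor <;> apply Complex.ext <;> simp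
    · refine ⟨-1, Or.inr ⟨rfl, hh⟩, ?_⟩
      have h2 : HalfS (-x) := by rw [halfS_neg hx]; simpa using hh
      simp only [spA, spB, if_neg hh, if_pos h2]
      constructor <;> apply Complex.ext <;> simp <;> ring
  obtain ⟨s, hs, a1, a2⟩ := key a ha
  obtain ⟨t, ht, b1, b2⟩ := key b hb
  have e : spL (-a) (-b) = ((s * t : ℝ) : ℂ) * (starRingEnd ℂ) (spL a b) := by
    simp only [spL, a1, a2, b1, b2, map_mul, map_neg, map_add, Complex.conj_conj, Complex.conj_ofReal]
    push_cast; ring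
  have hc : (starRingEnd ℂ) (spL a b) ≠ 0 := by simpa using h
  rw [lnk, e]
  rcases hs with ⟨rfl, hs⟩ | ⟨rfl, hs⟩ <;> rcases ht with ⟨rfl, ht⟩ | ⟨rfl, ht⟩ <;>
    simp [kap, hs, ht, Complex.arg_neg_coe_angle, h, Complex.arg_conj_coe_angle, lnk] <;> abel

lemma riemann_one (F : ℝ → ℝ) (hF : Continuous F) (N : ℕ) (hN : 0 < N) (c : ℕ → ℝ) (ε : ℝ)
    (h : ∀ i < N, ∀ s ∈ Set.Icc ((i : ℝ) / N) (((i : ℝ) + 1) / N), |F s - c i| ≤ ε) :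
    |(∫ s in (0:ℝ)..1, F s) - ∑ i ∈ Finset.range N, (1 / (N : ℝ)) * c i| ≤ ε := by
  have hN' : (0 : ℝ) < N := by exact_mod_cast hN
  have e1 := intervalIntegral.sum_integral_adjacent_intervals (μ := MeasureTheory.volume)
    (f := F) (a := fun k : ℕ => (k : ℝ) / N) (n := N)
    (fun k _ => hF.intervalIntegrable _ _)
  simp only [Nat.cast_zero, zero_div, div_self hN'.ne'] at e1
  rw [← e1, ← Finset.sum_sub_distrib]
  calc _ ≤ ∑ i ∈ Finset.range N, |(∫ x in ((i : ℕ) : ℝ) / N..((i + 1 : ℕ) : ℝ) / N, F x) - 1 / (N : ℝ) * c i| :=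
        Finset.abs_sum_le_sum_abs _ _
    _ ≤ ∑ i ∈ Finset.range N, ε * (1 / N) := by
        apply Finset.sum_le_sum
        intro i hi
        have hi' := Finset.mem_range.1 hi
        have hle : (i : ℝ) / N ≤ ((i + 1 : ℕ) : ℝ) / N := by
          push_cast; gcongr; linarith
        have e2 : (∫ x in ((i : ℕ) : ℝ) / N..((i + 1 : ℕ) : ℝ) / N, F x) - 1 / (N : ℝ) * c i
            = ∫ x in ((i : ℕ) : ℝ) / N..((i + 1 : ℕ) : ℝ) / N, (F x - c i) := by
          rw [intervalIntegral.integral_sub (hF.intervalIntegrable _ _) (by simp)]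
          simp only [intervalIntegral.integral_const, smul_eq_mul]
          push_cast
          ring
        rw [e2]
        have := intervalIntegral.norm_integral_le_of_norm_le_const (a := (i : ℝ) / N)
          (b := ((i + 1 : ℕ) : ℝ) / N) (f := fun x => F x - c i) (C := ε) (by
            intro x hx
            rw [Set.uIoc_of_le hle] at hx
            apply h i hi' x
            refine ⟨hx.1.le, ?_⟩
            simpa using hx.2)
        rw [Real.norm_eq_abs] at this
        refine this.trans (le_of_eq ?_)
        rw [abs_of_nonneg (by linarith)]
        push_cast; ring
    _ = ε := by
        rw [Finset.sum_const, Finset.card_range, nsmul_eq_mul]; field_simp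

lemma riemann_two (A : ℝ → ℝ → ℝ → ℝ)
    (hA : Continuous fun p : ℝ × ℝ × ℝ => A p.1 p.2.1 p.2.2) :
    Tendsto (fun N : ℕ => ∑ i ∈ Finset.range N, ∑ j ∈ Finset.range N,
      (1 / (N : ℝ)) ^ 2 * A ((i : ℝ) / N) ((j : ℝ) / N) (1 / (N : ℝ))) atTop
      (𝓝 (∫ s in (0:ℝ)..1, ∫ t in (0:ℝ)..1, A s t 0)) := by
  have hK : IsCompact ((Set.Icc (0:ℝ) 1) ×ˢ ((Set.Icc (0:ℝ) 1) ×ˢ (Set.Icc (0:ℝ) 1))) :=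
    isCompact_Icc.prod (isCompact_Icc.prod isCompact_Icc)
  have hu := hK.uniformContinuousOn_of_continuous hA.continuousOn
  rw [Metric.uniformContinuousOn_iff] at hu
  rw [Metric.tendsto_atTop]
  intro ε hε
  obtain ⟨δ, hδ, hd⟩ := hu (ε / 2) (by positivity)
  obtain ⟨M, hM⟩ := exists_nat_gt (1 / δ)
  refine ⟨M + 1, fun N hN => ?_⟩
  have hN0 : 0 < N := by omega
  have hNp : (0 : ℝ) < N := by exact_mod_cast hN0
  have hNd : 1 / (N : ℝ) < δ := by
    have : (M : ℝ) < N := by exact_mod_cast hN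
    rw [div_lt_iff₀ hNp]
    rw [div_lt_iff₀ hδ] at hM
    nlinarith
  have h1N : 1 / (N : ℝ) ≤ 1 := by
    rw [div_le_one hNp]; exact_mod_cast hN0
  have hcell : ∀ i < N, ∀ s ∈ Set.Icc ((i : ℝ) / N) (((i : ℝ) + 1) / N),
      (s ∈ Set.Icc (0:ℝ) 1 ∧ (i : ℝ) / N ∈ Set.Icc (0:ℝ) 1 ∧ |s - (i : ℝ) / N| < δ) := by
    intro i hi s hs
    have a1 : (0:ℝ) ≤ (i : ℝ) / N := by positivity
    have a2 : ((i : ℝ) + 1) / N ≤ 1 := by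
      rw [div_le_one hNp]; exact_mod_cast hi
    have a3 : ((i : ℝ) + 1) / N = (i : ℝ) / N + 1 / N := by ring
    have a4 : 0 < 1 / (N : ℝ) := by positivity
    refine ⟨⟨a1.trans hs.1, hs.2.trans a2⟩, ⟨a1, by linarith⟩, ?_⟩
    rw [abs_of_nonneg (by linarith [hs.1])]
    linarith [hs.2]
  rw [dist_comm, Real.dist_eq]
  have hc1 : Continuous fun s : ℝ => ∫ t in (0:ℝ)..1, A s t 0 := by
    apply intervalIntegral.continuous_parametric_intervalIntegral_of_continuous'
    exact hA.comp (by fun_prop : Continuous fun q : ℝ × ℝ => (q.1, q.2, (0:ℝ)))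
  have key := riemann_one (fun s => ∫ t in (0:ℝ)..1, A s t 0) hc1 N hN0
    (fun i => ∑ j ∈ Finset.range N, (1 / (N : ℝ)) * A ((i : ℝ) / N) ((j : ℝ) / N) (1 / (N : ℝ)))
    (ε / 2) (by
      intro i hi s hs
      obtain ⟨b1, b2, b3⟩ := hcell i hi s hs
      apply riemann_one (fun t => A s t 0) (hA.comp (by fun_prop : Continuous fun t : ℝ => (s, t, (0:ℝ)))) N hN0
        (fun j => A ((i : ℝ) / N) ((j : ℝ) / N) (1 / (N : ℝ)))
      intro j hj t ht
      obtain ⟨c1, c2, c3⟩ := hcell j hj t ht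
      have := hd (s, t, 0) ⟨b1, c1, by simp⟩ ((i : ℝ) / N, (j : ℝ) / N, 1 / (N : ℝ))
        ⟨b2, c2, by positivity, h1N⟩ (by
          rw [Prod.dist_eq, Prod.dist_eq, max_lt_iff, max_lt_iff]
          refine ⟨by rwa [Real.dist_eq], by rwa [Real.dist_eq], ?_⟩
          rw [Real.dist_eq, abs_sub_comm, sub_zero, abs_of_nonneg (by positivity)]
          exact hNd)
      rw [Real.dist_eq] at this
      exact this.le)
  refine lt_of_le_of_lt (le_of_eq ?_) (lt_of_le_of_lt key (by linarith))
  congr 2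
  apply Finset.sum_congr rfl
  intro i _
  rw [Finset.mul_sum]
  apply Finset.sum_congr rfl
  intro j _
  ring

/-- Averaged difference quotient. -/
def slp (e : ℝ → E3) (s h : ℝ) : E3 := ∫ u in (0:ℝ)..1, deriv e (s + h * u)

lemma slp_cont {e : ℝ → E3} (he : ContDiff ℝ 1 e) : Continuous fun p : ℝ × ℝ => slp e p.1 p.2 := by
  unfold slp
  have hd : Continuous (deriv e) := he.continuous_deriv le_rfl
  apply intervalIntegral.continuous_parametric_intervalIntegral_of_continuous'
  exact hd.comp (by fun_prop : Continuous fun q : (ℝ × ℝ) × ℝ => q.1.1 + q.1.2 * q.2)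

lemma slp_zero (e : ℝ → E3) (s : ℝ) : slp e s 0 = deriv e s := by
  simp [slp]

lemma slp_eq {e : ℝ → E3} (he : ContDiff ℝ 1 e) (s h : ℝ) : h • slp e s h = e (s + h) - e s := by
  have hd : Continuous (deriv e) := he.continuous_deriv le_rfl
  unfold slp
  rw [intervalIntegral.smul_integral_comp_add_mul (fun x => deriv e x),
    intervalIntegral.integral_deriv_eq_sub]
  · simp
  · intro x _
    exact he.differentiable (by norm_num) x
  · exact hd.intervalIntegrable _ _

def atf : ℝ → ℝ := dslope Real.arctan 0

lemma atf_cont : Continuous atf := by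
  rw [← continuousOn_univ]
  exact (continuousOn_dslope Filter.univ_mem).2
    ⟨Real.continuous_arctan.continuousOn, Real.differentiableAt_arctan 0⟩

lemma atf_zero : atf 0 = 1 := by
  simp [atf, dslope_same]

lemma atf_eq (x : ℝ) : Real.arctan x = x * atf x := by
  have := sub_smul_dslope Real.arctan 0 x
  simp at this
  exact this.symm

lemma det3_cont {X : Type*} [TopologicalSpace X] {a b c : X → E3} (ha : Continuous a)
    (hb : Continuous b) (hc : Continuous c) : Continuous fun x => det3 (a x) (b x) (c x) := by
  unfold det3; fun_prop

lemma triR_cont {X : Type*} [TopologicalSpace X] {a b c : X → E3} (ha : Continuous a)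
    (hb : Continuous b) (hc : Continuous c) : Continuous fun x => triR (a x) (b x) (c x) := by
  unfold triR dot3; fun_prop

/-- Sum of link angles along an edge, seen from `p`. -/
def edgeSum (N : ℕ) (e : ℝ → E3) (p : E3) : Real.Angle :=
  ∑ i ∈ Finset.range N, lnk (e ((i : ℝ) / N) - p) (e (((i + 1 : ℕ) : ℝ) / N) - p)

/-- Total boundary angle of a pair of edges. -/
def bdry (N : ℕ) (e f : ℝ → E3) : Real.Angle :=
  edgeSum N e (f 0) - edgeSum N e (f 1) + edgeSum N f (e 0) - edgeSum N f (e 1)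
    + kap (f 1 - e 1) + kap (f 0 - e 0) - kap (f 0 - e 1) - kap (f 1 - e 0)

/-- Telescoping. -/
lemma tele (N : ℕ) (h v : ℕ → ℕ → Real.Angle) :
    ∑ i ∈ Finset.range N, ∑ j ∈ Finset.range N, (h i j + v (i+1) j - h i (j+1) - v i j)
     = ∑ i ∈ Finset.range N, h i 0 - ∑ i ∈ Finset.range N, h i N
       + ∑ j ∈ Finset.range N, v N j - ∑ j ∈ Finset.range N, v 0 j := by
  have e1 : ∀ i, ∑ j ∈ Finset.range N, (h i j - h i (j+1)) = h i 0 - h i N := fun i =>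
    Finset.sum_range_sub' (fun j => h i j) N
  have e2 : ∀ j, ∑ i ∈ Finset.range N, (v (i+1) j - v i j) = v N j - v 0 j := fun j =>
    Finset.sum_range_sub (fun i => v i j) N
  have : ∀ i j, h i j + v (i+1) j - h i (j+1) - v i j = (h i j - h i (j+1)) + (v (i+1) j - v i j) := by
    intro i j; abel
  simp_rw [this, Finset.sum_add_distrib, e1]
  rw [Finset.sum_comm (f := fun i j => v (i+1) j - v i j)]
  simp_rw [e2, Finset.sum_sub_distrib]
  abel

lemma det3_first (a X Y : E3) (h : ℝ) :
    det3 a (a + h • X) (a + h • X + h • Y) = h ^ 2 * det3 a X Y := by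
  simp [det3]; ring

lemma det3_second (a X Y : E3) (h : ℝ) :
    det3 a (a + h • X + h • Y) (a + h • Y) = h ^ 2 * det3 a X Y := by
  simp [det3]; ring

lemma triR_self (a : E3) : triR a a a = 4 * ‖a‖ ^ 3 := by
  have := norm_sq3 a
  unfold triR dot3
  rw [← this]; ring

lemma lnk_flip {a b : E3} (ha : a ≠ 0) (hb : b ≠ 0) (h : spL a b ≠ 0) :
    lnk a b = (kap (-b) - kap (-a)) - lnk (-a) (-b) := by
  rw [lnk_neg ha hb h, kap_neg ha, kap_neg hb]
  abel

lemma dist_bound {e f : ℝ → E3} (he : Continuous e) (hf : Continuous f)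
    (hne : ∀ s ∈ Set.Icc (0:ℝ) 1, ∀ t ∈ Set.Icc (0:ℝ) 1, e s ≠ f t) :
    ∃ δ > 0, ∀ s ∈ Set.Icc (0:ℝ) 1, ∀ t ∈ Set.Icc (0:ℝ) 1, δ ≤ ‖e s - f t‖ := by
  have hK : IsCompact ((Set.Icc (0:ℝ) 1) ×ˢ (Set.Icc (0:ℝ) 1)) := isCompact_Icc.prod isCompact_Icc
  obtain ⟨p, hp, hmin⟩ := hK.exists_isMinOn ⟨(0, 0), by simp⟩
    (f := fun p : ℝ × ℝ => ‖e p.1 - f p.2‖) (by fun_prop)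
  refine ⟨‖e p.1 - f p.2‖, ?_, fun s hs t ht => hmin (a := (s, t)) ⟨hs, ht⟩⟩
  rw [gt_iff_lt, norm_pos_iff, sub_ne_zero]
  exact hne _ hp.1 _ hp.2

lemma ev_pos (R : ℝ → ℝ → ℝ → ℝ) (hR : Continuous fun p : ℝ × ℝ × ℝ => R p.1 p.2.1 p.2.2) (r : ℝ)
    (h0 : ∀ s ∈ Set.Icc (0:ℝ) 1, ∀ t ∈ Set.Icc (0:ℝ) 1, r < R s t 0) :
    ∀ᶠ N : ℕ in atTop, ∀ s ∈ Set.Icc (0:ℝ) 1, ∀ t ∈ Set.Icc (0:ℝ) 1, r < R s t (1 / (N : ℝ)) := by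
  have hK : IsCompact ((Set.Icc (0:ℝ) 1) ×ˢ (Set.Icc (0:ℝ) 1)) := isCompact_Icc.prod isCompact_Icc
  have := hK.eventually_forall_of_forall_eventually (x₀ := (0:ℝ))
    (P := fun h p => r < R p.1 p.2 h) (by
      rintro ⟨s, t⟩ ⟨hs, ht⟩
      have hc : Continuous fun z : ℝ × (ℝ × ℝ) => R z.2.1 z.2.2 z.1 :=
        hR.comp (by fun_prop : Continuous fun z : ℝ × (ℝ × ℝ) => (z.2.1, z.2.2, z.1))
      exact hc.continuousAt.eventually (lt_mem_nhds (h0 s hs t ht)))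
  have ht : Tendsto (fun N : ℕ => 1 / (N : ℝ)) atTop (𝓝 0) := tendsto_one_div_atTop_nhds_zero_nat
  filter_upwards [ht.eventually this] with N hN s hs t ht
  exact hN (s, t) ⟨hs, ht⟩

theorem bdry_tendsto {e f : ℝ → E3} (he : ContDiff ℝ 1 e) (hf : ContDiff ℝ 1 f)
    (hne : ∀ s ∈ Set.Icc (0:ℝ) 1, ∀ t ∈ Set.Icc (0:ℝ) 1, e s ≠ f t) :
    Tendsto (fun N : ℕ => bdry N e f) atTop
      (𝓝 ((-(2 * Real.pi * gaussLk e f) : ℝ) : Real.Angle)) := by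
  obtain ⟨δ, hδ, hdist⟩ := dist_bound he.continuous hf.continuous hne
  have hec := he.continuous
  have hfc := hf.continuous
  set R1 : ℝ → ℝ → ℝ → ℝ := fun s t h =>
    triR (e s - f t) (e (s + h) - f t) (e (s + h) - f (t + h)) with hR1
  set R2 : ℝ → ℝ → ℝ → ℝ := fun s t h =>
    triR (e s - f t) (e (s + h) - f (t + h)) (e s - f (t + h)) with hR2
  set D : ℝ → ℝ → ℝ → ℝ := fun s t h => det3 (e s - f t) (slp e s h) (-slp f t h) with hD
  have cR1 : Continuous fun p : ℝ × ℝ × ℝ => R1 p.1 p.2.1 p.2.2 := by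
    apply triR_cont <;> fun_prop
  have cR2 : Continuous fun p : ℝ × ℝ × ℝ => R2 p.1 p.2.1 p.2.2 := by
    apply triR_cont <;> fun_prop
  have cD : Continuous fun p : ℝ × ℝ × ℝ => D p.1 p.2.1 p.2.2 := by
    apply det3_cont
    · fun_prop
    · exact (slp_cont he).comp (by fun_prop : Continuous fun p : ℝ × ℝ × ℝ => (p.1, p.2.2))
    · exact ((slp_cont hf).comp (by fun_prop : Continuous fun p : ℝ × ℝ × ℝ => (p.2.1, p.2.2))).neg
  have r0 : 0 < δ ^ 3 := by positivity
  have hcube : ∀ s ∈ Set.Icc (0:ℝ) 1, ∀ t ∈ Set.Icc (0:ℝ) 1, δ ^ 3 < 4 * ‖e s - f t‖ ^ 3 := by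
    intro s hs t ht
    have : δ ^ 3 ≤ ‖e s - f t‖ ^ 3 := by
      have := hdist s hs t ht
      gcongr
    linarith
  have z1 : ∀ s t, R1 s t 0 = 4 * ‖e s - f t‖ ^ 3 := by
    intro s t; simp only [hR1, add_zero]; exact triR_self _
  have z2 : ∀ s t, R2 s t 0 = 4 * ‖e s - f t‖ ^ 3 := by
    intro s t; simp only [hR2, add_zero]; exact triR_self _
  set B : (ℝ → ℝ → ℝ → ℝ) → ℝ → ℝ → ℝ → ℝ := fun R s t h =>
    D s t h / max (R s t h) (δ ^ 3) * atf (h ^ 2 * (D s t h / max (R s t h) (δ ^ 3))) with hB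
  have cB : ∀ R : ℝ → ℝ → ℝ → ℝ, (Continuous fun p : ℝ × ℝ × ℝ => R p.1 p.2.1 p.2.2) →
      Continuous fun p : ℝ × ℝ × ℝ => B R p.1 p.2.1 p.2.2 := by
    intro R hR
    have hq : Continuous fun p : ℝ × ℝ × ℝ =>
        D p.1 p.2.1 p.2.2 / max (R p.1 p.2.1 p.2.2) (δ ^ 3) := by
      apply cD.div (hR.max continuous_const)
      intro p
      exact (lt_max_of_lt_right r0).ne'
    exact hq.mul (atf_cont.comp ((by fun_prop : Continuous fun p : ℝ × ℝ × ℝ => p.2.2 ^ 2).mul hq))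
  have hlim := riemann_two (fun s t h => B R1 s t h + B R2 s t h) ((cB R1 cR1).add (cB R2 cR2))
  have hval : (∫ s in (0:ℝ)..1, ∫ t in (0:ℝ)..1, (B R1 s t 0 + B R2 s t 0))
      = -(2 * Real.pi * gaussLk e f) := by
    have : (∫ s in (0:ℝ)..1, ∫ t in (0:ℝ)..1, (B R1 s t 0 + B R2 s t 0))
      = ∫ s in (0:ℝ)..1, ∫ t in (0:ℝ)..1,
        (-(1/2)) * (det3 (deriv e s) (deriv f t) (e s - f t) / ‖e s - f t‖ ^ 3) := by
      apply intervalIntegral.integral_congr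
      intro s hs
      apply intervalIntegral.integral_congr
      intro t ht
      rw [Set.uIcc_of_le zero_le_one] at hs ht
      have hc := hcube s hs t ht
      simp only [hB, z1, z2, max_eq_left hc.le, hD, slp_zero]
      simp only [ne_eq, OfNat.ofNat_ne_zero, not_false_eq_true, zero_pow, zero_mul, atf_zero, mul_one]
      have hpos : 0 < ‖e s - f t‖ ^ 3 := by linarith
      field_simp
      simp [det3]; ring
    rw [this]
    simp_rw [intervalIntegral.integral_const_mul]
    unfold gaussLk
    field_simp
    ring
  rw [hval] at hlim
  have hlim2 := (Real.Angle.continuous_coe.tendsto _).comp hlim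
  refine hlim2.congr' ?_
  filter_upwards [ev_pos R1 cR1 (δ ^ 3) (fun s hs t ht => by rw [z1]; exact hcube s hs t ht),
    ev_pos R2 cR2 (δ ^ 3) (fun s hs t ht => by rw [z2]; exact hcube s hs t ht),
    eventually_gt_atTop 0] with N h1 h2 hN
  have hNp : (0 : ℝ) < N := by exact_mod_cast hN
  have hin : ∀ i : ℕ, i ≤ N → (i : ℝ) / N ∈ Set.Icc (0:ℝ) 1 := by
    intro i hi
    refine ⟨by positivity, ?_⟩
    rw [div_le_one hNp]; exact_mod_cast hi
  have hstep : ∀ i : ℕ, ((i + 1 : ℕ) : ℝ) / N = (i : ℝ) / N + 1 / N := by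
    intro i; push_cast; ring
  set P : ℕ → ℕ → E3 := fun i j => e ((i : ℝ) / N) - f ((j : ℝ) / N) with hP
  have hPne : ∀ i ≤ N, ∀ j ≤ N, P i j ≠ 0 := by
    intro i hi j hj
    simp only [hP, sub_ne_zero]
    exact hne _ (hin i hi) _ (hin j hj)
  have t1 : ∀ i < N, ∀ j < N, δ ^ 3 < triR (P i j) (P (i+1) j) (P (i+1) (j+1)) := by
    intro i hi j hj
    have := h1 _ (hin i hi.le) _ (hin j hj.le)
    simpa only [hR1, hP, hstep] using this
  have t2 : ∀ i < N, ∀ j < N, δ ^ 3 < triR (P i j) (P (i+1) (j+1)) (P i (j+1)) := by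
    intro i hi j hj
    have := h2 _ (hin i hi.le) _ (hin j hj.le)
    simpa only [hR2, hP, hstep] using this
  have hcell : ∀ i < N, ∀ j < N,
      (((1 / (N : ℝ)) ^ 2 * (B R1 ((i : ℝ) / N) ((j : ℝ) / N) (1 / (N : ℝ)) +
        B R2 ((i : ℝ) / N) ((j : ℝ) / N) (1 / (N : ℝ))) : ℝ) : Real.Angle)
      = lnk (P i j) (P (i+1) j) + lnk (P (i+1) j) (P (i+1) (j+1))
        - lnk (P i (j+1)) (P (i+1) (j+1)) - lnk (P i j) (P i (j+1)) := by
    intro i hi j hj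
    have u1 := t1 i hi j hj
    have u2 := t2 i hi j hj
    have q := lnk_quad (r0.trans u1) (r0.trans u2)
    rw [lnk_symm (P i (j+1)) (P (i+1) (j+1)), lnk_symm (P i j) (P i (j+1)), ← sub_eq_add_neg,
      ← sub_eq_add_neg] at q
    rw [q]
    congr 1
    have eb : P (i+1) j = P i j + (1 / (N : ℝ)) • slp e ((i : ℝ) / N) (1 / (N : ℝ)) := by
      rw [slp_eq he]; simp only [hP, hstep]; abel
    have ed : P i (j+1) = P i j + (1 / (N : ℝ)) • (-slp f ((j : ℝ) / N) (1 / (N : ℝ))) := by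
      rw [smul_neg, slp_eq hf]; simp only [hP, hstep]; abel
    have ec : P (i+1) (j+1) = P i j + (1 / (N : ℝ)) • slp e ((i : ℝ) / N) (1 / (N : ℝ))
        + (1 / (N : ℝ)) • (-slp f ((j : ℝ) / N) (1 / (N : ℝ))) := by
      rw [smul_neg, slp_eq hf, slp_eq he]; simp only [hP, hstep]; abel
    have d1 : det3 (P i j) (P (i+1) j) (P (i+1) (j+1))
        = (1 / (N : ℝ)) ^ 2 * D ((i : ℝ) / N) ((j : ℝ) / N) (1 / (N : ℝ)) := by
      rw [eb, ec, det3_first]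
    have d2 : det3 (P i j) (P (i+1) (j+1)) (P i (j+1))
        = (1 / (N : ℝ)) ^ 2 * D ((i : ℝ) / N) ((j : ℝ) / N) (1 / (N : ℝ)) := by
      rw [ed, ec, det3_second]
    have r1 : R1 ((i : ℝ) / N) ((j : ℝ) / N) (1 / (N : ℝ))
        = triR (P i j) (P (i+1) j) (P (i+1) (j+1)) := by
      simp only [hR1, hP, hstep]
    have r2 : R2 ((i : ℝ) / N) ((j : ℝ) / N) (1 / (N : ℝ))
        = triR (P i j) (P (i+1) (j+1)) (P i (j+1)) := by
      simp only [hR2, hP, hstep]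
    rw [d1, d2]
    simp only [hB]
    rw [r1, r2, max_eq_left u1.le, max_eq_left u2.le, atf_eq, atf_eq]
    simp only [mul_div_assoc]
    ring
  have hsum : ((∑ i ∈ Finset.range N, ∑ j ∈ Finset.range N,
      (1 / (N : ℝ)) ^ 2 * (B R1 ((i : ℝ) / N) ((j : ℝ) / N) (1 / (N : ℝ)) +
        B R2 ((i : ℝ) / N) ((j : ℝ) / N) (1 / (N : ℝ))) : ℝ) : Real.Angle)
      = ∑ i ∈ Finset.range N, ∑ j ∈ Finset.range N,
       (lnk (P i j) (P (i+1) j) + lnk (P (i+1) j) (P (i+1) (j+1))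
        - lnk (P i (j+1)) (P (i+1) (j+1)) - lnk (P i j) (P i (j+1))) := by
    rw [← Real.Angle.coe_coeHom, map_sum]
    apply Finset.sum_congr rfl
    intro i hi
    rw [map_sum]
    apply Finset.sum_congr rfl
    intro j hj
    exact hcell i (Finset.mem_range.1 hi) j (Finset.mem_range.1 hj)
  simp only [Function.comp_apply]
  rw [hsum, tele N (fun i j => lnk (P i j) (P (i+1) j)) (fun i j => lnk (P i j) (P i (j+1)))]
  have hside : ∀ i ≤ N, (∀ j < N, spL (P i j) (P i (j+1)) ≠ 0) →
      ∑ j ∈ Finset.range N, lnk (P i j) (P i (j+1)) =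
      kap (f 1 - e ((i : ℝ) / N)) - kap (f 0 - e ((i : ℝ) / N)) - edgeSum N f (e ((i : ℝ) / N)) := by
    intro i hi hsp
    have : ∀ j ∈ Finset.range N, lnk (P i j) (P i (j+1)) =
      (kap (f (((j + 1 : ℕ) : ℝ) / N) - e ((i : ℝ) / N)) - kap (f ((j : ℝ) / N) - e ((i : ℝ) / N)))
       - lnk (f ((j : ℝ) / N) - e ((i : ℝ) / N)) (f (((j + 1 : ℕ) : ℝ) / N) - e ((i : ℝ) / N)) := by
      intro j hj
      have hj' := Finset.mem_range.1 hj
      rw [lnk_flip (hPne i hi j hj'.le) (hPne i hi (j+1) hj') (hsp j hj')]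
      simp only [hP, neg_sub]
    rw [Finset.sum_congr rfl this, Finset.sum_sub_distrib,
      Finset.sum_range_sub (fun j : ℕ => kap (f ((j : ℝ) / N) - e ((i : ℝ) / N)))]
    simp only [Nat.cast_zero, zero_div, div_self hNp.ne']
    rfl
  have sN := hside N le_rfl (by
    intro j hj
    have := (spL_ne (r0.trans (t1 (N-1) (by omega) j hj))).2.1
    rwa [show N - 1 + 1 = N by omega] at this)
  have s0 := hside 0 (by omega) (by
    intro j hj
    have := (spL_ne (r0.trans (t2 0 hN j hj))).2.2
    rw [spL_conj]
    simpa using this)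
  simp only [Nat.cast_zero, zero_div, div_self hNp.ne'] at sN s0
  rw [sN, s0]
  have b0 : ∑ i ∈ Finset.range N, lnk (P i 0) (P (i+1) 0) = edgeSum N e (f 0) := by
    simp [hP, edgeSum]
  have bN : ∑ i ∈ Finset.range N, lnk (P i N) (P (i+1) N) = edgeSum N e (f 1) := by
    simp only [hP, edgeSum, div_self hNp.ne']
  rw [b0, bN]
  unfold bdry
  abel

/-- The Gauss kernel. -/
def gK (e f : ℝ → E3) (s t : ℝ) : ℝ :=
  det3 (deriv e s) (deriv f t) (e s - f t) / ‖e s - f t‖ ^ 3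

def ESep (e f : ℝ → E3) : Prop :=
  ∀ s ∈ Set.Icc (0:ℝ) 1, ∀ t ∈ Set.Icc (0:ℝ) 1, e s ≠ f t

lemma gK_ext {e f : ℝ → E3} (he : ContDiff ℝ 1 e) (hf : ContDiff ℝ 1 f) (hne : ESep e f) :
    ∃ K : ℝ → ℝ → ℝ, (Continuous fun p : ℝ × ℝ => K p.1 p.2) ∧
      ∀ s ∈ Set.Icc (0:ℝ) 1, ∀ t ∈ Set.Icc (0:ℝ) 1, gK e f s t = K s t := by
  obtain ⟨δ, hδ, hdist⟩ := dist_bound he.continuous hf.continuous hne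
  have hde : Continuous (deriv e) := he.continuous_deriv le_rfl
  have hdf : Continuous (deriv f) := hf.continuous_deriv le_rfl
  have hec := he.continuous
  have hfc := hf.continuous
  refine ⟨fun s t => det3 (deriv e s) (deriv f t) (e s - f t) / (max ‖e s - f t‖ δ) ^ 3, ?_, ?_⟩
  · apply Continuous.div
    · apply det3_cont <;> fun_prop
    · fun_prop
    · intro p
      have : 0 < max ‖e p.1 - f p.2‖ δ := lt_max_of_lt_right hδ
      positivity
  · intro s hs t ht
    simp only [gK]
    rw [max_eq_left (hdist s hs t ht)]

lemma gaussLk_congr {e f : ℝ → E3} {K : ℝ → ℝ → ℝ}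
    (h : ∀ s ∈ Set.Icc (0:ℝ) 1, ∀ t ∈ Set.Icc (0:ℝ) 1, gK e f s t = K s t) :
    gaussLk e f = (4 * Real.pi)⁻¹ * ∫ s in (0:ℝ)..1, ∫ t in (0:ℝ)..1, K s t := by
  unfold gaussLk
  congr 1
  apply intervalIntegral.integral_congr
  intro s hs
  apply intervalIntegral.integral_congr
  intro t ht
  rw [Set.uIcc_of_le zero_le_one] at hs ht
  exact h s hs t ht

lemma gK_symm (e f : ℝ → E3) (s t : ℝ) : gK f e t s = gK e f s t := by
  unfold gK
  rw [norm_sub_rev (f t) (e s)]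
  congr 1
  simp [det3]; ring

lemma gaussLk_symm {e f : ℝ → E3} (he : ContDiff ℝ 1 e) (hf : ContDiff ℝ 1 f) (hne : ESep e f) :
    gaussLk f e = gaussLk e f := by
  obtain ⟨K, cK, hK⟩ := gK_ext he hf hne
  rw [gaussLk_congr hK, gaussLk_congr (K := fun t s => K s t)
    (fun t ht s hs => by rw [gK_symm, hK s hs t ht])]
  congr 1
  simp only [intervalIntegral.integral_of_le zero_le_one]
  rw [MeasureTheory.integral_integral_swap]
  have h2 : MeasureTheory.IntegrableOn (fun p : ℝ × ℝ => K p.2 p.1)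
      ((Set.Icc (0:ℝ) 1) ×ˢ (Set.Icc (0:ℝ) 1)) := by
    apply ContinuousOn.integrableOn_compact (isCompact_Icc.prod isCompact_Icc)
    exact (cK.comp continuous_swap).continuousOn
  rw [MeasureTheory.Measure.prod_restrict]
  exact h2.mono_set (Set.prod_mono Set.Ioc_subset_Icc_self Set.Ioc_subset_Icc_self)

lemma gaussLk_rev (e f : ℝ → E3) : gaussLk e (fun t => f (1 - t)) = - gaussLk e f := by
  unfold gaussLk
  rw [← mul_neg, ← intervalIntegral.integral_neg]
  congr 2
  ext s
  rw [← intervalIntegral.integral_neg]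
  have := intervalIntegral.integral_comp_sub_left (a := 0) (b := 1)
    (fun t => -(det3 (deriv e s) (deriv f t) (e s - f t) / ‖e s - f t‖ ^ 3)) 1
  simp only [sub_self, sub_zero] at this
  rw [← this]
  congr 1
  ext t
  rw [deriv_comp_const_sub, ← neg_div]
  congr 1
  simp [det3]; ring

lemma piece (Φ : E3 → E3 → ℝ) (hΦ : ∀ (k : ℝ) w p, Φ (k • w) p = k * Φ w p)
    {g f : ℝ → E3} (hf : ContDiff ℝ 1 f) {a b k c : ℝ} (hab : a < b) (hk : 0 < k)
    (ha : k * a - c = 0) (hb : k * b - c = 1)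
    (hg : ∀ t, a < t → t < b → g t = f (k * t - c))
    {Ψ : ℝ → ℝ} (cΨ : Continuous Ψ) (hΨ : ∀ u ∈ Set.Icc (0:ℝ) 1, Φ (deriv f u) (f u) = Ψ u) :
    IntervalIntegrable (fun t => Φ (deriv g t) (g t)) MeasureTheory.volume a b ∧
    ∫ t in a..b, Φ (deriv g t) (g t) = ∫ u in (0:ℝ)..1, Ψ u := by
  have key : ∀ t, a < t → t < b → Φ (deriv g t) (g t) = k * Ψ (k * t - c) := by
    intro t h1 h2
    have ev : g =ᶠ[𝓝 t] fun t => f (k * t - c) := by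
      filter_upwards [Ioo_mem_nhds h1 h2] with x hx using hg x hx.1 hx.2
    have hd : HasDerivAt (fun t => f (k * t - c)) (k • deriv f (k * t - c)) t := by
      have h3 : HasDerivAt f (deriv f (k * t - c)) (k * t - c) :=
        (hf.differentiable (by norm_num) _).hasDerivAt
      have h4 : HasDerivAt (fun t : ℝ => k * t - c) k t := by
        simpa using ((hasDerivAt_id t).const_mul k).sub_const c
      exact h3.scomp t h4
    rw [ev.deriv_eq, hd.deriv, hΦ, hg t h1 h2, hΨ]
    constructor <;> nlinarith
  have hae : ∀ᵐ t ∂MeasureTheory.volume, t ∈ Set.uIoc a b →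
      k * Ψ (k * t - c) = Φ (deriv g t) (g t) := by
    have hb' : ∀ᵐ t ∂(MeasureTheory.volume : MeasureTheory.Measure ℝ), t ≠ b := by
      simp [MeasureTheory.ae_iff]
    filter_upwards [hb'] with t ht htm
    rw [Set.uIoc_of_le hab.le] at htm
    exact (key t htm.1 (lt_of_le_of_ne htm.2 ht)).symm
  have hi : IntervalIntegrable (fun t => k * Ψ (k * t - c)) MeasureTheory.volume a b :=
    Continuous.intervalIntegrable (by fun_prop) _ _
  refine ⟨hi.congr_ae ((MeasureTheory.ae_restrict_iff' measurableSet_uIoc).2 hae), ?_⟩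
  rw [← intervalIntegral.integral_congr_ae hae, intervalIntegral.integral_const_mul,
    intervalIntegral.mul_integral_comp_mul_sub, ha, hb]

def cat3 (f1 f2 f3 : ℝ → E3) : ℝ → E3 := fun t =>
  if t < 1/3 then f1 (3 * t) else if t < 2/3 then f2 (3 * t - 1) else f3 (3 * t - 2)

def cat4 (f1 f2 f3 f4 : ℝ → E3) : ℝ → E3 := fun t =>
  if t < 1/4 then f1 (4 * t) else if t < 1/2 then f2 (4 * t - 1)
  else if t < 3/4 then f3 (4 * t - 2) else f4 (4 * t - 3)

lemma cat3_int (Φ : E3 → E3 → ℝ) (hΦ : ∀ (k : ℝ) w p, Φ (k • w) p = k * Φ w p)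
    {f1 f2 f3 : ℝ → E3} (h1 : ContDiff ℝ 1 f1) (h2 : ContDiff ℝ 1 f2) (h3 : ContDiff ℝ 1 f3)
    {Ψ1 Ψ2 Ψ3 : ℝ → ℝ} (c1 : Continuous Ψ1) (c2 : Continuous Ψ2) (c3 : Continuous Ψ3)
    (k1 : ∀ u ∈ Set.Icc (0:ℝ) 1, Φ (deriv f1 u) (f1 u) = Ψ1 u)
    (k2 : ∀ u ∈ Set.Icc (0:ℝ) 1, Φ (deriv f2 u) (f2 u) = Ψ2 u)
    (k3 : ∀ u ∈ Set.Icc (0:ℝ) 1, Φ (deriv f3 u) (f3 u) = Ψ3 u) :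
    ∫ t in (0:ℝ)..1, Φ (deriv (cat3 f1 f2 f3) t) (cat3 f1 f2 f3 t)
      = (∫ u in (0:ℝ)..1, Ψ1 u) + (∫ u in (0:ℝ)..1, Ψ2 u) + ∫ u in (0:ℝ)..1, Ψ3 u := by
  obtain ⟨i1, e1⟩ := piece Φ hΦ (g := cat3 f1 f2 f3) h1 (a := 0) (b := 1/3) (k := 3) (c := 0)
    (by norm_num) (by norm_num) (by norm_num) (by norm_num)
    (fun t a b => by simp only [cat3]; rw [if_pos b, sub_zero]) c1 k1
  obtain ⟨i2, e2⟩ := piece Φ hΦ (g := cat3 f1 f2 f3) h2 (a := 1/3) (b := 2/3) (k := 3) (c := 1)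
    (by norm_num) (by norm_num) (by norm_num) (by norm_num)
    (fun t a b => by simp only [cat3]; rw [if_neg (by linarith), if_pos b]) c2 k2
  obtain ⟨i3, e3⟩ := piece Φ hΦ (g := cat3 f1 f2 f3) h3 (a := 2/3) (b := 1) (k := 3) (c := 2)
    (by norm_num) (by norm_num) (by norm_num) (by norm_num)
    (fun t a b => by simp only [cat3]; rw [if_neg (by linarith), if_neg (by linarith)]) c3 k3
  rw [← e1, ← e2, ← e3, intervalIntegral.integral_add_adjacent_intervals i1 i2,
    intervalIntegral.integral_add_adjacent_intervals (i1.trans i2) i3]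

lemma cat4_int (Φ : E3 → E3 → ℝ) (hΦ : ∀ (k : ℝ) w p, Φ (k • w) p = k * Φ w p)
    {f1 f2 f3 f4 : ℝ → E3} (h1 : ContDiff ℝ 1 f1) (h2 : ContDiff ℝ 1 f2) (h3 : ContDiff ℝ 1 f3)
    (h4 : ContDiff ℝ 1 f4)
    {Ψ1 Ψ2 Ψ3 Ψ4 : ℝ → ℝ} (c1 : Continuous Ψ1) (c2 : Continuous Ψ2) (c3 : Continuous Ψ3)
    (c4 : Continuous Ψ4)
    (k1 : ∀ u ∈ Set.Icc (0:ℝ) 1, Φ (deriv f1 u) (f1 u) = Ψ1 u)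
    (k2 : ∀ u ∈ Set.Icc (0:ℝ) 1, Φ (deriv f2 u) (f2 u) = Ψ2 u)
    (k3 : ∀ u ∈ Set.Icc (0:ℝ) 1, Φ (deriv f3 u) (f3 u) = Ψ3 u)
    (k4 : ∀ u ∈ Set.Icc (0:ℝ) 1, Φ (deriv f4 u) (f4 u) = Ψ4 u) :
    ∫ t in (0:ℝ)..1, Φ (deriv (cat4 f1 f2 f3 f4) t) (cat4 f1 f2 f3 f4 t)
      = (∫ u in (0:ℝ)..1, Ψ1 u) + (∫ u in (0:ℝ)..1, Ψ2 u) + (∫ u in (0:ℝ)..1, Ψ3 u)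
        + ∫ u in (0:ℝ)..1, Ψ4 u := by
  obtain ⟨i1, e1⟩ := piece Φ hΦ (g := cat4 f1 f2 f3 f4) h1 (a := 0) (b := 1/4) (k := 4) (c := 0)
    (by norm_num) (by norm_num) (by norm_num) (by norm_num)
    (fun t a b => by simp only [cat4]; rw [if_pos b, sub_zero]) c1 k1
  obtain ⟨i2, e2⟩ := piece Φ hΦ (g := cat4 f1 f2 f3 f4) h2 (a := 1/4) (b := 1/2) (k := 4) (c := 1)
    (by norm_num) (by norm_num) (by norm_num) (by norm_num)
    (fun t a b => by simp only [cat4]; rw [if_neg (by linarith), if_pos b]) c2 k2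
  obtain ⟨i3, e3⟩ := piece Φ hΦ (g := cat4 f1 f2 f3 f4) h3 (a := 1/2) (b := 3/4) (k := 4) (c := 2)
    (by norm_num) (by norm_num) (by norm_num) (by norm_num)
    (fun t a b => by
      simp only [cat4]; rw [if_neg (by linarith), if_neg (by linarith), if_pos b]) c3 k3
  obtain ⟨i4, e4⟩ := piece Φ hΦ (g := cat4 f1 f2 f3 f4) h4 (a := 3/4) (b := 1) (k := 4) (c := 3)
    (by norm_num) (by norm_num) (by norm_num) (by norm_num)
    (fun t a b => by
      simp only [cat4]; rw [if_neg (by linarith), if_neg (by linarith), if_neg (by linarith)]) c4 k4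
  rw [← e1, ← e2, ← e3, ← e4, intervalIntegral.integral_add_adjacent_intervals i1 i2,
    intervalIntegral.integral_add_adjacent_intervals (i1.trans i2) i3,
    intervalIntegral.integral_add_adjacent_intervals ((i1.trans i2).trans i3) i4]

/-- Contribution of one edge against a quadrilateral. -/
lemma edge_cat4 {e f1 f2 f3 f4 : ℝ → E3} (he : ContDiff ℝ 1 e)
    (h1 : ContDiff ℝ 1 f1) (h2 : ContDiff ℝ 1 f2) (h3 : ContDiff ℝ 1 f3) (h4 : ContDiff ℝ 1 f4)
    (s1 : ESep e f1) (s2 : ESep e f2) (s3 : ESep e f3) (s4 : ESep e f4) :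
    ∃ Ψ : ℝ → ℝ, Continuous Ψ ∧
      (∀ s ∈ Set.Icc (0:ℝ) 1, ∫ t in (0:ℝ)..1, gK e (cat4 f1 f2 f3 f4) s t = Ψ s) ∧
      (4 * Real.pi)⁻¹ * ∫ s in (0:ℝ)..1, Ψ s =
        gaussLk e f1 + gaussLk e f2 + gaussLk e f3 + gaussLk e f4 := by
  obtain ⟨K1, c1, e1⟩ := gK_ext he h1 s1
  obtain ⟨K2, c2, e2⟩ := gK_ext he h2 s2
  obtain ⟨K3, c3, e3⟩ := gK_ext he h3 s3
  obtain ⟨K4, c4, e4⟩ := gK_ext he h4 s4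
  have hc : ∀ K : ℝ → ℝ → ℝ, (Continuous fun p : ℝ × ℝ => K p.1 p.2) →
      Continuous fun s => ∫ t in (0:ℝ)..1, K s t := fun K hK =>
    intervalIntegral.continuous_parametric_intervalIntegral_of_continuous' hK 0 1
  have hs : ∀ K : ℝ → ℝ → ℝ, (Continuous fun p : ℝ × ℝ => K p.1 p.2) → ∀ s,
      Continuous fun t => K s t := fun K hK s => hK.comp (Continuous.prodMk_right s)
  refine ⟨fun s => (∫ t in (0:ℝ)..1, K1 s t) + (∫ t in (0:ℝ)..1, K2 s t)
    + (∫ t in (0:ℝ)..1, K3 s t) + ∫ t in (0:ℝ)..1, K4 s t,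
    (((hc K1 c1).add (hc K2 c2)).add (hc K3 c3)).add (hc K4 c4), ?_, ?_⟩
  · intro s hs'
    exact cat4_int (fun w p => det3 (deriv e s) w (e s - p) / ‖e s - p‖ ^ 3)
      (fun k w p => by rw [← mul_div_assoc]; congr 1; simp [det3]; ring) h1 h2 h3 h4
      (hs K1 c1 s) (hs K2 c2 s) (hs K3 c3 s) (hs K4 c4 s)
      (fun u hu => e1 s hs' u hu) (fun u hu => e2 s hs' u hu)
      (fun u hu => e3 s hs' u hu) (fun u hu => e4 s hs' u hu)
  · rw [intervalIntegral.integral_add, intervalIntegral.integral_add,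
      intervalIntegral.integral_add, gaussLk_congr e1, gaussLk_congr e2, gaussLk_congr e3,
      gaussLk_congr e4]
    · ring
    all_goals
      apply Continuous.intervalIntegrable
      have := hc K1 c1
      have := hc K2 c2
      have := hc K3 c3
      have := hc K4 c4
      fun_prop

lemma gaussLk_cat {e1 e2 e3 f1 f2 f3 f4 : ℝ → E3}
    (he1 : ContDiff ℝ 1 e1) (he2 : ContDiff ℝ 1 e2) (he3 : ContDiff ℝ 1 e3)
    (h1 : ContDiff ℝ 1 f1) (h2 : ContDiff ℝ 1 f2) (h3 : ContDiff ℝ 1 f3) (h4 : ContDiff ℝ 1 f4)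
    (s11 : ESep e1 f1) (s12 : ESep e1 f2) (s13 : ESep e1 f3) (s14 : ESep e1 f4)
    (s21 : ESep e2 f1) (s22 : ESep e2 f2) (s23 : ESep e2 f3) (s24 : ESep e2 f4)
    (s31 : ESep e3 f1) (s32 : ESep e3 f2) (s33 : ESep e3 f3) (s34 : ESep e3 f4) :
    gaussLk (cat3 e1 e2 e3) (cat4 f1 f2 f3 f4) =
      (gaussLk e1 f1 + gaussLk e1 f2 + gaussLk e1 f3 + gaussLk e1 f4) +
      (gaussLk e2 f1 + gaussLk e2 f2 + gaussLk e2 f3 + gaussLk e2 f4) +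
      (gaussLk e3 f1 + gaussLk e3 f2 + gaussLk e3 f3 + gaussLk e3 f4) := by
  obtain ⟨P1, c1, k1, g1⟩ := edge_cat4 he1 h1 h2 h3 h4 s11 s12 s13 s14
  obtain ⟨P2, c2, k2, g2⟩ := edge_cat4 he2 h1 h2 h3 h4 s21 s22 s23 s24
  obtain ⟨P3, c3, k3, g3⟩ := edge_cat4 he3 h1 h2 h3 h4 s31 s32 s33 s34
  rw [← g1, ← g2, ← g3, ← mul_add, ← mul_add]
  unfold gaussLk
  congr 1
  exact cat3_int (fun w p => ∫ t in (0:ℝ)..1, det3 w (deriv (cat4 f1 f2 f3 f4) t)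
      (p - cat4 f1 f2 f3 f4 t) / ‖p - cat4 f1 f2 f3 f4 t‖ ^ 3)
    (fun k w p => by
      rw [← intervalIntegral.integral_const_mul]
      congr 1
      ext t
      rw [← mul_div_assoc]; congr 1; simp [det3]; ring)
    he1 he2 he3 c1 c2 c3 k1 k2 k3

lemma odd_natAbs_sum (n : Fin 3 → Fin 3 → ℤ) (h : Odd (∑ a, ∑ b, n a b)) :
    Odd (∑ a : Fin 3, ∑ b : Fin 3, (n a b).natAbs) := by
  have h1 : ∀ m : ℤ, ∃ k : ℤ, (m.natAbs : ℤ) = m + 2 * k := by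
    intro m
    rcases Int.natAbs_eq m with h | h
    · exact ⟨0, by omega⟩
    · exact ⟨-m, by omega⟩
  choose k hk using h1
  rw [← Int.odd_coe_nat]
  push_cast
  have : ∑ a : Fin 3, ∑ b : Fin 3, |n a b| =
      (∑ a, ∑ b, n a b) + 2 * ∑ a : Fin 3, ∑ b : Fin 3, k (n a b) := by
    simp_rw [Finset.mul_sum, ← Finset.sum_add_distrib]
    refine Finset.sum_congr rfl fun a _ => Finset.sum_congr rfl fun b _ => ?_
    rw [← hk, Int.natCast_natAbs]
  rw [this]
  exact h.add_even (even_two_mul _)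

/-- Index-level form of the boundary angle. -/
lemma bdry_eq (v : Fin 7 → E3) {e f : ℝ → E3} {i j k l : Fin 7} (N : ℕ)
    (e0 : e 0 = v i) (e1 : e 1 = v j) (f0 : f 0 = v k) (f1 : f 1 = v l) :
    bdry N e f = edgeSum N e (v k) - edgeSum N e (v l) + edgeSum N f (v i) - edgeSum N f (v j)
    + kap (v l - v j) + kap (v k - v i) - kap (v k - v j) - kap (v l - v i) := by
  rw [bdry, e0, e1, f0, f1]

lemma half_sum_angle (E : Fin 3 → Fin 3 → Fin 7 → Real.Angle) (κ : Fin 7 → Fin 7 → Real.Angle)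
    (hκ : ∀ i j, i ≠ j → κ i j = κ j i + (Real.pi : Real.Angle))
    (B : Fin 3 → Fin 3 → Fin 3 → Fin 3 → Real.Angle)
    (hB : ∀ a b c d, B a b c d = E a b (odds c) - E a b (evens d) + E c d (odds a) - E c d (evens b)
      + κ (evens d) (evens b) + κ (odds c) (odds a) - κ (odds c) (evens b) - κ (evens d) (odds a)) :
    ∑ a : Fin 3, ∑ b : Fin 3, (B a b (a+1) (b+1) - B a b (a+1) (b+2)) = (Real.pi : Real.Angle) := by
  have t : ∀ a b, B a b (a+1) (b+1) - B a b (a+1) (b+2) =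
      (E a b (evens (b+2)) - E a b (evens (b+1)))
      + (E (a+1) (b+1) (odds a) - E (a+1) (b+2) (odds a))
      + (E (a+1) (b+2) (evens b) - E (a+1) (b+1) (evens b))
      + (κ (evens (b+1)) (evens b) - κ (evens (b+2)) (evens b))
      + (κ (evens (b+2)) (odds a) - κ (evens (b+1)) (odds a)) := by
    intro a b
    rw [hB, hB]; abel
  have hp : (Real.pi : Real.Angle) + (Real.pi : Real.Angle) = 0 := Real.Angle.coe_pi_add_coe_pi
  have n9 : (Real.pi : Real.Angle) = (-9 : ℤ) • (Real.pi : Real.Angle) := by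
    have : (-9 : ℤ) • (Real.pi : Real.Angle) = (Real.pi : Real.Angle) -
      (5 : ℤ) • ((Real.pi : Real.Angle) + (Real.pi : Real.Angle)) := by abel
    rw [this, hp]; simp
  simp_rw [t]
  have k1 : κ (evens 2) (evens 0) = κ (evens 0) (evens 2) + (Real.pi : Real.Angle) :=
    hκ _ _ (by decide)
  have k2 : κ (evens 0) (evens 1) = κ (evens 1) (evens 0) + (Real.pi : Real.Angle) :=
    hκ _ _ (by decide)
  have k3 : κ (evens 1) (evens 2) = κ (evens 2) (evens 1) + (Real.pi : Real.Angle) :=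
    hκ _ _ (by decide)
  have f1 : (1 : Fin 3) + 1 = 2 := rfl
  have f2 : (1 : Fin 3) + 2 = 0 := rfl
  have f3 : (2 : Fin 3) + 1 = 0 := rfl
  have f4 : (2 : Fin 3) + 2 = 1 := rfl
  simp only [Fin.sum_univ_three, zero_add, f1, f2, f3, f4, k1, k2, k3]
  conv_rhs => rw [n9]
  abel
/-- For every embedding of `K₃,₃,₁` in `ℝ³` — given by distinct vertices `v i`
and, for each edge `ij`, a `C¹` arc `γ i j` from `v i` to `v j`, arcs of distinct
edges meeting only at shared endpoints — the sum over the nine 2-component links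
(pairs of disjoint cycles, each a triangle through vertex `7` and its
complementary quadrilateral) of the absolute values of their linking numbers is
odd. -/
theorem total_linking_odd (v : Fin 7 → E3) (γ : Fin 7 → Fin 7 → ℝ → E3)
    (hv : Function.Injective v)
    (hends : ∀ i j, Adj i j → γ i j 0 = v i ∧ γ i j 1 = v j)
    (hsym : ∀ i j, Adj i j → ∀ t, γ j i t = γ i j (1 - t))
    (hsmooth : ∀ i j, Adj i j → ContDiff ℝ 1 (γ i j))
    (hinj : ∀ i j, Adj i j → Set.InjOn (γ i j) (Set.Icc 0 1))
    (hdisj : ∀ i j k l, Adj i j → Adj k l → ({i, j} : Set (Fin 7)) ≠ {k, l} →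
      (γ i j '' Set.Icc 0 1) ∩ (γ k l '' Set.Icc 0 1)
        = v '' (({i, j} : Set (Fin 7)) ∩ {k, l})) :
    ∃ n : Fin 3 → Fin 3 → ℤ,
      (∀ a b : Fin 3, gaussLk (triLoop γ a b) (quadLoop γ a b) = n a b) ∧
      Odd (∑ a : Fin 3, ∑ b : Fin 3, (n a b).natAbs) := by
  have aA : ∀ a, Adj 6 (odds a) := by unfold Adj; decide
  have aB : ∀ a b, Adj (odds a) (evens b) := by unfold Adj; decide
  have aB' : ∀ a b, Adj (evens b) (odds a) := by unfold Adj; decide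
  have aC : ∀ b, Adj (evens b) 6 := by unfold Adj; decide
  have hsep : ∀ i j k l, Adj i j → Adj k l → (i ≠ k ∧ i ≠ l ∧ j ≠ k ∧ j ≠ l) →
      ESep (γ i j) (γ k l) := by
    rintro i j k l hij hkl ⟨h1, h2, h3, h4⟩ s hs t ht heq
    have hne : ({i, j} : Set (Fin 7)) ≠ {k, l} := by
      intro h
      have : i ∈ ({k, l} : Set (Fin 7)) := h ▸ Set.mem_insert i {j}
      rcases this with h | h
      · exact h1 h
      · exact h2 h
    have hmem : γ i j s ∈ (γ i j '' Set.Icc 0 1) ∩ (γ k l '' Set.Icc 0 1) :=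
      ⟨⟨s, hs, rfl⟩, ⟨t, ht, heq.symm⟩⟩
    rw [hdisj i j k l hij hkl hne] at hmem
    obtain ⟨x, ⟨hx1, hx2⟩, _⟩ := hmem
    rcases hx1 with rfl | rfl <;> rcases hx2 with h | h <;> first | exact h1 h | exact h2 h | exact h3 h | exact h4 h
  -- limits of the boundary angles
  have hlim : ∀ i j k l, Adj i j → Adj k l → (i ≠ k ∧ i ≠ l ∧ j ≠ k ∧ j ≠ l) →
      Tendsto (fun N : ℕ => bdry N (γ i j) (γ k l)) atTop
        (𝓝 ((-(2 * Real.pi * gaussLk (γ i j) (γ k l)) : ℝ) : Real.Angle)) :=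
    fun i j k l hij hkl h => bdry_tendsto (hsmooth i j hij) (hsmooth k l hkl) (hsep i j k l hij hkl h)
  have hbd : ∀ i j k l, Adj i j → Adj k l → ∀ N : ℕ, bdry N (γ i j) (γ k l) =
      edgeSum N (γ i j) (v k) - edgeSum N (γ i j) (v l) + edgeSum N (γ k l) (v i)
      - edgeSum N (γ k l) (v j)
      + kap (v l - v j) + kap (v k - v i) - kap (v k - v j) - kap (v l - v i) :=
    fun i j k l hij hkl N => bdry_eq v N (hends i j hij).1 (hends i j hij).2
      (hends k l hkl).1 (hends k l hkl).2
  -- contribution of an edge against the quadrilateral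
  have hrev : ∀ (e : ℝ → E3) a b, gaussLk e (γ (evens b) (odds a)) =
      - gaussLk e (γ (odds a) (evens b)) := by
    intro e a b
    rw [← gaussLk_rev]
    congr 1
    funext t
    exact hsym _ _ (aB a b) t
  set q : (ℝ → E3) → Fin 3 → Fin 3 → ℝ := fun e a b =>
    gaussLk e (γ (odds (a+1)) (evens (b+1))) - gaussLk e (γ (odds (a+2)) (evens (b+1)))
    + gaussLk e (γ (odds (a+2)) (evens (b+2))) - gaussLk e (γ (odds (a+1)) (evens (b+2))) with hq
  -- index disjointness
  have d1 : ∀ a b : Fin 3, ∀ c d : Fin 3, a ≠ c → ((6 : Fin 7) ≠ odds c ∧ (6 : Fin 7) ≠ evens d ∧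
      odds a ≠ odds c ∧ odds a ≠ evens d) := by decide
  have d2 : ∀ a b c d : Fin 3, a ≠ c → b ≠ d → (odds a ≠ odds c ∧ odds a ≠ evens d ∧
      evens b ≠ odds c ∧ evens b ≠ evens d) := by decide
  have d3 : ∀ a b : Fin 3, ∀ c d : Fin 3, b ≠ d → (evens b ≠ odds c ∧ evens b ≠ evens d ∧
      (6 : Fin 7) ≠ odds c ∧ (6 : Fin 7) ≠ evens d) := by decide
  have p1 : ∀ a : Fin 3, a ≠ a + 1 := by decide
  have p2 : ∀ a : Fin 3, a ≠ a + 2 := by decide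
  have sw : ∀ {i j k l : Fin 7}, (i ≠ k ∧ i ≠ l ∧ j ≠ k ∧ j ≠ l) →
      (i ≠ l ∧ i ≠ k ∧ j ≠ l ∧ j ≠ k) := by tauto
  have hlk : ∀ a b, gaussLk (triLoop γ a b) (quadLoop γ a b) =
      q (γ 6 (odds a)) a b + q (γ (odds a) (evens b)) a b + q (γ (evens b) 6) a b := by
    intro a b
    have := gaussLk_cat (hsmooth _ _ (aA a)) (hsmooth _ _ (aB a b)) (hsmooth _ _ (aC b))
      (hsmooth _ _ (aB (a+1) (b+1))) (hsmooth _ _ (aB' (a+2) (b+1)))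
      (hsmooth _ _ (aB (a+2) (b+2))) (hsmooth _ _ (aB' (a+1) (b+2)))
      (hsep _ _ _ _ (aA a) (aB _ _) (d1 a b _ _ (p1 a)))
      (hsep _ _ _ _ (aA a) (aB' _ _) (sw (d1 a b _ _ (p2 a))))
      (hsep _ _ _ _ (aA a) (aB _ _) (d1 a b _ _ (p2 a)))
      (hsep _ _ _ _ (aA a) (aB' _ _) (sw (d1 a b _ _ (p1 a))))
      (hsep _ _ _ _ (aB a b) (aB _ _) (d2 a b _ _ (p1 a) (p1 b)))
      (hsep _ _ _ _ (aB a b) (aB' _ _) (sw (d2 a b _ _ (p2 a) (p1 b))))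
      (hsep _ _ _ _ (aB a b) (aB _ _) (d2 a b _ _ (p2 a) (p2 b)))
      (hsep _ _ _ _ (aB a b) (aB' _ _) (sw (d2 a b _ _ (p1 a) (p2 b))))
      (hsep _ _ _ _ (aC b) (aB _ _) (d3 a b _ _ (p1 b)))
      (hsep _ _ _ _ (aC b) (aB' _ _) (sw (d3 a b _ _ (p1 b))))
      (hsep _ _ _ _ (aC b) (aB _ _) (d3 a b _ _ (p2 b)))
      (hsep _ _ _ _ (aC b) (aB' _ _) (sw (d3 a b _ _ (p2 b))))
    have h2 : gaussLk (triLoop γ a b) (quadLoop γ a b) = _ := this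
    rw [h2]
    simp only [hrev, hq]
    ring
  -- the limiting angle of an edge against the quadrilateral
  have hql : ∀ i j a b, Adj i j →
      (∀ c d, a ≠ c → b ≠ d → (i ≠ odds c ∧ i ≠ evens d ∧ j ≠ odds c ∧ j ≠ evens d)) →
      Tendsto (fun N : ℕ => bdry N (γ i j) (γ (odds (a+1)) (evens (b+1)))
        - bdry N (γ i j) (γ (odds (a+2)) (evens (b+1)))
        + bdry N (γ i j) (γ (odds (a+2)) (evens (b+2)))
        - bdry N (γ i j) (γ (odds (a+1)) (evens (b+2)))) atTop
        (𝓝 ((-(2 * Real.pi * q (γ i j) a b) : ℝ) : Real.Angle)) := by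
    intro i j a b hij hd
    have := (((hlim _ _ _ _ hij (aB (a+1) (b+1)) (hd _ _ (p1 a) (p1 b))).sub
      (hlim _ _ _ _ hij (aB (a+2) (b+1)) (hd _ _ (p2 a) (p1 b)))).add
      (hlim _ _ _ _ hij (aB (a+2) (b+2)) (hd _ _ (p2 a) (p2 b)))).sub
      (hlim _ _ _ _ hij (aB (a+1) (b+2)) (hd _ _ (p1 a) (p2 b)))
    rw [← Real.Angle.coe_sub, ← Real.Angle.coe_add, ← Real.Angle.coe_sub] at this
    convert this using 3
    simp only [hq]
    ring
  have hint : ∀ a b, ∃ n : ℤ, gaussLk (triLoop γ a b) (quadLoop γ a b) = n := by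
    intro a b
    have h1 := ((hql 6 (odds a) a b (aA a) (fun c d h _ => d1 a b c d h)).add
      (hql (odds a) (evens b) a b (aB a b) (fun c d h h' => d2 a b c d h h'))).add
      (hql (evens b) 6 a b (aC b) (fun c d _ h => d3 a b c d h))
    rw [← Real.Angle.coe_add, ← Real.Angle.coe_add] at h1
    have h0 : (((-(2 * Real.pi * q (γ 6 (odds a)) a b) + -(2 * Real.pi * q (γ (odds a) (evens b)) a b)
        + -(2 * Real.pi * q (γ (evens b) 6) a b) : ℝ)) : Real.Angle) = 0 := by
      refine tendsto_nhds_unique h1 (tendsto_const_nhds.congr fun N => ?_)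
      simp only [hbd _ _ _ _ (aA a) (aB _ _), hbd _ _ _ _ (aB a b) (aB _ _),
        hbd _ _ _ _ (aC b) (aB _ _)]
      abel
    rw [Real.Angle.coe_eq_zero_iff] at h0
    obtain ⟨m, hm⟩ := h0
    refine ⟨-m, ?_⟩
    rw [hlk]
    rw [zsmul_eq_mul] at hm
    have hpi := Real.pi_pos
    have : 2 * Real.pi * (q (γ 6 (odds a)) a b + q (γ (odds a) (evens b)) a b
        + q (γ (evens b) 6) a b) = 2 * Real.pi * ((-m : ℤ) : ℝ) := by
      push_cast; linarith
    exact mul_left_cancel₀ (by positivity) this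
  choose n hn using hint
  refine ⟨n, hn, odd_natAbs_sum n ?_⟩
  -- parity
  set g : Fin 3 → Fin 3 → Fin 3 → Fin 3 → ℝ := fun a b c d =>
    gaussLk (γ (odds a) (evens b)) (γ (odds c) (evens d)) with hg
  set S : ℝ := ∑ a : Fin 3, ∑ b : Fin 3, (g a b (a+1) (b+1) - g a b (a+1) (b+2)) with hS
  have gs : ∀ a b c d, a ≠ c → b ≠ d → g c d a b = g a b c d := by
    intro a b c d h h'
    exact gaussLk_symm (hsmooth _ _ (aB a b)) (hsmooth _ _ (aB c d))
      (hsep _ _ _ _ (aB a b) (aB c d) (d2 a b c d h h'))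
  have f1 : (1 : Fin 3) + 1 = 2 := rfl
  have f2 : (1 : Fin 3) + 2 = 0 := rfl
  have f3 : (2 : Fin 3) + 1 = 0 := rfl
  have f4 : (2 : Fin 3) + 2 = 1 := rfl
  have hsumA : ∀ a, ∑ b : Fin 3, q (γ 6 (odds a)) a b = 0 := by
    intro a
    simp only [hq, Fin.sum_univ_three, zero_add, f1, f2, f3, f4]
    ring
  have hsumC : ∀ b, ∑ a : Fin 3, q (γ (evens b) 6) a b = 0 := by
    intro b
    simp only [hq, Fin.sum_univ_three, zero_add, f1, f2, f3, f4]
    ring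
  have hqg : ∀ a b, q (γ (odds a) (evens b)) a b =
      (g a b (a+1) (b+1) - g a b (a+1) (b+2)) +
      (g (a+2) (b+2) a b - g (a+2) (b+1) a b) := by
    intro a b
    rw [gs a b (a+2) (b+2) (p2 a) (p2 b), gs a b (a+2) (b+1) (p2 a) (p1 b)]
    simp only [hq, hg]; ring
  have hsumS : ∑ a : Fin 3, ∑ b : Fin 3, (g (a+2) (b+2) a b - g (a+2) (b+1) a b) = S := by
    simp only [hS, Fin.sum_univ_three, zero_add, f1, f2, f3, f4]
    ring
  have htot : ((∑ a, ∑ b, n a b : ℤ) : ℝ) = 2 * S := by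
    push_cast
    simp_rw [← hn, hlk, Finset.sum_add_distrib, hsumA]
    rw [Finset.sum_comm (f := fun a b => q (γ (evens b) 6) a b)]
    simp_rw [hsumC, hqg, Finset.sum_add_distrib]
    rw [hsumS]
    simp only [Finset.sum_const_zero]
    rw [← hS]
    ring
  have hSl : Tendsto (fun N : ℕ => ∑ a : Fin 3, ∑ b : Fin 3,
      (bdry N (γ (odds a) (evens b)) (γ (odds (a+1)) (evens (b+1))) -
       bdry N (γ (odds a) (evens b)) (γ (odds (a+1)) (evens (b+2))))) atTop
      (𝓝 ((-(2 * Real.pi * S) : ℝ) : Real.Angle)) := by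
    have : ((-(2 * Real.pi * S) : ℝ) : Real.Angle) = ∑ a : Fin 3, ∑ b : Fin 3,
        (((-(2 * Real.pi * g a b (a+1) (b+1)) : ℝ) : Real.Angle) -
          ((-(2 * Real.pi * g a b (a+1) (b+2)) : ℝ) : Real.Angle)) := by
      simp_rw [← Real.Angle.coe_sub, ← Real.Angle.coe_coeHom, ← map_sum]
      congr 1
      simp only [hS, Finset.mul_sum, ← Finset.sum_neg_distrib]
      refine Finset.sum_congr rfl fun a _ => Finset.sum_congr rfl fun b _ => ?_
      ring
    rw [this]
    refine tendsto_finsetSum _ fun a _ => tendsto_finsetSum _ fun b _ => ?_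
    exact (hlim _ _ _ _ (aB a b) (aB (a+1) (b+1)) (d2 _ _ _ _ (p1 a) (p1 b))).sub
      (hlim _ _ _ _ (aB a b) (aB (a+1) (b+2)) (d2 _ _ _ _ (p1 a) (p2 b)))
  have hfin : ((-(2 * Real.pi * S) : ℝ) : Real.Angle) = (Real.pi : Real.Angle) := by
    refine tendsto_nhds_unique hSl (tendsto_const_nhds.congr fun N => ?_)
    symm
    apply half_sum_angle (fun a b x => edgeSum N (γ (odds a) (evens b)) (v x))
      (fun i j => kap (v i - v j)) ?_
      (fun a b c d => bdry N (γ (odds a) (evens b)) (γ (odds c) (evens d)))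
    · intro a b c d
      exact hbd _ _ _ _ (aB a b) (aB c d) N
    · intro i j hij
      have : v j - v i ≠ 0 := by
        rw [sub_ne_zero]; exact fun h => hij (hv h).symm
      rw [← kap_neg this, neg_sub]
  rw [Real.Angle.angle_eq_iff_two_pi_dvd_sub] at hfin
  obtain ⟨k, hk⟩ := hfin
  refine ⟨-k - 1, ?_⟩
  have hpi := Real.pi_pos
  have h3 : Real.pi * (2 * S) = Real.pi * ((2 * (-k - 1) + 1 : ℤ) : ℝ) := by
    push_cast; linarith
  have h4 := mul_left_cancel₀ hpi.ne' h3
  rw [← htot] at h4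
  exact_mod_cast h4

end
end

section
/- In any geodesic immersion of K_{3,3} in the 2-sphere with no three vertices on a common great circle, at least two edges have no crossings with any other edge. -/
open scoped Classical

noncomputable section

/-- The interior of the shortest geodesic arc joining `X` and `Y` on the unit
sphere: normalizations of strictly positive combinations of `X` and `Y`. -/
def ArcInt (X Y : E3) : Set E3 :=
  {z | ∃ a b : ℝ, 0 < a ∧ 0 < b ∧ z = ‖a • X + b • Y‖⁻¹ • (a • X + b • Y)}

/-- Two geodesic edges `XY` and `ZW` on the sphere cross if they share a point
interior to both. -/
def Crosses (X Y Z W : E3) : Prop := (ArcInt X Y ∩ ArcInt Z W).Nonempty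

/-- Vertices of `K₃,₃`: indices `0,2,4` form one part (labels `1,3,5`). -/
def oI : Fin 3 → Fin 6 := ![0, 2, 4]

/-- Indices `1,3,5` form the other part (labels `2,4,6`). -/
def eI : Fin 3 → Fin 6 := ![1, 3, 5]

/-- A geodesic immersion of `K₃,₃` in the unit sphere: all vertices are unit
vectors and no three of them lie on a common great circle. -/
def GoodImm (v : Fin 6 → E3) : Prop :=
  (∀ i, ‖v i‖ = 1) ∧
    ∀ i j k : Fin 6, i ≠ j → i ≠ k → j ≠ k → LinearIndependent ℝ ![v i, v j, v k]

/-- The number of crossings of the immersion: the number of unordered pairs of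
disjoint edges whose geodesic arcs cross.  An edge is a pair `(a, b)`, joining
vertex `oI a` to vertex `eI b`. -/
def crossingCount (v : Fin 6 → E3) : ℕ :=
  (Finset.univ.filter fun p : (Fin 3 × Fin 3) × (Fin 3 × Fin 3) =>
    p.1.1 < p.2.1 ∧ p.1.2 ≠ p.2.2 ∧
      Crosses (v (oI p.1.1)) (v (eI p.1.2)) (v (oI p.2.1)) (v (eI p.2.2))).card

/-- The edge `(a,b)` of `K₃,₃` has no crossings with any other edge. -/
def EdgeFree (v : Fin 6 → E3) (p : Fin 3 × Fin 3) : Prop :=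
  ∀ q : Fin 3 × Fin 3, q ≠ p →
    ¬ Crosses (v (oI p.1)) (v (eI p.2)) (v (oI q.1)) (v (eI q.2))

namespace K33aux

/-- Conjunction over the two Booleans. -/
def alB (f : Bool → Bool) : Bool := cond (f true) (f false) false

/-- Lazy implication. -/
def impB (a b : Bool) : Bool := cond a b true

/-- Not all three signs agree. -/
def nasB (x y z : Bool) : Bool := cond x (cond y (!z) true) (cond y true z)

/-- The sign condition for a crossing of two disjoint edges. -/
def cb (x y p q : Bool) : Bool :=
  cond x (cond y (cond p q false) false) (cond y false (cond p false (!q)))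

/-- An edge is free when its four potential crossings do not occur. -/
def frB (a b c d : Bool) : Bool :=
  cond a false (cond b false (cond c false (!d)))

/-- At least one of the Booleans in the list holds. -/
def oneB : List Bool → Bool
  | [] => false
  | a :: t => cond a true (oneB t)

/-- At least two of nine Booleans hold. -/
def twoB (a b c d e f g h i : Bool) : Bool :=
  cond a (oneB [b, c, d, e, f, g, h, i]) <|
  cond b (oneB [c, d, e, f, g, h, i]) <|
  cond c (oneB [d, e, f, g, h, i]) <|
  cond d (oneB [e, f, g, h, i]) <|
  cond e (oneB [f, g, h, i]) <|
  cond f (oneB [g, h, i]) <|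
  cond g (oneB [h, i]) <|
  cond h i false

/-- The free-edge count at a full sign pattern. -/
def leafB (s00 s01 s02 s10 s11 s12 s20 s21 s22 m0101 m0102 m0112 m0201 m0202 m0212 m1201 m1202 m1212 : Bool) : Bool :=
  twoB
    (frB (cb s02 s12 (!m0102) m0112) (cb s02 s22 (!m0202) m0212) (cb s01 s11 (!m0101) (!m0112)) (cb s01 s21 (!m0201) (!m0212)))
    (frB (cb s12 s02 m0102 (!m0112)) (cb s12 s22 (!m1202) m1212) (cb s11 s01 m0101 m0112) (cb s11 s21 (!m1201) (!m1212)))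
    (frB (cb s22 s02 m0202 (!m0212)) (cb s22 s12 m1202 (!m1212)) (cb s21 s01 m0201 m0212) (cb s21 s11 m1201 m1212))
    (frB (cb s12 s02 m0102 (!m0112)) (cb s22 s02 m0202 (!m0212)) (cb s00 s10 m0101 (!m0102)) (cb s00 s20 m0201 (!m0202)))
    (frB (cb s02 s12 (!m0102) m0112) (cb s22 s12 m1202 (!m1212)) (cb s10 s00 (!m0101) m0102) (cb s10 s20 m1201 (!m1202)))
    (frB (cb s02 s22 (!m0202) m0212) (cb s12 s22 (!m1202) m1212) (cb s20 s00 (!m0201) m0202) (cb s20 s10 (!m1201) m1202))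
    (frB (cb s11 s01 m0101 m0112) (cb s21 s01 m0201 m0212) (cb s10 s00 (!m0101) m0102) (cb s20 s00 (!m0201) m0202))
    (frB (cb s01 s11 (!m0101) (!m0112)) (cb s21 s11 m1201 m1212) (cb s00 s10 m0101 (!m0102)) (cb s20 s10 (!m1201) m1202))
    (frB (cb s01 s21 (!m0201) (!m0212)) (cb s11 s21 (!m1201) (!m1212)) (cb s00 s20 m0201 (!m0202)) (cb s10 s20 m1201 (!m1202)))

/-- The search over all sign patterns, pruned by the sign relations. -/
def checkB : Bool :=
  alB fun s00 => alB fun s01 => alB fun s02 => alB fun s10 => alB fun s11 => alB fun s12 => alB fun s20 => alB fun s21 => alB fun s22 =>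
  alB fun m0101 =>
  impB (nasB (s00 == s11) (!(s01 == s10)) (!m0101)) <|
  alB fun m0102 =>
  impB (nasB (s00 == s12) (!(s02 == s10)) (!m0102)) <|
  alB fun m0112 =>
  impB (nasB (s01 == s12) (!(s02 == s11)) (!m0112)) <|
  impB (nasB ((s00 == m0112)) (!(s01 == m0102)) ((s02 == m0101))) <|
  impB (nasB ((s10 == m0112)) (!(s11 == m0102)) ((s12 == m0101))) <|
  alB fun m0201 =>
  impB (nasB (s00 == s21) (!(s01 == s20)) (!m0201)) <|
  alB fun m0202 =>
  impB (nasB (s00 == s22) (!(s02 == s20)) (!m0202)) <|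
  alB fun m0212 =>
  impB (nasB (s01 == s22) (!(s02 == s21)) (!m0212)) <|
  impB (nasB ((s00 == m0212)) (!(s01 == m0202)) ((s02 == m0201))) <|
  impB (nasB ((s20 == m0212)) (!(s21 == m0202)) ((s22 == m0201))) <|
  alB fun m1201 =>
  impB (nasB (s10 == s21) (!(s11 == s20)) (!m1201)) <|
  impB (nasB ((s00 == m1201)) (!(s10 == m0201)) ((s20 == m0101))) <|
  impB (nasB ((s01 == m1201)) (!(s11 == m0201)) ((s21 == m0101))) <|
  alB fun m1202 =>
  impB (nasB (s10 == s22) (!(s12 == s20)) (!m1202)) <|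
  impB (nasB ((s00 == m1202)) (!(s10 == m0202)) ((s20 == m0102))) <|
  impB (nasB ((s02 == m1202)) (!(s12 == m0202)) ((s22 == m0102))) <|
  alB fun m1212 =>
  impB (nasB (s11 == s22) (!(s12 == s21)) (!m1212)) <|
  impB (nasB ((s10 == m1212)) (!(s11 == m1202)) ((s12 == m1201))) <|
  impB (nasB ((s01 == m1212)) (!(s11 == m0212)) ((s21 == m0112))) <|
  impB (nasB ((s20 == m1212)) (!(s21 == m1202)) ((s22 == m1201))) <|
  impB (nasB ((s02 == m1212)) (!(s12 == m0212)) ((s22 == m0112))) <|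
  leafB s00 s01 s02 s10 s11 s12 s20 s21 s22 m0101 m0102 m0112 m0201 m0202 m0212 m1201 m1202 m1212

set_option maxRecDepth 100000 in
theorem checkB_true : checkB = true := by decide +kernel

theorem alB_iff (f : Bool → Bool) : alB f = true ↔ ∀ b, f b = true := by
  unfold alB
  constructor
  · intro h b
    cases h1 : f true <;> cases b <;> simp_all
  · intro h
    simp [h]

theorem impB_iff (a b : Bool) : impB a b = true ↔ (a = true → b = true) := by
  cases a <;> simp [impB]

theorem twoB_spec (F : Fin 3 → Fin 3 → Bool)
    (h : twoB (F 0 0) (F 0 1) (F 0 2) (F 1 0) (F 1 1) (F 1 2) (F 2 0) (F 2 1) (F 2 2) = true) :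
    ∃ p q : Fin 3 × Fin 3, p ≠ q ∧ F p.1 p.2 = true ∧ F q.1 q.2 = true := by
  have hc : ∀ a b c : Bool, cond a b c = true → (a = true ∧ b = true) ∨ c = true := by decide
  have ho : ∀ a t, oneB (a :: t) = true → a = true ∨ oneB t = true := by
    intro a t h
    cases a
    · exact Or.inr h
    · exact Or.inl rfl
  have fin : ∀ i j k l : Fin 3, ((i, j) : Fin 3 × Fin 3) ≠ (k, l) → F i j = true → F k l = true →
      ∃ p q : Fin 3 × Fin 3, p ≠ q ∧ F p.1 p.2 = true ∧ F q.1 q.2 = true :=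
    fun i j k l h1 h2 h3 => ⟨(i, j), (k, l), h1, h2, h3⟩
  unfold twoB at h
  iterate 8
    rcases hc _ _ _ h with ⟨h0, h1⟩ | h
    · first
        | exact fin _ _ _ _ (by decide) h0 h1
        | (repeat
            rcases ho _ _ h1 with h2 | h1
            · exact fin _ _ _ _ (by decide) h0 h2
           exact absurd h1 (by decide))
  exact absurd h (by decide)

/-- The sign of a nonzero real, as a Boolean. -/
def S (x : ℝ) : Bool := decide (0 < x)

/-- The two by two minors. -/
def D (M : Fin 3 → Fin 3 → ℝ) (j l i k : Fin 3) : ℝ := M j i * M l k - M j k * M l i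

theorem S_neg {x : ℝ} (hx : x ≠ 0) : S (-x) = !S x := by
  unfold S
  rcases lt_or_gt_of_ne hx with h | h
  · simp [h, h.le]
  · simp [h, h.le]

theorem S_mul {x y : ℝ} (hx : x ≠ 0) (hy : y ≠ 0) : S (x * y) = (S x == S y) := by
  unfold S
  rcases lt_or_gt_of_ne hx with h | h <;> rcases lt_or_gt_of_ne hy with h' | h'
  · simp [h.not_gt, h'.not_gt, mul_pos_of_neg_of_neg h h']
  · simp [h.not_gt, h', (mul_neg_of_neg_of_pos h h').not_gt]
  · simp [h'.not_gt, h, (mul_neg_of_pos_of_neg h h').not_gt]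
  · simp [h, h', mul_pos h h']

theorem nasB_S {x y z : ℝ} (hx : x ≠ 0) (hy : y ≠ 0) (hz : z ≠ 0) (h : x + y + z = 0) :
    nasB (S x) (S y) (S z) = true := by
  unfold S nasB
  rcases lt_or_gt_of_ne hx with h1 | h1 <;> rcases lt_or_gt_of_ne hy with h2 | h2 <;>
    rcases lt_or_gt_of_ne hz with h3 | h3 <;>
    first
      | (exfalso; linarith)
      | simp [h1, h2, h3, h1.le, h2.le, h3.le]

theorem nas_minor {a b c d : ℝ} (ha : a ≠ 0) (hb : b ≠ 0) (hc : c ≠ 0) (hd : d ≠ 0)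
    {m : ℝ} (hm : m ≠ 0) (h : m = a * d - b * c) :
    nasB (S a == S d) (!(S b == S c)) (!S m) = true := by
  rw [← S_mul ha hd, ← S_mul hb hc, ← S_neg (mul_ne_zero hb hc), ← S_neg hm]
  exact nasB_S (mul_ne_zero ha hd) (neg_ne_zero.2 (mul_ne_zero hb hc)) (neg_ne_zero.2 hm)
    (by rw [h]; ring)

theorem nas_rel {a b c x y z : ℝ} (ha : a ≠ 0) (hb : b ≠ 0) (hc : c ≠ 0)
    (hx : x ≠ 0) (hy : y ≠ 0) (hz : z ≠ 0) (h : a * x - b * y + c * z = 0) :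
    nasB (S a == S x) (!(S b == S y)) (S c == S z) = true := by
  rw [← S_mul ha hx, ← S_mul hb hy, ← S_neg (mul_ne_zero hb hy), ← S_mul hc hz]
  exact nasB_S (mul_ne_zero ha hx) (neg_ne_zero.2 (mul_ne_zero hb hy)) (mul_ne_zero hc hz)
    (by linarith)

/-- Boolean crossing indicator read off the matrix. -/
def crM (M : Fin 3 → Fin 3 → ℝ) (n i j k l : Fin 3) : Bool :=
  cb (S (M j n)) (S (M l n)) (S (D M l j i n)) (S (D M j l k n))

theorem cb_swap (x y p q : Bool) : cb x y p q = cb y x q p := by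
  revert x y p q; decide

theorem crM_swap (M : Fin 3 → Fin 3 → ℝ) (n i j k l : Fin 3) :
    crM M n i j k l = crM M n k l i j := cb_swap _ _ _ _

/-- Free-edge indicator read off the matrix. -/
def frM (M : Fin 3 → Fin 3 → ℝ) : Fin 3 → Fin 3 → Bool :=
  ![
    ![frB (crM M 2 0 0 1 1) (crM M 2 0 0 1 2) (crM M 1 0 0 2 1) (crM M 1 0 0 2 2),
      frB (crM M 2 0 1 1 0) (crM M 2 0 1 1 2) (crM M 1 0 1 2 0) (crM M 1 0 1 2 2),
      frB (crM M 2 0 2 1 0) (crM M 2 0 2 1 1) (crM M 1 0 2 2 0) (crM M 1 0 2 2 1)],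
    ![frB (crM M 2 0 1 1 0) (crM M 2 0 2 1 0) (crM M 0 1 0 2 1) (crM M 0 1 0 2 2),
      frB (crM M 2 0 0 1 1) (crM M 2 0 2 1 1) (crM M 0 1 1 2 0) (crM M 0 1 1 2 2),
      frB (crM M 2 0 0 1 2) (crM M 2 0 1 1 2) (crM M 0 1 2 2 0) (crM M 0 1 2 2 1)],
    ![frB (crM M 1 0 1 2 0) (crM M 1 0 2 2 0) (crM M 0 1 1 2 0) (crM M 0 1 2 2 0),
      frB (crM M 1 0 0 2 1) (crM M 1 0 2 2 1) (crM M 0 1 0 2 1) (crM M 0 1 2 2 1),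
      frB (crM M 1 0 0 2 2) (crM M 1 0 1 2 2) (crM M 0 1 0 2 2) (crM M 0 1 1 2 2)]]

theorem leaf_matrix (M : Fin 3 → Fin 3 → ℝ) (hM : ∀ j i, M j i ≠ 0)
    (hD : ∀ j l i k, j ≠ l → i ≠ k → D M j l i k ≠ 0) :
    leafB (S (M 0 0)) (S (M 0 1)) (S (M 0 2)) (S (M 1 0)) (S (M 1 1)) (S (M 1 2)) (S (M 2 0)) (S (M 2 1)) (S (M 2 2))
    (S (D M 0 1 0 1)) (S (D M 0 1 0 2)) (S (D M 0 1 1 2)) (S (D M 0 2 0 1)) (S (D M 0 2 0 2)) (S (D M 0 2 1 2)) (S (D M 1 2 0 1)) (S (D M 1 2 0 2)) (S (D M 1 2 1 2)) = true := by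
  have hc := checkB_true
  unfold checkB at hc
  simp only [alB_iff, impB_iff] at hc
  apply hc
  all_goals
    first
      | exact nas_minor (hM _ _) (hM _ _) (hM _ _) (hM _ _) (hD _ _ _ _ (by decide) (by decide)) rfl
      | (refine nas_rel (hM _ _) (hM _ _) (hM _ _) (hD _ _ _ _ (by decide) (by decide))
          (hD _ _ _ _ (by decide) (by decide)) (hD _ _ _ _ (by decide) (by decide)) ?_
         simp only [D]
         ring)

theorem matrix_free (M : Fin 3 → Fin 3 → ℝ) (hM : ∀ j i, M j i ≠ 0)
    (hD : ∀ j l i k, j ≠ l → i ≠ k → D M j l i k ≠ 0) :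
    ∃ p q : Fin 3 × Fin 3, p ≠ q ∧ frM M p.1 p.2 = true ∧ frM M q.1 q.2 = true := by
  apply twoB_spec
  have h := leaf_matrix M hM hD
  have r : ∀ i k, i ≠ k → ∀ j l, j ≠ l → S (D M l j i k) = !S (D M j l i k) := by
    intro i k hik j l hjl
    rw [← S_neg (hD j l i k hjl hik)]
    congr 1
    simp only [D]; ring
  have c : ∀ i k, i ≠ k → ∀ j l, j ≠ l → S (D M j l k i) = !S (D M j l i k) := by
    intro i k hik j l hjl
    rw [← S_neg (hD j l i k hjl hik)]
    congr 1
    simp only [D]; ring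
  have r1 := fun i k hik => r i k hik 0 1 (by decide)
  have r2 := fun i k hik => r i k hik 0 2 (by decide)
  have r3 := fun i k hik => r i k hik 1 2 (by decide)
  have c1 := c 0 1 (by decide)
  have c2 := c 0 2 (by decide)
  have c3 := c 1 2 (by decide)
  unfold leafB at h
  simp only [frM, crM]
  simp (discharger := decide) only [r1, r2, r3, c1, c2, c3, Bool.not_not, Matrix.cons_val]
  exact h

theorem frM_spec (M : Fin 3 → Fin 3 → ℝ) (i j : Fin 3) (h : frM M i j = true)
    (k l n : Fin 3) (hk : k ≠ i) (hl : l ≠ j) (hn : n ≠ i) (hn' : n ≠ k) :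
    crM M n i j k l = false := by
  have fs : ∀ a b c d, frB a b c d = true → a = false ∧ b = false ∧ c = false ∧ d = false := by
    decide
  fin_cases i <;> fin_cases j <;>
    (obtain ⟨h1, h2, h3, h4⟩ := fs _ _ _ _ h
     fin_cases k <;> first | exact absurd rfl hk | skip
     all_goals (fin_cases n <;> first | exact absurd rfl hn | exact absurd rfl hn' | skip)
     all_goals (fin_cases l <;> first | exact absurd rfl hl | skip)
     all_goals
      first
        | exact h1
        | exact h2
        | exact h3
        | exact h4
        | exact (crM_swap _ _ _ _ _ _).trans h1
        | exact (crM_swap _ _ _ _ _ _).trans h2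
        | exact (crM_swap _ _ _ _ _ _).trans h3
        | exact (crM_swap _ _ _ _ _ _).trans h4)

/-- A crossing gives the corresponding sign conditions. -/
theorem crM_of_eq (M : Fin 3 → Fin 3 → ℝ) (hM : ∀ j i, M j i ≠ 0) (n i j k l : Fin 3)
    (hjl : j ≠ l) (hD : ∀ j l i k, j ≠ l → i ≠ k → D M j l i k ≠ 0) (hni : n ≠ i) (hnk : n ≠ k)
    {a b c d : ℝ} (ha : 0 < a) (hb : 0 < b) (hc : 0 < c) (hd : 0 < d)
    (en : b * M j n = d * M l n) (ei : a + b * M j i = d * M l i)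
    (ek : b * M j k = c + d * M l k) : crM M n i j k l = true := by
  -- b * D l j i n = b * M l i * M j n - b * M l n * M j i
  have e1 : b * D M l j i n = M l n * a := by
    have : b * D M l j i n = M l i * (b * M j n) - M l n * (b * M j i) := by
      simp only [D]; ring
    rw [this, en]
    have : b * M j i = d * M l i - a := by linarith
    rw [this]; ring
  have e2 : d * D M j l k n = M j n * c := by
    have : d * D M j l k n = M j k * (d * M l n) - M j n * (d * M l k) := by
      simp only [D]; ring
    rw [this, ← en]
    have : d * M l k = b * M j k - c := by linarith
    rw [this]; ring
  have st : ∀ x : ℝ, 0 < x → S x = true := fun x hx => by simp [S, hx]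
  have t1 : S (M j n) = S (M l n) := by
    have := congrArg S en
    rw [S_mul hb.ne' (hM _ _), S_mul hd.ne' (hM _ _), st b hb, st d hd] at this
    simpa using this
  have t2 : S (D M l j i n) = S (M l n) := by
    have := congrArg S e1
    rw [S_mul hb.ne' (hD _ _ _ _ hjl.symm hni.symm), S_mul (hM _ _) ha.ne', st b hb, st a ha] at this
    simpa using this
  have t3 : S (D M j l k n) = S (M j n) := by
    have := congrArg S e2
    rw [S_mul hd.ne' (hD _ _ _ _ hjl hnk.symm), S_mul (hM _ _) hc.ne', st d hd, st c hc] at this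
    simpa using this
  unfold crM
  rw [t2, t3, t1]
  cases S (M l n) <;> rfl

theorem crosses_pos {X Y Z W : E3} (hXY : ∀ a b : ℝ, 0 < a → a • X + b • Y ≠ 0)
    (hZW : ∀ a b : ℝ, 0 < a → a • Z + b • W ≠ 0) (h : Crosses X Y Z W) :
    ∃ a b c d : ℝ, 0 < a ∧ 0 < b ∧ 0 < c ∧ 0 < d ∧ a • X + b • Y = c • Z + d • W := by
  obtain ⟨z, ⟨a, b, ha, hb, h1⟩, ⟨c, d, hc, hd, h2⟩⟩ := h
  have n1 : 0 < ‖a • X + b • Y‖⁻¹ := inv_pos.2 (norm_pos_iff.2 (hXY a b ha))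
  have n2 : 0 < ‖c • Z + d • W‖⁻¹ := inv_pos.2 (norm_pos_iff.2 (hZW c d hc))
  refine ⟨_ * a, _ * b, _ * c, _ * d, mul_pos n1 ha, mul_pos n1 hb, mul_pos n2 hc, mul_pos n2 hd, ?_⟩
  rw [mul_smul, mul_smul, mul_smul, mul_smul, ← smul_add, ← smul_add, ← h1, ← h2]

theorem oI_inj : ∀ a b, oI a = oI b → a = b := by decide
theorem eI_inj : ∀ a b, eI a = eI b → a = b := by decide
theorem oI_ne_eI : ∀ a b, oI a ≠ eI b := by decide

theorem indep_zero {x y z : E3} (h : LinearIndependent ℝ ![x, y, z]) (a b c : ℝ)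
    (e : a • x + b • y + c • z = 0) : a = 0 ∧ b = 0 ∧ c = 0 := by
  have := Fintype.linearIndependent_iff.1 h ![a, b, c] (by simpa [Fin.sum_univ_three] using e)
  exact ⟨this 0, this 1, this 2⟩

theorem third_index : ∀ i k : Fin 3, ∃ n, n ≠ i ∧ n ≠ k := by decide

theorem sum_third (i k n : Fin 3) (hik : i ≠ k) (hni : n ≠ i) (hnk : n ≠ k) (f : Fin 3 → E3) :
    ∑ t, f t = f i + f k + f n := by
  rw [Fin.sum_univ_three]
  fin_cases i <;> fin_cases k <;> fin_cases n <;> simp at hik hni hnk ⊢ <;> abel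

theorem two_others : ∀ i : Fin 3, ∃ k n, i ≠ k ∧ n ≠ i ∧ n ≠ k := by decide

end K33aux

open K33aux in
/-- In any geodesic immersion of `K₃,₃` in the sphere with no three vertices on a
common great circle, at least two edges have no crossings with any other edge. -/
theorem K33_two_crossingless_edges (v : Fin 6 → E3) (h : GoodImm v) :
    ∃ p q : Fin 3 × Fin 3, p ≠ q ∧ EdgeFree v p ∧ EdgeFree v q := by
  obtain ⟨-, hI⟩ := h
  have ind := fun i j k hij hik hjk => indep_zero (hI i j k hij hik hjk)
  -- coordinates of the even vertices with respect to the odd ones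
  have hb : LinearIndependent ℝ (fun a => v (oI a)) := by
    have := hI 0 2 4 (by decide) (by decide) (by decide)
    convert this using 1
    funext a
    fin_cases a <;> rfl
  let B := basisOfLinearIndependentOfCardEqFinrank hb (by simp)
  have hB : ∀ a, B a = v (oI a) := fun a => by simp [B]
  obtain ⟨M, hM⟩ : ∃ M : Fin 3 → Fin 3 → ℝ, ∀ j, v (eI j) = ∑ i, M j i • v (oI i) :=
    ⟨fun j i => B.repr (v (eI j)) i, fun j => by
      simp only [← hB]; exact (B.sum_repr _).symm⟩
  have oo : ∀ {a b}, a ≠ b → oI a ≠ oI b := fun hab e => hab (oI_inj _ _ e)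
  have ee : ∀ {a b}, a ≠ b → eI a ≠ eI b := fun hab e => hab (eI_inj _ _ e)
  have oe : ∀ a b, eI a ≠ oI b := fun a b e => oI_ne_eI b a e.symm
  have hM0 : ∀ j i, M j i ≠ 0 := by
    intro j i h0
    obtain ⟨k, n, hik, hni, hnk⟩ := two_others i
    have e := hM j
    rw [sum_third i k n hik hni hnk, h0] at e
    have := ind (eI j) (oI k) (oI n) (oe _ _) (oe _ _) (oo hnk.symm) 1 (-M j k) (-M j n)
      (by rw [e]; module)
    exact one_ne_zero this.1
  have hD : ∀ j l i k, j ≠ l → i ≠ k → D M j l i k ≠ 0 := by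
    intro j l i k hjl hik h0
    obtain ⟨n, hni, hnk⟩ := third_index i k
    have e := hM j
    have e' := hM l
    rw [sum_third i k n hik hni hnk] at e e'
    have := ind (eI j) (eI l) (oI n) (ee hjl) (oe _ _) (oe _ _) (M l i) (-M j i)
      (-(M l i * M j n - M j i * M l n))
      (by
        rw [e, e']
        have h1 : M j i * M l k = M j k * M l i := sub_eq_zero.1 h0
        have : M l i • (M j i • v (oI i) + M j k • v (oI k) + M j n • v (oI n)) +
          (-M j i) • (M l i • v (oI i) + M l k • v (oI k) + M l n • v (oI n)) +
          (-(M l i * M j n - M j i * M l n)) • v (oI n)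
          = (M j k * M l i - M j i * M l k) • v (oI k) := by module
        rw [this, h1, sub_self, zero_smul])
    exact hM0 l i this.1
  -- a free edge of the matrix is a free edge of the immersion
  have key : ∀ p : Fin 3 × Fin 3, frM M p.1 p.2 = true → EdgeFree v p := by
    rintro ⟨i, j⟩ hf ⟨k, l⟩ hne hcr
    simp only at hf hcr
    have nz : ∀ i j, ∀ a b : ℝ, 0 < a → a • v (oI i) + b • v (eI j) ≠ 0 := by
      intro i j a b ha e
      obtain ⟨k, n, hik, hni, hnk⟩ := two_others i
      have := ind (oI i) (eI j) (oI k) (oI_ne_eI _ _) (oo hik) (oe _ _) a b 0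
        (by rw [e]; simp)
      exact ha.ne' this.1
    obtain ⟨a, b, c, d, ha, hb', hc, hd, e⟩ := crosses_pos (nz i j) (nz k l) hcr
    by_cases hik : k = i
    · subst hik
      have hl : l ≠ j := fun hl => hne (by rw [hl])
      have := ind (oI k) (eI j) (eI l) (oI_ne_eI _ _) (oI_ne_eI _ _) (ee hl.symm) (a - c) b (-d)
        (by
          have : (a - c) • v (oI k) + b • v (eI j) + (-d) • v (eI l)
            = (a • v (oI k) + b • v (eI j)) - (c • v (oI k) + d • v (eI l)) := by module
          rw [this, e, sub_self])
      exact hb'.ne' this.2.1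
    by_cases hl : l = j
    · subst hl
      have := ind (oI i) (oI k) (eI l) (oo (Ne.symm hik)) (oI_ne_eI _ _) (oI_ne_eI _ _) a (-c) (b - d)
        (by
          have : a • v (oI i) + (-c) • v (oI k) + (b - d) • v (eI l)
            = (a • v (oI i) + b • v (eI l)) - (c • v (oI k) + d • v (eI l)) := by module
          rw [this, e, sub_self])
      exact ha.ne' this.1
    obtain ⟨n, hni, hnk⟩ := third_index i k
    have e1 := hM j
    have e2 := hM l
    rw [sum_third i k n (Ne.symm hik) hni hnk] at e1 e2
    rw [e1, e2] at e
    have := ind (oI i) (oI k) (oI n) (oo (Ne.symm hik)) (oo hni.symm) (oo hnk.symm)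
      (a + b * M j i - d * M l i) (b * M j k - c - d * M l k) (b * M j n - d * M l n)
      (by
        have e3 := sub_eq_zero.2 e
        rw [← e3]
        module)
    have hcr' := crM_of_eq M hM0 n i j k l (Ne.symm hl) hD hni hnk ha hb' hc hd
      (by linarith [this.2.2]) (by linarith [this.1]) (by linarith [this.2.1])
    rw [frM_spec M i j hf k l n hik hl hni hnk] at hcr'
    exact Bool.false_ne_true hcr'
  obtain ⟨p, q, hpq, hp, hq⟩ := matrix_free M hM0 hD
  exact ⟨p, q, hpq, key p hp, key q hq⟩

end
end

section
/- Every geodesic immersion of K_{3,3} in the 2-sphere with no three vertices on a common great circle has an odd number of edge crossings. -/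
open scoped Classical

noncomputable section

set_option linter.unusedSimpArgs false

def ng (x : ℝ) : ZMod 2 := if x < 0 then 1 else 0

lemma ng_neg {x : ℝ} (h : x < 0) : ng x = 1 := by simp [ng, h]
lemma ng_pos {x : ℝ} (h : 0 < x) : ng x = 0 := by simp [ng, h.le]

lemma ng_mul {x y : ℝ} (hx : x ≠ 0) (hy : y ≠ 0) : ng (x * y) = ng x + ng y := by
  rcases lt_or_gt_of_ne hx with h | h <;> rcases lt_or_gt_of_ne hy with k | k
  · rw [ng_neg h, ng_neg k, ng_pos (mul_pos_of_neg_of_neg h k)]; decide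
  · rw [ng_neg h, ng_pos k, ng_neg (mul_neg_of_neg_of_pos h k)]; decide
  · rw [ng_pos h, ng_neg k, ng_neg (mul_neg_of_pos_of_neg h k)]; decide
  · rw [ng_pos h, ng_pos k, ng_pos (mul_pos h k)]; decide

lemma ng_opp {x : ℝ} (hx : x ≠ 0) : ng (-x) = 1 + ng x := by
  have := ng_mul (x := -1) (by norm_num) hx
  rw [ng_neg (x := -1) (by norm_num)] at this
  simpa using this

/-- Normalized sign identity. -/
lemma core_norm (x y z w : ℝ) (hx : x ≠ 0) (hy : y ≠ 0) (hz : z ≠ 0) (hw : w ≠ 0)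
    (D d12 d13 d21 d22 d23 d31 d32 d33 : ℝ)
    (e : D = x * w - y * z) (e12 : d12 = y - w) (e13 : d13 = z - x) (e21 : d21 = z - w)
    (e22 : d22 = w - 1) (e23 : d23 = 1 - z) (e31 : d31 = y - x) (e32 : d32 = 1 - y)
    (e33 : d33 = x - 1) :
    ng x * (ng D + ng d13 + ng d31 + ng d33) + ng y * (ng D + ng d12 + ng d31 + ng d32)
      + ng z * (ng D + ng d13 + ng d21 + ng d23)
      + ng w * (ng D + ng d12 + ng d21 + ng d22) = 0 := by
  have P13 : (x < 0 → 0 < z → ng d13 = 0) ∧ (0 < x → z < 0 → ng d13 = 1) :=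
    ⟨fun _ _ => ng_pos (by linarith), fun _ _ => ng_neg (by linarith)⟩
  have P12 : (w < 0 → 0 < y → ng d12 = 0) ∧ (0 < w → y < 0 → ng d12 = 1) :=
    ⟨fun _ _ => ng_pos (by linarith), fun _ _ => ng_neg (by linarith)⟩
  have P21 : (w < 0 → 0 < z → ng d21 = 0) ∧ (0 < w → z < 0 → ng d21 = 1) :=
    ⟨fun _ _ => ng_pos (by linarith), fun _ _ => ng_neg (by linarith)⟩
  have P31 : (x < 0 → 0 < y → ng d31 = 0) ∧ (0 < x → y < 0 → ng d31 = 1) :=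
    ⟨fun _ _ => ng_pos (by linarith), fun _ _ => ng_neg (by linarith)⟩
  have P22 : w < 0 → ng d22 = 1 := fun _ => ng_neg (by linarith)
  have P33 : x < 0 → ng d33 = 1 := fun _ => ng_neg (by linarith)
  have P23 : z < 0 → ng d23 = 0 := fun _ => ng_pos (by linarith)
  have P32 : y < 0 → ng d32 = 0 := fun _ => ng_pos (by linarith)
  have PD : (x * w < 0 → 0 < y * z → ng D = 1) ∧ (0 < x * w → y * z < 0 → ng D = 0) :=
    ⟨fun _ _ => ng_neg (by linarith), fun _ _ => ng_pos (by linarith)⟩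
  clear e e12 e13 e21 e22 e23 e31 e32 e33
  rcases lt_or_gt_of_ne hx with h1 | h1 <;> rcases lt_or_gt_of_ne hy with h2 | h2 <;>
  rcases lt_or_gt_of_ne hz with h3 | h3 <;> rcases lt_or_gt_of_ne hw with h4 | h4 <;>
  simp only [mul_pos_of_neg_of_neg, mul_neg_of_neg_of_pos, mul_neg_of_pos_of_neg, mul_pos,
    ng_neg, ng_pos, h1, h2, h3, h4, forall_true_left] at * <;>
  simp only [*, one_mul, zero_mul, zero_add, add_zero] <;> ring_nf <;> reduce_mod_char

lemma core (r1 r2 r3 c2 c3 x y z w : ℝ) (hr1 : r1 ≠ 0) (hr2 : r2 ≠ 0) (hr3 : r3 ≠ 0)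
    (hc2 : c2 ≠ 0) (hc3 : c3 ≠ 0) (hx : x ≠ 0) (hy : y ≠ 0) (hz : z ≠ 0) (hw : w ≠ 0)
    (b : Fin 3 → Fin 3 → ℝ)
    (h00 : b 0 0 = r1) (h01 : b 0 1 = r1 * c2) (h02 : b 0 2 = r1 * c3)
    (h10 : b 1 0 = r2) (h11 : b 1 1 = r2 * c2 * x) (h12 : b 1 2 = r2 * c3 * y)
    (h20 : b 2 0 = r3) (h21 : b 2 1 = r3 * c2 * z) (h22 : b 2 2 = r3 * c3 * w)
    (N : Fin 3 → Fin 3 → ℝ) (hN0 : ∀ r m, N r m ≠ 0)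
    (hN : ∀ r m, N r m = b (r+1) (m+1) * b (r+2) (m+2) - b (r+1) (m+2) * b (r+2) (m+1)) :
    ∑ r : Fin 3, ∑ m : Fin 3, (1 + ng (b (r+1) m) + ng (b (r+2) m)) *
      (1 + ng (N r (m+1)) + ng (N r (m+2))) = 1 := by
  have H := core_norm x y z w hx hy hz hw _ _ _ _ _ _ _ _ _ rfl rfl rfl rfl rfl rfl rfl rfl rfl
  have f1 : (1:Fin 3)+1 = 2 := rfl
  have f2 : (1:Fin 3)+2 = 0 := rfl
  have f3 : (2:Fin 3)+1 = 0 := rfl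
  have f4 : (2:Fin 3)+2 = 1 := rfl
  have m00 : N 0 0 = r2 * r3 * c2 * c3 * (x * w - y * z) := by
    rw [hN]; simp only [f1,f2,f3,f4,zero_add, *]; ring
  have m01 : N 0 1 = r2 * r3 * c3 * (y - w) := by
    rw [hN]; simp only [f1,f2,f3,f4,zero_add, *]; ring
  have m02 : N 0 2 = r2 * r3 * c2 * (z - x) := by
    rw [hN]; simp only [f1,f2,f3,f4,zero_add, *]; ring
  have m10 : N 1 0 = r1 * r3 * c2 * c3 * (z - w) := by
    rw [hN]; simp only [f1,f2,f3,f4,zero_add, *]; ring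
  have m11 : N 1 1 = r1 * r3 * c3 * (w - 1) := by
    rw [hN]; simp only [f1,f2,f3,f4,zero_add, *]; ring
  have m12 : N 1 2 = r1 * r3 * c2 * (1 - z) := by
    rw [hN]; simp only [f1,f2,f3,f4,zero_add, *]; ring
  have m20 : N 2 0 = r1 * r2 * c2 * c3 * (y - x) := by
    rw [hN]; simp only [f1,f2,f3,f4,zero_add, *]; ring
  have m21 : N 2 1 = r1 * r2 * c3 * (1 - y) := by
    rw [hN]; simp only [f1,f2,f3,f4,zero_add, *]; ring
  have m22 : N 2 2 = r1 * r2 * c2 * (x - 1) := by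
    rw [hN]; simp only [f1,f2,f3,f4,zero_add, *]; ring
  have k00 := hN0 0 0
  have k01 := hN0 0 1
  have k02 := hN0 0 2
  have k10 := hN0 1 0
  have k11 := hN0 1 1
  have k12 := hN0 1 2
  have k20 := hN0 2 0
  have k21 := hN0 2 1
  have k22 := hN0 2 2
  rw [m00] at k00
  rw [m01] at k01
  rw [m02] at k02
  rw [m10] at k10
  rw [m11] at k11
  rw [m12] at k12
  rw [m20] at k20
  rw [m21] at k21
  rw [m22] at k22
  have q3 : ∀ {a b c : ℝ}, a * b * c ≠ 0 → ng (a * b * c) = ng a + ng b + ng c := by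
    intro a b c h
    have h' := mul_ne_zero_iff.1 h
    rw [ng_mul h'.1 h'.2, ng_mul (mul_ne_zero_iff.1 h'.1).1 (mul_ne_zero_iff.1 h'.1).2]
  have q4 : ∀ {a b c d : ℝ}, a * b * c * d ≠ 0 →
      ng (a * b * c * d) = ng a + ng b + ng c + ng d := by
    intro a b c d h
    have h' := mul_ne_zero_iff.1 h
    rw [ng_mul h'.1 h'.2, q3 h'.1]
  have q5 : ∀ {a b c d e : ℝ}, a * b * c * d * e ≠ 0 →
      ng (a * b * c * d * e) = ng a + ng b + ng c + ng d + ng e := by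
    intro a b c d e h
    have h' := mul_ne_zero_iff.1 h
    rw [ng_mul h'.1 h'.2, q4 h'.1]
  simp only [Fin.sum_univ_three, f1, f2, f3, f4, zero_add, m00, m01, m02, m10, m11, m12, m20,
    m21, m22, q5 k00, q4 k01, q4 k02, q5 k10, q4 k11, q4 k12, q5 k20, q4 k21, q4 k22,
    h00, h01, h02, h10, h11, h12, h20, h21, h22, ng_mul hr1 hc2, ng_mul hr1 hc3,
    q3 (mul_ne_zero (mul_ne_zero hr2 hc2) hx), q3 (mul_ne_zero (mul_ne_zero hr2 hc3) hy),
    q3 (mul_ne_zero (mul_ne_zero hr3 hc2) hz), q3 (mul_ne_zero (mul_ne_zero hr3 hc3) hw)]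
  clear * - H
  generalize ng (x * w - y * z) = n00 at *
  generalize ng (y - w) = n01 at *
  generalize ng (z - x) = n02 at *
  generalize ng (z - w) = n10 at *
  generalize ng (w - 1) = n11 at *
  generalize ng (1 - z) = n12 at *
  generalize ng (y - x) = n20 at *
  generalize ng (1 - y) = n21 at *
  generalize ng (x - 1) = n22 at *
  generalize ng x = x at *
  generalize ng y = y at *
  generalize ng z = z at *
  generalize ng w = w at *
  generalize ng r1 = r1 at *
  generalize ng r2 = r2 at *
  generalize ng r3 = r3 at *
  generalize ng c2 = c2 at *
  generalize ng c3 = c3 at *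
  rw [← sub_eq_zero, ← H, ← sub_eq_zero]
  ring_nf
  reduce_mod_char

lemma k33_sign_sum (b : Fin 3 → Fin 3 → ℝ) (hb : ∀ r m, b r m ≠ 0)
    (N : Fin 3 → Fin 3 → ℝ) (hN0 : ∀ r m, N r m ≠ 0)
    (hN : ∀ r m, N r m = b (r+1) (m+1) * b (r+2) (m+2) - b (r+1) (m+2) * b (r+2) (m+1)) :
    ∑ r : Fin 3, ∑ m : Fin 3, (1 + ng (b (r+1) m) + ng (b (r+2) m)) *
      (1 + ng (N r (m+1)) + ng (N r (m+2))) = 1 := by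
  have h := hb
  have n00 := hb 0 0
  have n01 := hb 0 1
  have n02 := hb 0 2
  have n10 := hb 1 0
  have n11 := hb 1 1
  have n12 := hb 1 2
  have n20 := hb 2 0
  have n21 := hb 2 1
  have n22 := hb 2 2
  refine core (b 0 0) (b 1 0) (b 2 0) (b 0 1 / b 0 0) (b 0 2 / b 0 0)
    (b 1 1 * b 0 0 / (b 1 0 * b 0 1)) (b 1 2 * b 0 0 / (b 1 0 * b 0 2))
    (b 2 1 * b 0 0 / (b 2 0 * b 0 1)) (b 2 2 * b 0 0 / (b 2 0 * b 0 2))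
    ?_ ?_ ?_ ?_ ?_ ?_ ?_ ?_ ?_ b ?_ ?_ ?_ ?_ ?_ ?_ ?_ ?_ ?_ N hN0 hN <;>
  first | positivity | (field_simp)

lemma li_zero {X Z U : E3} (h : LinearIndependent ℝ ![X, Z, U]) {a b c : ℝ}
    (e : a • X + b • Z + c • U = 0) : a = 0 ∧ b = 0 ∧ c = 0 := by
  rw [Fintype.linearIndependent_iff] at h
  have := h ![a, b, c] (by simpa [Fin.sum_univ_three] using e)
  exact ⟨this 0, this 1, this 2⟩

lemma crosses_iff {X Z U Y W : E3} (h : LinearIndependent ℝ ![X, Z, U])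
    {y1 y2 y3 w1 w2 w3 : ℝ} (hY : Y = y1 • X + y2 • Z + y3 • U)
    (hW : W = w1 • X + w2 • Z + w3 • U) (hy : y3 ≠ 0) (hw : w3 ≠ 0) :
    Crosses X Y Z W ↔ 0 < y3 * w3 ∧ 0 < (y3 * w1 - y1 * w3) * y3 ∧
      0 < (y2 * w3 - y3 * w2) * y3 := by
  have nz : ∀ {a b : ℝ}, 0 < b → a • X + b • Y ≠ 0 := by
    intro a b hb e
    have := li_zero h (a := a + b * y1) (b := b * y2) (c := b * y3)
      (by rw [← e, hY]; module)
    exact (mul_ne_zero hb.ne' hy) this.2.2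
  have nz' : ∀ {a b : ℝ}, 0 < b → a • Z + b • W ≠ 0 := by
    intro a b hb e
    have := li_zero h (a := b * w1) (b := a + b * w2) (c := b * w3)
      (by rw [← e, hW]; module)
    exact (mul_ne_zero hb.ne' hw) this.2.2
  constructor
  · rintro ⟨p, ⟨a, b, ha, hb, e1⟩, ⟨c, d, hc, hd, e2⟩⟩
    have s1 : 0 < ‖a • X + b • Y‖⁻¹ := inv_pos.2 (norm_pos_iff.2 (nz hb))
    have s2 : 0 < ‖c • Z + d • W‖⁻¹ := inv_pos.2 (norm_pos_iff.2 (nz' hd))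
    have e := e1.symm.trans e2
    generalize ‖a • X + b • Y‖⁻¹ = s at *
    generalize ‖c • Z + d • W‖⁻¹ = t at *
    obtain ⟨q1, q2, q3⟩ := li_zero h (a := s * a + (s * b) * y1 - (t * d) * w1)
      (b := (s * b) * y2 - t * c - (t * d) * w2) (c := (s * b) * y3 - (t * d) * w3)
      (by rw [← sub_eq_zero] at e; rw [← e, hY, hW]; module)
    have ha' := mul_pos s1 ha
    have hb' := mul_pos s1 hb
    have hc' := mul_pos s2 hc
    have hd' := mul_pos s2 hd
    generalize s * a = a' at *
    generalize s * b = b' at *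
    generalize t * c = c' at *
    generalize t * d = d' at *
    have hy2 : 0 < y3 * y3 := mul_self_pos.2 hy
    have hw2 : 0 < w3 * w3 := mul_self_pos.2 hw
    refine ⟨?_, ?_, ?_⟩
    · have : b' * (y3 * w3) = d' * (w3 * w3) := by linear_combination w3 * q3
      exact pos_of_mul_pos_right (this ▸ mul_pos hd' hw2) hb'.le
    · have : d' * ((y3 * w1 - y1 * w3) * y3) = a' * (y3 * y3) := by
        linear_combination (-y3 * y3) * q1 + y1 * y3 * q3
      exact pos_of_mul_pos_right (this ▸ mul_pos ha' hy2) hd'.le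
    · have : d' * ((y2 * w3 - y3 * w2) * y3) = c' * (y3 * y3) := by
        linear_combination (y3 * y3) * q2 - y2 * y3 * q3
      exact pos_of_mul_pos_right (this ▸ mul_pos hc' hy2) hd'.le
  · rintro ⟨h1, h2, h3⟩
    have hy2 : 0 < y3 * y3 := mul_self_pos.2 hy
    refine ⟨_, ⟨(y3 * w1 - y1 * w3) * y3, y3 * w3, h2, h1, rfl⟩,
      ⟨(y2 * w3 - y3 * w2) * y3, y3 * y3, h3, hy2, ?_⟩⟩
    have : ((y3 * w1 - y1 * w3) * y3) • X + (y3 * w3) • Y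
        = ((y2 * w3 - y3 * w2) * y3) • Z + (y3 * y3) • W := by
      rw [hY, hW]; module
    rw [this]

lemma pair {X Z U Y W : E3} (h : LinearIndependent ℝ ![X, Z, U])
    {y1 y2 y3 w1 w2 w3 : ℝ} (hY : Y = y1 • X + y2 • Z + y3 • U)
    (hW : W = w1 • X + w2 • Z + w3 • U) (hy : y3 ≠ 0) (hw : w3 ≠ 0)
    (hM : y3 * w1 - y1 * w3 ≠ 0) (hM' : y2 * w3 - y3 * w2 ≠ 0) :
    (if Crosses X Y Z W then (1 : ZMod 2) else 0) + (if Crosses X W Z Y then 1 else 0)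
      = (1 + ng y3 + ng w3) * (1 + ng (y2 * w3 - y3 * w2) + ng (y3 * w1 - y1 * w3)) := by
  have e1 := crosses_iff h hY hW hy hw
  have e2 := crosses_iff h hW hY hw hy
  rw [show w3 * y1 - w1 * y3 = -(y3 * w1 - y1 * w3) by ring,
    show w2 * y3 - w3 * y2 = -(y2 * w3 - y3 * w2) by ring, mul_comm w3 y3] at e2
  simp only [e1, e2, mul_pos_iff]
  generalize y3 * w1 - y1 * w3 = M at *
  generalize y2 * w3 - y3 * w2 = M' at *
  have two : (1 : ZMod 2) + 1 = 0 := by decide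
  rcases lt_or_gt_of_ne hy with h1 | h1 <;> rcases lt_or_gt_of_ne hw with h2 | h2 <;>
  rcases lt_or_gt_of_ne hM with h3 | h3 <;> rcases lt_or_gt_of_ne hM' with h4 | h4 <;>
  simp [ng_neg, ng_pos, h1, h2, h3, h4, h1.le, h2.le, h3.le, h4.le, h1.not_gt, h2.not_gt,
    h3.not_gt, h4.not_gt, mul_pos_iff, two]

lemma coord_ne {X Z U Y : E3} (h : LinearIndependent ℝ ![X, Z, Y])
    {y1 y2 y3 : ℝ} (hY : Y = y1 • X + y2 • Z + y3 • U) : y3 ≠ 0 := by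
  rintro rfl
  have := li_zero h (a := y1) (b := y2) (c := -1) (by rw [hY]; module)
  norm_num at this

lemma minor_ne {X Z U Y W : E3} (h : LinearIndependent ℝ ![X, Y, W])
    {y1 y2 y3 w1 w2 w3 : ℝ} (hY : Y = y1 • X + y2 • Z + y3 • U)
    (hW : W = w1 • X + w2 • Z + w3 • U) (hw : w3 ≠ 0) : y2 * w3 - y3 * w2 ≠ 0 := by
  intro e
  have := li_zero h (a := y3 * w1 - y1 * w3) (b := w3) (c := -y3) (by
    have : y2 * w3 = y3 * w2 := by linarith
    have e3 : (y3 * w1 - y1 * w3) • X + w3 • Y + -y3 • W = (y2 * w3 - y3 * w2) • Z := by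
      rw [hY, hW]; module
    rw [e3, e, zero_smul])
  exact hw this.2.1

lemma exists_coord {X Z U : E3} (h : LinearIndependent ℝ ![X, Z, U]) (Y : E3) :
    ∃ c : Fin 3 → ℝ, Y = c 0 • X + c 1 • Z + c 2 • U := by
  let B := basisOfLinearIndependentOfCardEqFinrank h (by simp)
  refine ⟨fun i => B.repr Y i, ?_⟩
  have hB : ⇑B = ![X, Z, U] := coe_basisOfLinearIndependentOfCardEqFinrank h _
  have hs := B.sum_repr Y
  rw [Fin.sum_univ_three, hB] at hs
  exact hs.symm

/-- Every geodesic immersion of `K₃,₃` in the sphere with no three vertices on a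
common great circle has an odd number of edge crossings. -/
theorem K33_odd_crossings (v : Fin 6 → E3) (h : GoodImm v) :
    Odd (crossingCount v) := by
  obtain ⟨-, hl⟩ := h
  have L := fun i j k (hh : i ≠ j ∧ i ≠ k ∧ j ≠ k) => hl i j k hh.1 hh.2.1 hh.2.2
  have ex : ∀ j : Fin 3, ∃ c : Fin 3 → ℝ,
      v (eI j) = c 0 • v (oI 0) + c 1 • v (oI 1) + c 2 • v (oI 2) :=
    fun j => exists_coord (L (oI 0) (oI 1) (oI 2) (by decide)) _
  choose b hb using ex
  have g1 : ∀ j, v (eI j) = b j 0 • v (oI 0) + b j 2 • v (oI 2) + b j 1 • v (oI 1) :=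
    fun j => by rw [hb j]; abel
  have g0 : ∀ j, v (eI j) = b j 1 • v (oI 1) + b j 2 • v (oI 2) + b j 0 • v (oI 0) :=
    fun j => by rw [hb j]; abel
  have d01 : ∀ j, oI 0 ≠ oI 1 ∧ oI 0 ≠ eI j ∧ oI 1 ≠ eI j := by decide
  have d02 : ∀ j, oI 0 ≠ oI 2 ∧ oI 0 ≠ eI j ∧ oI 2 ≠ eI j := by decide
  have d12 : ∀ j, oI 1 ≠ oI 2 ∧ oI 1 ≠ eI j ∧ oI 2 ≠ eI j := by decide
  have b2 : ∀ j, b j 2 ≠ 0 := fun j => coord_ne (L _ _ _ (d01 j)) (hb j)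
  have b1 : ∀ j, b j 1 ≠ 0 := fun j => coord_ne (L _ _ _ (d02 j)) (g1 j)
  have b0 : ∀ j, b j 0 ≠ 0 := fun j => coord_ne (L _ _ _ (d12 j)) (g0 j)
  have dd : ∀ i j k, j ≠ k → oI i ≠ eI j ∧ oI i ≠ eI k ∧ eI j ≠ eI k := by decide
  have M0 : ∀ j k, j ≠ k → b j 1 * b k 2 - b j 2 * b k 1 ≠ 0 := fun j k hjk =>
    minor_ne (L _ _ _ (dd 0 j k hjk)) (hb j) (hb k) (b2 k)
  have M1 : ∀ j k, j ≠ k → b j 2 * b k 0 - b j 0 * b k 2 ≠ 0 := fun j k hjk =>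
    minor_ne (L _ _ _ (dd 1 j k hjk))
      (show v (eI j) = b j 1 • v (oI 1) + b j 2 • v (oI 2) + b j 0 • v (oI 0) from g0 j)
      (g0 k) (b0 k)
  have M2 : ∀ j k, j ≠ k → b j 0 * b k 1 - b j 1 * b k 0 ≠ 0 := fun j k hjk =>
    minor_ne (L _ _ _ (dd 2 j k hjk))
      (show v (eI j) = b j 2 • v (oI 2) + b j 0 • v (oI 0) + b j 1 • v (oI 1) by
        rw [hb j]; abel)
      (show v (eI k) = b k 2 • v (oI 2) + b k 0 • v (oI 0) + b k 1 • v (oI 1) by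
        rw [hb k]; abel) (b1 k)
  have P2 := fun j k (hjk : j ≠ k) => pair (L (oI 0) (oI 1) (oI 2) (by decide)) (hb j) (hb k)
    (b2 j) (b2 k) (M1 j k hjk) (M0 j k hjk)
  have P0 := fun j k (hjk : j ≠ k) => pair (L (oI 1) (oI 2) (oI 0) (by decide)) (g0 j) (g0 k)
    (b0 j) (b0 k) (M2 j k hjk) (M1 j k hjk)
  have two : (2 : ZMod 2) = 0 := by decide
  have P1 : ∀ j k, j ≠ k → (if Crosses (v (oI 0)) (v (eI j)) (v (oI 2)) (v (eI k))
      then (1 : ZMod 2) else 0)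
      + (if Crosses (v (oI 0)) (v (eI k)) (v (oI 2)) (v (eI j)) then 1 else 0)
      = (1 + ng (b j 1) + ng (b k 1)) * (1 + ng (b j 1 * b k 2 - b j 2 * b k 1)
        + ng (b j 0 * b k 1 - b j 1 * b k 0)) := by
    intro j k hjk
    have n0 : b j 2 * b k 1 - b j 1 * b k 2 = -(b j 1 * b k 2 - b j 2 * b k 1) := by ring
    have n2 : b j 1 * b k 0 - b j 0 * b k 1 = -(b j 0 * b k 1 - b j 1 * b k 0) := by ring
    have p := pair (L (oI 0) (oI 2) (oI 1) (by decide)) (g1 j) (g1 k)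
      (b1 j) (b1 k) (by rw [n2]; exact neg_ne_zero.2 (M2 j k hjk))
      (by rw [n0]; exact neg_ne_zero.2 (M0 j k hjk))
    rw [n0, n2, ng_opp (M0 j k hjk), ng_opp (M2 j k hjk)] at p
    rw [p]
    linear_combination (1 + ng (b j 1) + ng (b k 1)) * two
  have S := k33_sign_sum b (fun r m => by fin_cases m; exacts [b0 r, b1 r, b2 r])
    (fun r m => b (r+1) (m+1) * b (r+2) (m+2) - b (r+1) (m+2) * b (r+2) (m+1))
    (fun r m => by
      have : r + 1 ≠ r + 2 := by revert r; decide
      fin_cases m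
      exacts [M0 _ _ this, M1 _ _ this, M2 _ _ this]) (fun _ _ => rfl)
  rw [← ZMod.natCast_eq_one_iff_odd, ← S, crossingCount, Finset.card_filter]
  push_cast
  have f1 : (1:Fin 3)+1 = 2 := rfl
  have f2 : (1:Fin 3)+2 = 0 := rfl
  have f3 : (2:Fin 3)+1 = 0 := rfl
  have f4 : (2:Fin 3)+2 = 1 := rfl
  have l01 : (0 : Fin 3) < 1 := by decide
  have l02 : (0 : Fin 3) < 2 := by decide
  have l12 : (1 : Fin 3) < 2 := by decide
  have k01 : (0 : Fin 3) ≠ 1 := by decide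
  have k02 : (0 : Fin 3) ≠ 2 := by decide
  have k12 : (1 : Fin 3) ≠ 2 := by decide
  simp only [Fintype.sum_prod_type, Fin.sum_univ_three, f1, f2, f3, f4, zero_add, l01, l02, l12,
    l01.not_gt, l02.not_gt, l12.not_gt, lt_irrefl, k01, k02, k12, k01.symm, k02.symm, k12.symm,
    ne_eq, not_true_eq_false, not_false_eq_true, true_and, false_and, and_false, if_false,
    add_zero]
  linear_combination P2 0 1 k01 + P2 1 2 k12 + P2 2 0 k02.symm + P1 0 1 k01 + P1 1 2 k12
    + P1 2 0 k02.symm + P0 0 1 k01 + P0 1 2 k12 + P0 2 0 k02.symm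

end
end
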